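/- arXiv:2601.21442 — 8 statements merged into one kernel-verified Lean document; each statement's English description precedes it below -/
import Mathlib

section
/- Let d be a positive integer and let ψ > 1 be the unique positive real solution of ψ^d = ψ^{d-1} + 1. If {a_n}_{n=1}^∞ is a monotonically increasing (i.e., non-decreasing) sequence of positive integers satisfying lim_{n→∞} a_n^{1/ψ^n} = ∞, then the sum ∑_{n=1}^∞ 1/(a_n · a_{n+1} · ⋯ · a_{n+d-1}) is an irrational number. -/
open Filter Topology

/-- The function `x ↦ exp x / x` is non-decreasing on `[1, ∞)`. -/
lemma exp_sub_le_div {x y : ℝ} (hx : 1 ≤ x) (hxy : x ≤ y) : Real.exp (x - y) ≤ x / y := by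
  have hy : 0 < y := by linarith
  have h : y / x ≤ Real.exp (y - x) := by
    refine le_trans ?_ (Real.add_one_le_exp (y - x))
    rw [div_le_iff₀ (by linarith)]
    nlinarith [mul_nonneg (sub_nonneg.2 hx) (sub_nonneg.2 hxy)]
  rw [← neg_sub, Real.exp_neg, ← inv_div]
  exact inv_anti₀ (by positivity) h

/-- If a sum of reciprocals of positive integers is a rational number with denominator `q`, then its
tail after clearing `q` and a common multiple of the leading denominators is at least `1`. -/
lemma one_le_mul_tsum_tail {b : ℕ → ℕ} (hb : ∀ n, 0 < b n)
    (hsum : Summable fun n => 1 / (b n : ℝ)) {r : ℚ} (hr : (r : ℝ) = ∑' n, 1 / (b n : ℝ))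
    {N A : ℕ} (hA : 0 < A) (hdvd : ∀ n < N, b n ∣ A) :
    1 ≤ (r.den : ℝ) * (A * ∑' n, 1 / (b (n + N) : ℝ)) := by
  have hpos : 0 < ∑' n, 1 / (b (n + N) : ℝ) := by
    refine ((summable_nat_add_iff N).2 hsum).tsum_pos (fun n => by positivity) 0 ?_
    have := hb (0 + N)
    positivity
  have hden : (r.den : ℝ) * r = r.num := by
    exact_mod_cast Rat.den_mul_eq_num r
  obtain ⟨H, hH⟩ : ∃ H : ℕ, (A : ℝ) * ∑ n ∈ Finset.range N, 1 / (b n : ℝ) = H := by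
    refine ⟨∑ n ∈ Finset.range N, A / b n, ?_⟩
    rw [Finset.mul_sum]
    push_cast
    refine Finset.sum_congr rfl fun n hn => ?_
    rw [Nat.cast_div (hdvd n (Finset.mem_range.1 hn)) (by exact_mod_cast (hb n).ne')]
    ring
  have hint : (r.den : ℝ) * (A * ∑' n, 1 / (b (n + N) : ℝ))
      = ((A * r.num - r.den * H : ℤ) : ℝ) := by
    have hsplit := hsum.sum_add_tsum_nat_add N
    rw [← hr] at hsplit
    push_cast
    rw [← hH, ← hden, ← hsplit]
    ring
  have hA' : (0 : ℝ) < A := by exact_mod_cast hA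
  have hd' : (0 : ℝ) < r.den := by exact_mod_cast r.den_pos
  have h0 : 0 < (r.den : ℝ) * (A * ∑' n, 1 / (b (n + N) : ℝ)) := by positivity
  rw [hint] at h0 ⊢
  exact_mod_cast h0

/-- Reciprocals of a sequence growing at least as fast as `exp (ψ ^ k)` and bounded below by its
value at `m` decay geometrically. -/
lemma one_div_le_geometric {ψ : ℝ} (hψ : 1 < ψ) {a : ℕ → ℕ} {m k : ℕ} (hm : 0 < a m)
    (hmk : a m ≤ a k) (hLm : 1 ≤ Real.log (a m)) (hk : ψ ^ k ≤ Real.log (a k)) :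
    1 / (a k : ℝ) ≤ Real.log (a m) / a m * (1 / ψ) ^ k := by
  have hm' : (0 : ℝ) < a m := by exact_mod_cast hm
  have hmk' : (a m : ℝ) ≤ a k := by exact_mod_cast hmk
  have hlog := Real.log_le_log hm' hmk'
  have h := exp_sub_le_div hLm hlog
  rw [Real.exp_sub, Real.exp_log hm', Real.exp_log (by linarith)] at h
  have h' : (a m : ℝ) / a k ≤ Real.log (a m) / ψ ^ k :=
    h.trans (div_le_div_of_nonneg_left (by linarith) (by positivity) hk)
  calc 1 / (a k : ℝ) = (a m : ℝ) / a k / a m := by field_simp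
    _ ≤ Real.log (a m) / ψ ^ k / a m := by gcongr
    _ = _ := by rw [one_div, inv_pow]; ring

/-- Partial sums of powers of the root of `ψ ^ (e + 1) = ψ ^ e + 1`. -/
lemma sum_pow_succ_eq {ψ : ℝ} {e : ℕ} (h : ψ ^ (e + 1) = ψ ^ e + 1) (N : ℕ) :
    ∑ i ∈ Finset.range N, ψ ^ (i + 1) = ψ ^ (N + e + 1) - ψ ^ (e + 1) := by
  induction N with
  | zero => simp
  | succ N ih =>
    rw [Finset.sum_range_succ, ih]
    have : ψ ^ (N + 1 + e + 1) = ψ ^ (N + 1) * ψ ^ (e + 1) := by ring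
    rw [this, h]
    ring

/-- Reciprocals of products of `e + 1` consecutive terms, compared with those starting at `N`. -/
lemma prod_mul_one_div_prod_le {a : ℕ → ℕ} (ha_pos : ∀ n, 1 ≤ n → 0 < a n)
    (ha : ∀ i j, 1 ≤ i → i ≤ j → a i ≤ a j) (e N n : ℕ) :
    (∏ i ∈ Finset.range e, (a (N + 1 + i) : ℝ)) *
      (1 / ∏ i ∈ Finset.range (e + 1), (a (n + N + 1 + i) : ℝ)) ≤ 1 / (a (n + (N + e + 1)) : ℝ) := by
  have hpos : ∀ i, 1 ≤ i → (0 : ℝ) < a i := fun i hi => by exact_mod_cast ha_pos i hi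
  have hle : ∏ i ∈ Finset.range e, (a (N + 1 + i) : ℝ)
      ≤ ∏ i ∈ Finset.range e, (a (n + N + 1 + i) : ℝ) :=
    Finset.prod_le_prod (fun _ _ => by positivity) fun i _ => by
      exact_mod_cast ha _ _ (by omega) (by omega)
  have hP : 0 < ∏ i ∈ Finset.range e, (a (n + N + 1 + i) : ℝ) :=
    Finset.prod_pos fun i _ => hpos _ (by omega)
  have hlast := hpos (n + (N + e + 1)) (by omega)
  rw [Finset.prod_range_succ, show n + N + 1 + e = n + (N + e + 1) by ring, mul_one_div,
    div_le_div_iff₀ (by positivity) hlast, one_mul]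
  gcongr

/-- At an index where `log (a n) / ψ ^ n` is at least all of its earlier values, `a n` dominates
a product of earlier terms. -/
lemma prod_le_mul_exp_neg {ψ : ℝ} {e : ℕ} (h : ψ ^ (e + 1) = ψ ^ e + 1) {a : ℕ → ℕ}
    (ha_pos : ∀ n, 1 ≤ n → 0 < a n) {N : ℕ} {c : ℝ}
    (hc : Real.log (a (N + e + 1)) = c * ψ ^ (N + e + 1))
    (hrec : ∀ i < N, Real.log (a (i + 1)) ≤ c * ψ ^ (i + 1)) :
    ∏ i ∈ Finset.range N, (a (i + 1) : ℝ)
      ≤ a (N + e + 1) * Real.exp (-(ψ ^ (e + 1) * c)) := by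
  have hpos : ∀ i, 1 ≤ i → (0 : ℝ) < a i := fun i hi => by exact_mod_cast ha_pos i hi
  have hprod : 0 < ∏ i ∈ Finset.range N, (a (i + 1) : ℝ) :=
    Finset.prod_pos fun i _ => hpos _ (by omega)
  rw [← Real.exp_log hprod, ← Real.exp_log (hpos (N + e + 1) (by omega)), ← Real.exp_add,
    Real.exp_le_exp, Real.log_prod fun i _ => (hpos _ (by omega)).ne']
  calc ∑ i ∈ Finset.range N, Real.log (a (i + 1))
      ≤ ∑ i ∈ Finset.range N, c * ψ ^ (i + 1) :=
        Finset.sum_le_sum fun i hi => hrec i (Finset.mem_range.1 hi)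
    _ = _ := by
        rw [← Finset.mul_sum, sum_pow_succ_eq h, hc]
        ring

/-- Let `d` be a positive integer and let `ψ > 1` be the unique positive
real solution of `ψ^d = ψ^(d-1) + 1`. If `a` is a monotonically increasing (non-decreasing)
sequence of positive integers with `lim_n a_n^(1/ψ^n) = ∞`, then
`∑_{n≥1} 1/(a_n ⋯ a_{n+d-1})` is irrational. -/
theorem stmt_0 (d : ℕ) (hd : 0 < d) (ψ : ℝ) (hψ : 1 < ψ)
    (hψeq : ψ ^ d = ψ ^ (d - 1) + 1)
    (a : ℕ → ℕ) (ha_pos : ∀ n, 1 ≤ n → 0 < a n)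
    (ha_mono : ∀ n, 1 ≤ n → a n ≤ a (n + 1))
    (hlim : Tendsto (fun n : ℕ => (a n : ℝ) ^ (1 / ψ ^ n)) atTop atTop) :
    Irrational (∑' n : ℕ, 1 / ∏ i ∈ Finset.range d, (a (n + 1 + i) : ℝ)) := by
  obtain ⟨e, rfl⟩ : ∃ e, d = e + 1 := ⟨d - 1, by omega⟩
  rw [Nat.add_sub_cancel] at hψeq
  have hpos : ∀ i, 1 ≤ i → (0 : ℝ) < a i := fun i hi => by exact_mod_cast ha_pos i hi
  have hψpow : ∀ n, 0 < ψ ^ n := fun n => by positivity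
  have hmono : ∀ i j, 1 ≤ i → i ≤ j → a i ≤ a j := fun i j hi hij => by
    induction j, hij using Nat.le_induction with
    | base => exact le_rfl
    | succ j hij ih => exact ih.trans (ha_mono j (hi.trans hij))
  have hc : Tendsto (fun n : ℕ => Real.log (a n) / ψ ^ n) atTop atTop := by
    refine (Real.tendsto_log_atTop.comp hlim).congr' ?_
    filter_upwards [eventually_ge_atTop 1] with n hn
    rw [Function.comp_apply, Real.log_rpow (hpos n hn)]
    ring
  obtain ⟨M, hM⟩ := eventually_atTop.1 (hc.eventually_ge_atTop 1)
  have hgrow : ∀ k, M ≤ k → ψ ^ k ≤ Real.log (a k) := fun k hk =>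
    (one_le_div (hψpow k)).1 (hM k hk)
  have hgeom : ∀ m k, M ≤ m → 1 ≤ m → m ≤ k →
      1 / (a k : ℝ) ≤ Real.log (a m) / a m * (1 / ψ) ^ k := fun m k hm hm1 hmk =>
    one_div_le_geometric hψ (ha_pos m hm1) (hmono m k hm1 hmk)
      ((one_le_pow₀ hψ.le).trans (hgrow m hm)) (hgrow k (hm.trans hmk))
  have hinv : 1 / ψ < 1 := by rw [div_lt_one (by linarith)]; exact hψ
  have hgeosum : HasSum (fun k : ℕ => (1 / ψ) ^ k) (ψ ^ (e + 1)) := by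
    have hκ : (1 - 1 / ψ)⁻¹ = ψ ^ (e + 1) := by
      have h1 : ψ ^ e * (ψ - 1) = 1 := by linear_combination hψeq
      have h2 : ψ - 1 ≠ 0 := by linarith
      have h3 : ψ ≠ 0 := by linarith
      rw [one_sub_div h3, inv_div, div_eq_iff h2]
      linear_combination (-ψ) * h1
    rw [← hκ]
    exact hasSum_geometric_of_lt_one (by positivity) hinv
  have hdom : ∀ m,
      HasSum (fun k : ℕ => Real.log (a m) / a m * (1 / ψ) ^ (k + m))
        (ψ ^ (e + 1) * (Real.log (a m) / ψ ^ m) / a m) := fun m => by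
    have hterm : (fun k : ℕ => Real.log (a m) / a m * (1 / ψ) ^ (k + m))
        = fun k => Real.log (a m) / a m * (1 / ψ) ^ m * (1 / ψ) ^ k := by
      funext k; ring
    have hval : ψ ^ (e + 1) * (Real.log (a m) / ψ ^ m) / a m
        = Real.log (a m) / a m * (1 / ψ) ^ m * ψ ^ (e + 1) := by
      rw [one_div, inv_pow]; ring
    rw [hterm, hval]
    exact hgeosum.mul_left _
  have htail : ∀ m, M ≤ m → 1 ≤ m → Summable fun k : ℕ => 1 / (a (k + m) : ℝ) := fun m hm hm1 =>
    (hdom m).summable.of_nonneg_of_le (fun _ => by positivity)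
      fun k => hgeom m _ hm hm1 (by omega)
  set b : ℕ → ℕ := fun n => ∏ i ∈ Finset.range (e + 1), a (n + 1 + i) with hb
  have hbpos : ∀ n, 0 < b n := fun n => Finset.prod_pos fun i _ => ha_pos _ (by omega)
  have hbcast : ∀ n, (b n : ℝ) = ∏ i ∈ Finset.range (e + 1), (a (n + 1 + i) : ℝ) := fun n => by
    rw [hb]; push_cast; rfl
  have hbsum : Summable fun n => 1 / (b n : ℝ) := by
    rw [← summable_nat_add_iff M]
    have hP : 0 < ∏ i ∈ Finset.range e, (a (M + 1 + i) : ℝ) :=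
      Finset.prod_pos fun i _ => hpos _ (by omega)
    rw [← summable_mul_left_iff hP.ne']
    refine (htail (M + e + 1) (by omega) (by omega)).of_nonneg_of_le (fun _ => by positivity)
      fun n => ?_
    rw [hbcast]
    exact prod_mul_one_div_prod_le ha_pos hmono e M n
  simp_rw [← hbcast]
  rintro ⟨r, hr⟩
  obtain ⟨M', hM'⟩ := eventually_atTop.1 (hc.eventually_gt_atTop (2 * (r.den : ℝ)))
  obtain ⟨m, hm, hrec⟩ := high_scores hc (M + M' + e + 1)
  obtain ⟨N, rfl⟩ : ∃ N, m = N + e + 1 := ⟨m - (e + 1), by omega⟩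
  set c : ℝ := Real.log (a (N + e + 1)) / ψ ^ (N + e + 1) with hcdef
  have hcbig : 2 * (r.den : ℝ) < c := hM' _ (by omega)
  have hprod := prod_le_mul_exp_neg hψeq ha_pos (N := N) (c := c)
    (div_mul_cancel₀ _ (hψpow _).ne').symm fun i hi =>
      (div_le_iff₀ (hψpow _)).1 (hrec (i + 1) (by omega)).le
  have hone := one_le_mul_tsum_tail hbpos hbsum hr (N := N)
    (A := ∏ i ∈ Finset.range (N + e), a (i + 1))
    (Finset.prod_pos fun i _ => ha_pos _ (by omega)) fun n hn => by
      rw [show N + e = n + ((e + 1) + (N - n - 1)) by omega, Finset.prod_range_add,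
        Finset.prod_range_add]
      refine Dvd.dvd.mul_left (Dvd.intro _ (congrArg (· * _) ?_)) _
      exact Finset.prod_congr rfl fun i _ => by congr 1; ring
  have hsplit : ((∏ i ∈ Finset.range (N + e), a (i + 1) : ℕ) : ℝ) * ∑' n, 1 / (b (n + N) : ℝ)
      ≤ (∏ i ∈ Finset.range N, (a (i + 1) : ℝ)) * (ψ ^ (e + 1) * c / a (N + e + 1)) := by
    rw [Finset.prod_range_add]
    push_cast
    rw [mul_assoc, ← tsum_mul_left]
    refine mul_le_mul_of_nonneg_left ?_ (by positivity)
    rw [← (hdom (N + e + 1)).tsum_eq]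
    refine (((summable_nat_add_iff N).2 hbsum).mul_left _).tsum_le_tsum (fun n => ?_)
      (hdom (N + e + 1)).summable
    refine le_trans ?_ (hgeom (N + e + 1) _ (by omega) (by omega) (by omega))
    rw [hbcast]
    simpa only [add_right_comm N _ 1] using prod_mul_one_div_prod_le ha_pos hmono e N n
  have hden : (0 : ℝ) < r.den := by exact_mod_cast r.den_pos
  have hκ : 1 ≤ ψ ^ (e + 1) := one_le_pow₀ hψ.le
  set t : ℝ := ψ ^ (e + 1) * c with ht
  have htc : 2 * (r.den : ℝ) < t := by nlinarith
  have hexp := Real.quadratic_le_exp_of_nonneg (x := t) (by linarith)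
  have hlast := hpos (N + e + 1) (by omega)
  have hfin : (∏ i ∈ Finset.range N, (a (i + 1) : ℝ)) * (t / a (N + e + 1))
      ≤ t * Real.exp (-t) := by
    calc _ ≤ (a (N + e + 1) * Real.exp (-t)) * (t / a (N + e + 1)) :=
          mul_le_mul_of_nonneg_right hprod (div_nonneg (by linarith) hlast.le)
      _ = _ := by field_simp
  have hsmall : (r.den : ℝ) * (t * Real.exp (-t)) < 1 := by
    rw [Real.exp_neg, ← mul_assoc, ← div_eq_mul_inv, div_lt_one (Real.exp_pos t)]
    nlinarith
  have := mul_le_mul_of_nonneg_left (hsplit.trans hfin) hden.le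
  linarith
end

section
/- Let d be a positive integer and let ψ > 1 be the unique positive real solution of ψ^d = ψ^{d-1} + 1. For every real number C ∈ (1,∞) there exists a strictly increasing sequence of positive integers {a_n}_{n=1}^∞ satisfying lim_{n→∞} a_n^{1/ψ^n} = C such that the sum ∑_{n=1}^∞ 1/(a_n · a_{n+1} · ⋯ · a_{n+d-1}) is a rational number. -/
open Filter Topology

/-- The divisor `2 ^ k` of `8` for which `p / 2 ^ k` lies in `[t, 2 * t)`, if `p ∈ [t, 16 * t)`. -/
noncomputable def dyadicScale (p : ℕ) (t : ℝ) : ℕ :=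
  if (p : ℝ) < 2 * t then 1 else if (p : ℝ) < 4 * t then 2 else if (p : ℝ) < 8 * t then 4 else 8

lemma dyadicScale_dvd (p : ℕ) (t : ℝ) : dyadicScale p t ∣ 8 := by
  unfold dyadicScale
  split_ifs <;> norm_num

lemma dyadicScale_pos (p : ℕ) (t : ℝ) : 0 < dyadicScale p t :=
  Nat.pos_of_dvd_of_pos (dyadicScale_dvd p t) (by norm_num)

lemma dyadicScale_bounds {p : ℕ} {t : ℝ} (h₁ : t ≤ p) (h₂ : (p : ℝ) < 16 * t) :
    dyadicScale p t * t ≤ p ∧ (p : ℝ) < 2 * (dyadicScale p t * t) := by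
  unfold dyadicScale
  split_ifs <;> push_cast <;> constructor <;> linarith

/-- The sequence of order `D + 1` with `u (n + D + 1) = u (n + D) * (u n + s n) / s (n + D)`,
where `s n = dyadicScale (u n * u (n - D)) (T (n + 1))`. -/
noncomputable def trackingSeq (D : ℕ) (T : ℕ → ℝ) (init : ℕ → ℕ) : ℕ → ℕ
  | n =>
    if _h : n ≤ D then init n
    else
      trackingSeq D T init (n - 1) *
        (trackingSeq D T init (n - (D + 1)) +
          dyadicScale (trackingSeq D T init (n - (D + 1)) *
            trackingSeq D T init (n - (D + 1) - D)) (T (n - (D + 1) + 1))) /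
        dyadicScale (trackingSeq D T init (n - 1) * trackingSeq D T init (n - 1 - D))
          (T (n - 1 + 1))
  termination_by n => n
  decreasing_by all_goals omega

/-- Scaling by divisors of `8` keeps an integer solution of the recurrence within a factor `4`
of a real sequence with `T (n + D + 1) = T (n + D) * T n`. -/
lemma exists_tracking_sequence (D : ℕ) (T : ℕ → ℝ) (hT : ∀ n, (8 : ℝ) ^ (D + 1) ≤ T n)
    (hrec : ∀ n, T (n + D + 1) = T (n + D) * T n) :
    ∃ u s : ℕ → ℕ, (∀ n, s n ∣ 8) ∧ (∀ n, s n ∣ u n) ∧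
      (∀ n, T n ≤ u n ∧ (u n : ℝ) < 4 * T n) ∧
      ∀ n, s (n + D) * u (n + D + 1) = u (n + D) * (u n + s n) := by
  have hTpos : ∀ n, 0 < T n := fun n => lt_of_lt_of_le (by positivity) (hT n)
  let init : ℕ → ℕ := fun n => 8 ^ (D + 1) * ⌈T n / 8 ^ (D + 1)⌉₊
  let u := trackingSeq D T init
  let s : ℕ → ℕ := fun n => dyadicScale (u n * u (n - D)) (T (n + 1))
  have hs8 : ∀ n, s n ∣ 8 := fun n => dyadicScale_dvd _ _
  have hspos : ∀ n, 0 < s n := fun n => dyadicScale_pos _ _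
  have hu_init : ∀ n ≤ D, u n = init n := by
    intro n hn
    simp only [u]
    rw [trackingSeq, dif_pos hn]
  have hu_step : ∀ n, u (n + D + 1) = u (n + D) * (u n + s n) / s (n + D) := by
    intro n
    simp only [u, s]
    rw [trackingSeq, dif_neg (by omega)]
    have h₁ : n + D + 1 - (D + 1) = n := by omega
    have h₂ : n + D + 1 - 1 = n + D := by omega
    rw [h₁, h₂]
  have hstep : ∀ n, 8 ∣ u (n + D) → s (n + D) * u (n + D + 1) = u (n + D) * (u n + s n) := by
    intro n h
    rw [hu_step]
    exact Nat.mul_div_cancel' (((hs8 _).trans h).mul_right _)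
  have hdvd : ∀ n, 8 ^ (D + 1) ∣ u (n + D) * ∏ i ∈ Finset.range D, s (n + i) ∧
      ∀ m ≤ n + D, 8 ∣ u m := by
    intro n
    induction n with
    | zero =>
      have h : ∀ m ≤ D, 8 ^ (D + 1) ∣ u m := fun m hm => by
        rw [hu_init m hm]
        exact Dvd.intro _ rfl
      refine ⟨(h _ (by omega)).mul_right _, fun m hm => ?_⟩
      exact (Dvd.intro_left (8 ^ D) rfl).trans (h m (by omega))
    | succ n ih =>
      obtain ⟨ih₁, ih₂⟩ := ih
      obtain ⟨w, hw⟩ : s n ∣ u n + s n :=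
        ((hs8 n).trans (ih₂ n (by omega))).add (dvd_refl _)
      have hprod : s n * ∏ i ∈ Finset.range D, s (n + 1 + i)
          = (∏ i ∈ Finset.range D, s (n + i)) * s (n + D) := by
        rw [← Finset.prod_range_succ (fun i => s (n + i)), Finset.prod_range_succ', mul_comm]
        congr 1
        exact Finset.prod_congr rfl fun i _ => by congr 1; ring
      have hstep' := hstep n (ih₂ _ le_rfl)
      have hV : u (n + 1 + D) * ∏ i ∈ Finset.range D, s (n + 1 + i)
          = u (n + D) * (∏ i ∈ Finset.range D, s (n + i)) * w := by
        have h₁ : n + 1 + D = n + D + 1 := by ring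
        rw [h₁]
        apply Nat.eq_of_mul_eq_mul_left (Nat.mul_pos (hspos n) (hspos (n + D)))
        calc _ = (s (n + D) * u (n + D + 1)) * (s n * ∏ i ∈ Finset.range D, s (n + 1 + i)) := by
              ring
          _ = _ := by rw [hstep', hprod, hw]; ring
      have h₁ : 8 ^ (D + 1) ∣ u (n + 1 + D) * ∏ i ∈ Finset.range D, s (n + 1 + i) := by
        rw [hV]
        exact ih₁.mul_right _
      refine ⟨h₁, fun m hm => ?_⟩
      rcases Nat.lt_or_ge m (n + 1 + D) with h | h
      · exact ih₂ m (by omega)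
      obtain rfl : m = n + 1 + D := le_antisymm hm h
      have h₂ : ∏ i ∈ Finset.range D, s (n + 1 + i) ∣ 8 ^ D := by
        have := Finset.prod_dvd_prod_of_dvd (s := Finset.range D) (fun i => s (n + 1 + i))
          (fun _ => 8) fun i _ => hs8 _
        simpa using this
      have h₃ : 8 ^ D * 8 ∣ 8 ^ D * u (n + 1 + D) := by
        rw [← pow_succ, mul_comm (8 ^ D)]
        exact h₁.trans (mul_dvd_mul_left _ h₂)
      exact Nat.dvd_of_mul_dvd_mul_left (by positivity) h₃
  have h8 : ∀ n, 8 ∣ u n := fun n => (hdvd n).2 n (by omega)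
  have hsu : ∀ n, s n ∣ u n := fun n => (hs8 n).trans (h8 n)
  have hrecu := fun n => hstep n (h8 _)
  refine ⟨u, s, hs8, hsu, fun n => ?_, hrecu⟩
  induction n using Nat.strong_induction_on with
  | _ n ih =>
  rcases Nat.lt_or_ge D n with hn | hn
  · obtain ⟨k, rfl⟩ : ∃ k, n = k + D + 1 := ⟨n - (D + 1), by omega⟩
    obtain ⟨a₁, a₂⟩ := ih (k + D) (by omega)
    obtain ⟨b₁, b₂⟩ := ih k (by omega)
    have hk := hTpos k
    have hkD := hTpos (k + D)
    obtain ⟨c₁, c₂⟩ := dyadicScale_bounds (p := u (k + D) * u k) (t := T (k + D + 1))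
      (by
        rw [hrec]
        push_cast
        exact mul_le_mul a₁ b₁ hk.le (by positivity))
      (by
        rw [hrec]
        push_cast
        calc (u (k + D) : ℝ) * u k < (4 * T (k + D)) * (4 * T k) :=
              mul_lt_mul'' a₂ b₂ (by positivity) (by positivity)
          _ = _ := by ring)
    have hsk : s (k + D) = dyadicScale (u (k + D) * u k) (T (k + D + 1)) := by
      simp only [s, Nat.add_sub_cancel]
    rw [← hsk] at c₁ c₂
    push_cast at c₁ c₂
    have hspos' : (0 : ℝ) < s (k + D) := by exact_mod_cast hspos (k + D)
    have hsle : (s k : ℝ) ≤ u k := by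
      have : 0 < u k := by exact_mod_cast hk.trans_le b₁
      exact_mod_cast Nat.le_of_dvd this (hsu k)
    have hr : (s (k + D) : ℝ) * u (k + D + 1) = u (k + D) * (u k + s k) := by
      exact_mod_cast hrecu k
    have hupos : (0 : ℝ) ≤ u (k + D) := by positivity
    have hspk : (0 : ℝ) ≤ s k := by positivity
    constructor
    · refine le_of_mul_le_mul_left ?_ hspos'
      rw [hr]
      nlinarith [mul_nonneg hupos hspk]
    · refine lt_of_mul_lt_mul_left ?_ hspos'.le
      rw [hr]
      nlinarith [mul_le_mul_of_nonneg_left hsle hupos]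
  · rw [hu_init n hn]
    simp only [init]
    push_cast
    have hp : (0 : ℝ) < 8 ^ (D + 1) := by positivity
    have h₁ := Nat.le_ceil (T n / 8 ^ (D + 1))
    have h₂ := Nat.ceil_lt_add_one (a := T n / 8 ^ (D + 1)) (div_nonneg (hTpos n).le hp.le)
    have h₃ : (8 : ℝ) ^ (D + 1) * (T n / 8 ^ (D + 1)) = T n := by field_simp
    have h₄ := hT n
    constructor
    · nlinarith
    · nlinarith

/-- The reciprocals of products of `D + 1` consecutive terms of `u + s` telescope. -/
lemma hasSum_one_div_prod_of_recurrence (D : ℕ) (u s : ℕ → ℕ) (hs : ∀ n, 0 < s n)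
    (hu : ∀ n, 0 < u n) (hrec : ∀ n, s (n + D) * u (n + D + 1) = u (n + D) * (u n + s n))
    (hlim : Tendsto (fun n => (u n : ℝ)) atTop atTop) (m : ℕ) :
    HasSum (fun n => 1 / ∏ i ∈ Finset.range (D + 1), ((u (n + m + i) + s (n + m + i) : ℕ) : ℝ))
      (1 / (u (m + D) * ∏ i ∈ Finset.range D, ((u (m + i) + s (m + i) : ℕ) : ℝ))) := by
  let x : ℕ → ℝ := fun n =>
    1 / (u (n + m + D) * ∏ i ∈ Finset.range D, ((u (n + m + i) + s (n + m + i) : ℕ) : ℝ))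
  have hA : ∀ n, (0 : ℝ) < ((u n + s n : ℕ) : ℝ) := fun n => by
    exact_mod_cast Nat.add_pos_left (hu n) _
  have hdiff : ∀ n, 1 / ∏ i ∈ Finset.range (D + 1),
      ((u (n + m + i) + s (n + m + i) : ℕ) : ℝ) = x n - x (n + 1) := by
    intro n
    have hP : (∏ i ∈ Finset.range D, ((u (n + m + i) + s (n + m + i) : ℕ) : ℝ)) *
        ((u (n + m + D) + s (n + m + D) : ℕ) : ℝ)
        = (∏ i ∈ Finset.range D, ((u (n + 1 + m + i) + s (n + 1 + m + i) : ℕ) : ℝ)) *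
        ((u (n + m) + s (n + m) : ℕ) : ℝ) := by
      rw [← Finset.prod_range_succ (fun i => ((u (n + m + i) + s (n + m + i) : ℕ) : ℝ)),
        Finset.prod_range_succ']
      congr 1
      refine Finset.prod_congr rfl fun i _ => ?_
      have : n + m + (i + 1) = n + 1 + m + i := by ring
      rw [this]
    have hr : (s (n + m + D) : ℝ) * u (n + 1 + m + D)
        = u (n + m + D) * ((u (n + m) + s (n + m) : ℕ) : ℝ) := by
      have h₁ : n + 1 + m + D = n + m + D + 1 := by ring
      rw [h₁]
      exact_mod_cast hrec (n + m)
    have hP₁ : 0 < ∏ i ∈ Finset.range D, ((u (n + m + i) + s (n + m + i) : ℕ) : ℝ) :=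
      Finset.prod_pos fun i _ => hA _
    have hP₂ : 0 < ∏ i ∈ Finset.range D, ((u (n + 1 + m + i) + s (n + 1 + m + i) : ℕ) : ℝ) :=
      Finset.prod_pos fun i _ => hA _
    have hu₁ : (0 : ℝ) < u (n + m + D) := by exact_mod_cast hu _
    have hu₂ : (0 : ℝ) < u (n + 1 + m + D) := by exact_mod_cast hu _
    have hs₁ : (0 : ℝ) < s (n + m + D) := by exact_mod_cast hs _
    have hA₁ := hA (n + m + D)
    have hA₂ := hA (n + m)
    have hA₃ : ((u (n + m + D) + s (n + m + D) : ℕ) : ℝ) = u (n + m + D) + s (n + m + D) := by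
      push_cast
      ring
    simp only [x]
    rw [Finset.prod_range_succ]
    generalize (∏ i ∈ Finset.range D, ((u (n + m + i) + s (n + m + i) : ℕ) : ℝ)) = P at *
    generalize (∏ i ∈ Finset.range D, ((u (n + 1 + m + i) + s (n + 1 + m + i) : ℕ) : ℝ)) = P₂ at *
    generalize ((u (n + m + D) + s (n + m + D) : ℕ) : ℝ) = A at *
    generalize ((u (n + m) + s (n + m) : ℕ) : ℝ) = B at *
    generalize (u (n + m + D) : ℝ) = v at *
    generalize (u (n + 1 + m + D) : ℝ) = v₂ at *
    generalize (s (n + m + D) : ℝ) = σ at *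
    have h₁ : 1 / (v₂ * P₂) = σ / (v * P * A) := by
      rw [div_eq_div_iff (by positivity) (by positivity)]
      linear_combination v * hP - P₂ * hr
    rw [h₁]
    field_simp
    rw [hA₃]
    ring
  have hx : Tendsto x atTop (𝓝 0) := by
    have hlim' : Tendsto (fun n => (1 : ℝ) / u (n + m + D)) atTop (𝓝 0) := by
      simp only [one_div]
      refine (hlim.comp (tendsto_add_atTop_nat (m + D))).inv_tendsto_atTop.congr fun n => ?_
      simp [add_assoc]
    refine squeeze_zero (fun n => by positivity) (fun n => ?_) hlim'
    have hu₁ : (0 : ℝ) < u (n + m + D) := by exact_mod_cast hu _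
    refine one_div_le_one_div_of_le hu₁ (le_mul_of_one_le_right hu₁.le ?_)
    exact_mod_cast Nat.one_le_iff_ne_zero.mpr
      (Finset.prod_ne_zero_iff.mpr fun i _ => (Nat.add_pos_left (hu _) _).ne')
  rw [hasSum_iff_tendsto_nat_of_nonneg (fun n => by positivity)]
  simp only [hdiff, Finset.sum_range_sub']
  have hx0 : x 0 = 1 / (u (m + D) * ∏ i ∈ Finset.range D, ((u (m + i) + s (m + i) : ℕ) : ℝ)) := by
    simp [x]
  rw [← hx0]
  simpa using hx.const_sub (x 0)

/-- Doubly exponential growth eventually beats any constant, the identity, and has ratio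
at least `8`. -/
lemma exists_rpow_pow_lower_bounds {ψ C : ℝ} (hψ : 1 < ψ) (hC : 1 < C) (K : ℝ) :
    ∃ N : ℕ, (N : ℝ) ≤ C ^ (ψ ^ N) ∧ ∀ n ≥ N, K ≤ C ^ (ψ ^ n) ∧
      8 * C ^ (ψ ^ n) ≤ C ^ (ψ ^ (n + 1)) := by
  have hC0 : 0 < C := by linarith
  have hpow : Tendsto (fun n : ℕ => ψ ^ n) atTop atTop := tendsto_pow_atTop_atTop_of_one_lt hψ
  have hexp : Tendsto (fun x : ℝ => C ^ x) atTop atTop :=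
    tendsto_rpow_atTop_of_base_gt_one C hC
  have h₁ : ∀ᶠ n : ℕ in atTop, K ≤ C ^ (ψ ^ n) := (hexp.comp hpow).eventually_ge_atTop K
  have h₂ : ∀ᶠ n : ℕ in atTop, (8 : ℝ) ≤ C ^ (ψ ^ n * (ψ - 1)) :=
    (hexp.comp (hpow.atTop_mul_const (by linarith : 0 < ψ - 1))).eventually_ge_atTop 8
  have h₃ : ∀ᶠ n : ℕ in atTop, (n : ℝ) ≤ C ^ (ψ ^ n) := by
    have hlog := Real.log_pos hC
    have := (tendsto_pow_const_div_const_pow_of_one_lt 1 hψ).eventually (gt_mem_nhds hlog)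
    filter_upwards [this] with n hn
    have hp : 0 < ψ ^ n := by positivity
    rw [pow_one, div_lt_iff₀ hp] at hn
    rw [Real.rpow_def_of_pos hC0]
    have := Real.add_one_le_exp (Real.log C * ψ ^ n)
    linarith
  obtain ⟨N, hN⟩ := eventually_atTop.mp ((h₁.and h₂).and h₃)
  refine ⟨N, (hN N le_rfl).2, fun n hn => ⟨(hN n hn).1.1, ?_⟩⟩
  have h := (hN n hn).1.2
  have : C ^ (ψ ^ (n + 1)) = C ^ (ψ ^ n * (ψ - 1)) * C ^ (ψ ^ n) := by
    rw [← Real.rpow_add hC0]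
    congr 1
    ring
  rw [this]
  gcongr

/-- Let `d` be a positive integer and `ψ > 1` the unique positive real
solution of `ψ^d = ψ^(d-1) + 1`. For every real `C ∈ (1,∞)` there is a strictly increasing
sequence of positive integers `a` with `lim_n a_n^(1/ψ^n) = C` such that
`∑_{n≥1} 1/(a_n ⋯ a_{n+d-1})` is rational. -/
theorem stmt_1 (d : ℕ) (hd : 0 < d) (ψ : ℝ) (hψ : 1 < ψ)
    (hψeq : ψ ^ d = ψ ^ (d - 1) + 1)
    (C : ℝ) (hC : 1 < C) :
    ∃ a : ℕ → ℕ, (∀ n, 1 ≤ n → 0 < a n) ∧ (∀ n, 1 ≤ n → a n < a (n + 1)) ∧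
      Tendsto (fun n : ℕ => (a n : ℝ) ^ (1 / ψ ^ n)) atTop (𝓝 C) ∧
      ∃ q : ℚ, (∑' n : ℕ, 1 / ∏ i ∈ Finset.range d, (a (n + 1 + i) : ℝ)) = q := by
  obtain ⟨D, rfl⟩ : ∃ D, d = D + 1 := ⟨d - 1, by omega⟩
  rw [Nat.add_sub_cancel] at hψeq
  have hC0 : 0 < C := by linarith
  obtain ⟨N, hN, hNlarge⟩ := exists_rpow_pow_lower_bounds hψ hC (8 ^ (D + 1))
  let T : ℕ → ℝ := fun n => C ^ (ψ ^ (n + N))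
  have hTpos : ∀ n, 0 < T n := fun n => Real.rpow_pos_of_pos hC0 _
  obtain ⟨u, s, hs8, hsu, hbound, hrec⟩ := exists_tracking_sequence D T
    (fun n => (hNlarge (n + N) (by omega)).1) (fun n => by
      simp only [T]
      rw [← Real.rpow_add hC0]
      congr 1
      have : ψ ^ (n + D + 1 + N) = ψ ^ (n + N) * ψ ^ (D + 1) := by ring
      rw [this, hψeq]
      ring)
  have hspos : ∀ n, 0 < s n := fun n => Nat.pos_of_dvd_of_pos (hs8 n) (by norm_num)
  have hupos : ∀ n, 0 < u n := fun n => by exact_mod_cast (hTpos n).trans_le (hbound n).1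
  have hlow : ∀ n, T n ≤ ((u n + s n : ℕ) : ℝ) := fun n =>
    (hbound n).1.trans (by exact_mod_cast Nat.le_add_right _ _)
  have hupp : ∀ n, ((u n + s n : ℕ) : ℝ) < 8 * T n := fun n => by
    have h₁ : (s n : ℝ) ≤ u n := by exact_mod_cast Nat.le_of_dvd (hupos n) (hsu n)
    push_cast
    linarith [(hbound n).2]
  let a : ℕ → ℕ := fun n => if n < N then n else u (n - N) + s (n - N)
  have ha : ∀ n, a (n + N) = u n + s n := fun n => by simp [a]
  have hulim : Tendsto (fun n => (u n : ℝ)) atTop atTop := by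
    have : Tendsto T atTop atTop := (tendsto_rpow_atTop_of_base_gt_one C hC).comp
      ((tendsto_pow_atTop_atTop_of_one_lt hψ).comp (tendsto_add_atTop_nat N))
    exact tendsto_atTop_mono (fun n => (hbound n).1) this
  refine ⟨a, fun n hn => ?_, fun n hn => ?_, ?_, ?_⟩
  · simp only [a]
    split_ifs
    · exact hn
    · exact Nat.add_pos_left (hupos _) _
  · rcases lt_trichotomy (n + 1) N with h | h | h
    · simp [a, h, (by omega : n < N)]
    · have h₁ : a n = n := by simp [a, (by omega : n < N)]
      have h₂ : a (n + 1) = u 0 + s 0 := by rw [h, ← ha 0, zero_add]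
      have h₃ : (N : ℝ) ≤ ((u 0 + s 0 : ℕ) : ℝ) := by
        refine hN.trans (le_trans (le_of_eq ?_) (hlow 0))
        simp [T]
      have h₄ : N ≤ u 0 + s 0 := by exact_mod_cast h₃
      omega
    · obtain ⟨k, rfl⟩ : ∃ k, n = k + N := ⟨n - N, by omega⟩
      rw [ha, (by ring : k + N + 1 = k + 1 + N), ha]
      have h₁ : 8 * T k ≤ T (k + 1) := by
        have := (hNlarge (k + N) (by omega)).2
        simp only [T]
        rwa [(by ring : k + 1 + N = k + N + 1)]
      exact_mod_cast (hupp k).trans_le (h₁.trans (hlow (k + 1)))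
  · rw [← tendsto_add_atTop_iff_nat N]
    have hroot : ∀ n, T n ^ (1 / ψ ^ (n + N)) = C := fun n => by
      have : ψ ^ (n + N) ≠ 0 := by positivity
      simp only [T]
      rw [← Real.rpow_mul hC0.le, mul_one_div_cancel this, Real.rpow_one]
    have hexp : Tendsto (fun n => 1 / ψ ^ (n + N)) atTop (𝓝 0) := by
      simp only [one_div]
      exact ((tendsto_pow_atTop_atTop_of_one_lt hψ).comp
        (tendsto_add_atTop_nat N)).inv_tendsto_atTop
    have h8 : Tendsto (fun n => (8 : ℝ) ^ (1 / ψ ^ (n + N)) * C) atTop (𝓝 C) := by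
      have := ((tendsto_const_nhds (x := (8 : ℝ))).rpow hexp (Or.inl (by norm_num))).mul_const C
      simpa using this
    refine tendsto_of_tendsto_of_tendsto_of_le_of_le tendsto_const_nhds h8
      (fun n => ?_) (fun n => ?_)
    · simp only [ha]
      calc C = T n ^ (1 / ψ ^ (n + N)) := (hroot n).symm
        _ ≤ _ := Real.rpow_le_rpow (hTpos n).le (hlow n) (by positivity)
    · simp only [ha]
      calc _ ≤ (8 * T n) ^ (1 / ψ ^ (n + N)) :=
            Real.rpow_le_rpow (by positivity) (hupp n).le (by positivity)
        _ = _ := by rw [Real.mul_rpow (by norm_num) (hTpos n).le, hroot]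
  · have htail := hasSum_one_div_prod_of_recurrence D u s hspos hupos hrec hulim 1
    have hterm : (fun n => 1 / ∏ i ∈ Finset.range (D + 1), (a (n + N + 1 + i) : ℝ)) =
        fun n => 1 / ∏ i ∈ Finset.range (D + 1), ((u (n + 1 + i) + s (n + 1 + i) : ℕ) : ℝ) := by
      funext n
      congr 1
      refine Finset.prod_congr rfl fun i _ => ?_
      rw [(by ring : n + N + 1 + i = n + 1 + i + N), ha]
    rw [← hterm] at htail
    have hsum := (hasSum_nat_add_iff
      (f := fun n => 1 / ∏ i ∈ Finset.range (D + 1), (a (n + 1 + i) : ℝ)) N).mp htail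
    refine ⟨1 / (u (1 + D) * ∏ i ∈ Finset.range D, ((u (1 + i) + s (1 + i) : ℕ) : ℚ)) +
      ∑ n ∈ Finset.range N, 1 / ∏ i ∈ Finset.range (D + 1), (a (n + 1 + i) : ℚ), ?_⟩
    rw [hsum.tsum_eq]
    push_cast
    rfl
end

section
/- Fix a positive integer d and a tuple of non-negative integers w = (w_0, w_1, …, w_{d-1}) with w_{d-1} ≥ 1, and let c_w be the unique positive real root of P_w. Let {a_n}_{n=1}^∞ and {b_n}_{n=1}^∞ be sequences of positive integers with {a_n}_{n=1}^∞ monotonically increasing (i.e., non-decreasing). Assume there exist real numbers 0 < η < τ such that for every n ∈ ℕ one has b_n ≤ n^η and a_n^{w_0} · a_{n+1}^{w_1} · ⋯ · a_{n+d-1}^{w_{d-1}} ≥ n^{1+τ}. If moreover limsup_{n→∞} a_n^{1/c_w^n} = ∞, then the sum S = ∑_{n=1}^∞ b_n / (a_n^{w_0} · a_{n+1}^{w_1} · ⋯ · a_{n+d-1}^{w_{d-1}}) is irrational. -/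
open Filter Topology

/-- A series of positive terms is irrational if its partial sums have denominators that are
small compared with the tails. -/
theorem irrational_tsum_of_small_tails {u : ℕ → ℝ} (hu : ∀ n, 0 < u n) (hs : Summable u)
    (h : ∀ q : ℕ, 0 < q → ∃ N D : ℕ, 0 < D ∧ (∃ z : ℤ, (D : ℝ) * ∑ i ∈ Finset.range N, u i = z) ∧
      (q : ℝ) * D * ∑' i, u (i + N) < 1) :
    Irrational (∑' n, u n) := by
  rintro ⟨r, hr⟩
  obtain ⟨N, D, hD, ⟨z, hz⟩, hlt⟩ := h r.den r.den_pos
  have hsplit := hs.sum_add_tsum_nat_add N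
  have htail : 0 < ∑' i, u (i + N) :=
    ((summable_nat_add_iff N).2 hs).tsum_pos (fun i => (hu _).le) 0 (hu _)
  have hden : (r.den : ℝ) * r = r.num := by
    exact_mod_cast Rat.den_mul_eq_num r
  have key : (r.den : ℝ) * D * ∑' i, u (i + N) = ((D * r.num - r.den * z : ℤ) : ℝ) := by
    push_cast
    rw [← hz, ← hden, hr, ← hsplit]
    ring
  have hpos : 0 < (r.den : ℝ) * D * ∑' i, u (i + N) := by
    have := r.den_pos
    positivity
  rw [key] at hlt hpos
  have h1 : (D * r.num - r.den * z : ℤ) < 1 := by exact_mod_cast hlt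
  have h2 : 0 < (D * r.num - r.den * z : ℤ) := by exact_mod_cast hpos
  omega

/-- If `x n / c ^ n` is unbounded, there are arbitrarily late indices `R` at which `x R` noticeably
exceeds the exponential bound satisfied by the earlier terms, and after which every term of `x` is
at least its index or much larger than `c ^ R`. -/
theorem exists_exponential_record {c : ℝ} (hc : 1 < c) {x : ℕ → ℝ}
    (hmono : ∀ m n, 1 ≤ m → m ≤ n → x m ≤ x n)
    (hfreq : ∀ T : ℝ, ∃ᶠ n in atTop, T * c ^ n ≤ x n) (n₀ : ℕ) (T : ℝ) :
    ∃ (R : ℕ) (Z : ℝ), n₀ < R ∧ 1 ≤ Z ∧ (∀ m, 1 ≤ m → m < R → x m ≤ Z * c ^ m + R) ∧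
      (1 + 1 / (2 * (R : ℝ) ^ 2)) * Z * c ^ R ≤ x R ∧
      ∀ n, R ≤ n → (n : ℝ) ≤ x n ∨ (Z ≤ 2 ∧ T * c ^ R ≤ x n) := by
  have hc0 : 0 < c := by linarith
  -- the first crossing of the increasing threshold `Y * (2 - 1 / n)` after `k`
  have cross : ∀ (k r : ℕ) (Y : ℝ), 1 ≤ k → k < r → 1 ≤ Y → 2 * Y * c ^ r ≤ x r →
      (∀ m, 1 ≤ m → m ≤ k → x m ≤ Y * c ^ m + k) →
      ∃ (R : ℕ) (Z : ℝ), k < R ∧ R ≤ r ∧ 1 ≤ Z ∧ Z ≤ 2 * Y ∧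
        (∀ m, 1 ≤ m → m < R → x m ≤ Z * c ^ m + R) ∧
        (1 + 1 / (2 * (R : ℝ) ^ 2)) * Z * c ^ R ≤ x R := by
    intro k r Y hk hkr hY hr hsmall
    classical
    have hex : ∃ n, k < n ∧ Y * (2 - 1 / (n : ℝ)) * c ^ n ≤ x n := by
      refine ⟨r, hkr, le_trans ?_ hr⟩
      have : 0 ≤ 1 / (r : ℝ) := by positivity
      have : Y * (2 - 1 / (r : ℝ)) ≤ 2 * Y := by nlinarith
      gcongr
    obtain ⟨hkR, hR⟩ := Nat.find_spec hex
    have hmin : ∀ m, m < Nat.find hex → k < m → x m < Y * (2 - 1 / (m : ℝ)) * c ^ m := by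
      intro m hm hkm
      by_contra hcon
      exact Nat.find_min hex hm ⟨hkm, not_lt.1 hcon⟩
    have hRr : Nat.find hex ≤ r := by
      by_contra hcon
      have h1 := hmin r (not_le.1 hcon) hkr
      have : 0 ≤ 1 / (r : ℝ) := by positivity
      have h2 : Y * (2 - 1 / (r : ℝ)) * c ^ r ≤ 2 * Y * c ^ r := by
        have : Y * (2 - 1 / (r : ℝ)) ≤ 2 * Y := by nlinarith
        gcongr
      linarith
    generalize Nat.find hex = R at *
    have hR1 : (1 : ℝ) ≤ (R : ℝ) - 1 := by
      have : (2 : ℝ) ≤ R := by exact_mod_cast (by omega : 2 ≤ R)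
      linarith
    have hinv : 1 / ((R : ℝ) - 1) ≤ 1 := by
      rw [div_le_one (by linarith)]; exact hR1
    have hinv0 : 0 ≤ 1 / ((R : ℝ) - 1) := by
      apply div_nonneg <;> linarith
    refine ⟨R, Y * (2 - 1 / ((R : ℝ) - 1)), hkR, hRr, by nlinarith, by nlinarith, ?_, ?_⟩
    · intro m hm hmR
      by_cases hmk : m ≤ k
      · refine (hsmall m hm hmk).trans ?_
        have : (k : ℝ) ≤ R := by exact_mod_cast hkR.le
        have : Y ≤ Y * (2 - 1 / ((R : ℝ) - 1)) := by nlinarith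
        gcongr
      · refine (hmin m hmR (not_le.1 hmk)).le.trans ?_
        have h1 : (m : ℝ) ≤ (R : ℝ) - 1 := by
          have : ((m + 1 : ℕ) : ℝ) ≤ R := by exact_mod_cast hmR
          push_cast at this; linarith
        have h0 : (0 : ℝ) < m := by exact_mod_cast hm
        have h2 : 1 / ((R : ℝ) - 1) ≤ 1 / m := one_div_le_one_div_of_le h0 h1
        have h3 : (0 : ℝ) ≤ R := by positivity
        have h4 : Y * (2 - 1 / (m : ℝ)) * c ^ m ≤ Y * (2 - 1 / ((R : ℝ) - 1)) * c ^ m := by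
          gcongr
        linarith
    · refine le_trans (mul_le_mul_of_nonneg_right ?_ (by positivity)) hR
      have hRpos : (0 : ℝ) < R := by linarith
      have hR1' : (R : ℝ) - 1 ≠ 0 := by linarith
      have key : (1 + 1 / (2 * (R : ℝ) ^ 2)) * (2 - 1 / ((R : ℝ) - 1)) ≤ 2 - 1 / (R : ℝ) := by
        have e1 : 2 - 1 / (R : ℝ) - (2 - 1 / ((R : ℝ) - 1)) = 1 / ((R : ℝ) * (R - 1)) := by
          field_simp; ring
        have e2 : 1 / (R : ℝ) ^ 2 ≤ 1 / ((R : ℝ) * (R - 1)) := by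
          apply one_div_le_one_div_of_le
          · exact mul_pos hRpos (by linarith)
          · nlinarith
        have e3 : 1 / (2 * (R : ℝ) ^ 2) * (2 - 1 / ((R : ℝ) - 1)) ≤ 1 / (R : ℝ) ^ 2 := by
          have : 1 / (R : ℝ) ^ 2 = 1 / (2 * (R : ℝ) ^ 2) * 2 := by field_simp
          rw [this]
          gcongr
          linarith
        linarith
      calc _ = Y * ((1 + 1 / (2 * (R : ℝ) ^ 2)) * (2 - 1 / ((R : ℝ) - 1))) := by ring
        _ ≤ _ := by gcongr
  by_cases hslow : ∃ᶠ n : ℕ in atTop, x n < n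
  · obtain ⟨k₀, hk₀, hslow₀⟩ := frequently_atTop.1 hslow (n₀ + 1)
    have hlin : ∀ᶠ n : ℕ in atTop, (n : ℝ) ≤ c ^ n := by
      have := tendsto_pow_const_div_const_pow_of_one_lt 1 hc
      filter_upwards [this.eventually_le_const zero_lt_one] with n hn
      rw [div_le_one (by positivity)] at hn
      simpa using hn
    obtain ⟨r, ⟨hr, hrlin⟩, hkr⟩ :=
      (((hfreq (max 2 T)).and_eventually hlin).and_eventually (eventually_gt_atTop k₀)).exists
    have hr2 : 2 * c ^ r ≤ x r := le_trans (by gcongr; exact le_max_left _ _) hr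
    have hrT : T * c ^ r ≤ x r := le_trans (by gcongr; exact le_max_right _ _) hr
    classical
    -- the last slow index before `r`
    let k := Nat.findGreatest (fun n => x n < n) (r - 1)
    have hk₀k : k₀ ≤ k := Nat.le_findGreatest (by omega) hslow₀
    have hk : x k < k := Nat.findGreatest_spec (P := fun n : ℕ => x n < n) (by omega) hslow₀
    have hkr' : k ≤ r - 1 := Nat.findGreatest_le _
    have hfast : ∀ n, k < n → n ≤ r → (n : ℝ) ≤ x n := by
      intro n hkn hnr
      rcases eq_or_lt_of_le hnr with rfl | hlt
      · have : 0 < c ^ n := by positivity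
        linarith
      · exact not_lt.1 (Nat.findGreatest_is_greatest (P := fun n : ℕ => x n < n) hkn (by omega))
    obtain ⟨R, Z, hkR, hRr, hZ1, hZ2, hbound, hrec⟩ := cross k r 1 (by omega) (by omega) le_rfl
      (by linarith) (fun m hm hmk => by
        have := hmono m k hm hmk
        have : 0 < c ^ m := by positivity
        linarith)
    refine ⟨R, Z, by omega, hZ1, hbound, hrec, fun n hn => ?_⟩
    by_cases hnr : n ≤ r
    · exact Or.inl (hfast n (by omega) hnr)
    · refine Or.inr ⟨by linarith, le_trans ?_ (hmono r n (by omega) (by omega))⟩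
      rcases le_total T 0 with hT | hT
      · have : T * c ^ R ≤ 0 := mul_nonpos_of_nonpos_of_nonneg hT (by positivity)
        have : 0 < c ^ r := by positivity
        linarith
      · refine le_trans ?_ hrT
        have := pow_le_pow_right₀ hc.le hRr
        gcongr
  · rw [not_frequently] at hslow
    obtain ⟨n₁, hn₁⟩ := eventually_atTop.1 hslow
    set k := max (n₀ + 1) n₁
    have hk₀ : n₀ + 1 ≤ k := le_max_left _ _
    have hk₁ : n₁ ≤ k := le_max_right _ _
    set Y := max 1 (x k)
    obtain ⟨r, hr, hkr⟩ := ((hfreq (2 * Y)).and_eventually (eventually_gt_atTop k)).exists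
    obtain ⟨R, Z, hkR, hRr, hZ1, hZ2, hbound, hrec⟩ := cross k r Y (by omega) hkr
      (le_max_left _ _) hr (fun m hm hmk => by
        have h1 := hmono m k hm hmk
        have h2 : x k ≤ Y := le_max_right _ _
        have h3 : 1 ≤ Y := le_max_left _ _
        have h4 : 1 ≤ c ^ m := one_le_pow₀ hc.le
        have h5 : (0 : ℝ) ≤ k := by positivity
        nlinarith)
    exact ⟨R, Z, by omega, hZ1, hbound, hrec, fun n hn => Or.inl (not_lt.1 (hn₁ n (by omega)))⟩

theorem eventually_record_gain {c : ℝ} (hc : 1 < c) (W Q p K : ℝ) (hp : 0 ≤ p) (hK : 0 < K) :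
    ∀ᶠ R : ℕ in atTop, ∀ X : ℝ, c ^ R ≤ X →
      W * (R : ℝ) ^ 2 + Q + p * Real.log (K * X) ≤ X / (3 * (R : ℝ) ^ 2) := by
  have hc0 : 0 < c := by linarith
  have t := fun k : ℕ => tendsto_pow_const_div_const_pow_of_one_lt k hc
  have t1 : Tendsto (fun R : ℕ => 6 * p * ((R : ℝ) ^ 2 / c ^ R)) atTop (𝓝 0) := by
    simpa using (t 2).const_mul (6 * p)
  have t2 : Tendsto (fun R : ℕ => 6 * W * ((R : ℝ) ^ 4 / c ^ R)
      + 6 * (Q + p * Real.log K) * ((R : ℝ) ^ 2 / c ^ R)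
      + 6 * (p * Real.log c) * ((R : ℝ) ^ 3 / c ^ R)) atTop (𝓝 0) := by
    simpa using (((t 4).const_mul (6 * W)).add ((t 2).const_mul (6 * (Q + p * Real.log K)))).add
      ((t 3).const_mul (6 * (p * Real.log c)))
  filter_upwards [t1.eventually_le_const zero_lt_one, t2.eventually_le_const zero_lt_one,
    eventually_gt_atTop 0] with R h1 h2 hR X hX
  have hRpos : (0 : ℝ) < R := by exact_mod_cast hR
  have hcR : 0 < c ^ R := by positivity
  have hXpos : 0 < X := by linarith
  have hlog : Real.log (K * X) ≤ Real.log K + R * Real.log c + X / c ^ R := by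
    have e : K * X = K * (c ^ R * (X / c ^ R)) := by field_simp
    have hq : 0 < X / c ^ R := by positivity
    rw [e, Real.log_mul hK.ne' (by positivity), Real.log_mul hcR.ne' hq.ne', Real.log_pow]
    linarith [Real.log_le_sub_one_of_pos hq]
  have g1 : p * (X / c ^ R) ≤ X / (6 * (R : ℝ) ^ 2) := by
    rw [le_div_iff₀ (by positivity)]
    calc _ = X * (6 * p * ((R : ℝ) ^ 2 / c ^ R)) := by ring
      _ ≤ X * 1 := by gcongr
      _ = X := mul_one X
  have g2 : W * (R : ℝ) ^ 2 + Q + p * (Real.log K + R * Real.log c) ≤ X / (6 * (R : ℝ) ^ 2) := by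
    rw [le_div_iff₀ (by positivity)]
    refine le_trans ?_ hX
    have := mul_le_mul_of_nonneg_left h2 hcR.le
    rw [mul_one] at this
    refine le_trans (le_of_eq ?_) this
    field_simp
    ring
  have g3 : X / (3 * (R : ℝ) ^ 2) = X / (6 * (R : ℝ) ^ 2) + X / (6 * (R : ℝ) ^ 2) := by
    field_simp; ring
  have := mul_le_mul_of_nonneg_left hlog hp
  rw [g3]
  linarith

/-- At a record `x (N + e)` of `x` against `Z * c ^ m`, the weighted sum
`∑ w j * x (N + j)` dominates `W * ∑ m < N + e, x m`, where `c` is the root attached to `w`. -/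
theorem denominator_le_weighted_sum {c : ℝ} (hc : 1 < c) {e N : ℕ} (hN : 1 ≤ N) {w : ℕ → ℕ} {W : ℝ}
    (hW : ∀ j ≤ e, (w j : ℝ) ≤ W)
    (hroot : (c - 1) * ∑ j ∈ Finset.range (e + 1), (w j : ℝ) * c ^ j = W * c ^ e)
    {x : ℕ → ℝ} {Z B : ℝ} (hZ : 0 ≤ Z) (hB : 0 ≤ B)
    (hx : ∀ m, 1 ≤ m → m < N + e → x m ≤ Z * c ^ m + B) :
    W * ∑ m ∈ Finset.Ico 1 (N + e), x m ≤
      ∑ j ∈ Finset.range (e + 1), (w j : ℝ) * x (N + j)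
        + w e * (Z * c ^ (N + e) - x (N + e)) + W * (N + e) * B := by
  have hc0 : 0 < c := by linarith
  have hW0 : 0 ≤ W := le_trans (by positivity) (hW 0 (by omega))
  have hdef : ∑ j ∈ Finset.range e, (w j : ℝ) * (Z * c ^ (N + j) + B - x (N + j)) ≤
      W * ∑ m ∈ Finset.Ico 1 (N + e), (Z * c ^ m + B - x m) := by
    have hsub : Finset.Ico N (N + e) ⊆ Finset.Ico 1 (N + e) := Finset.Ico_subset_Ico_left hN
    calc _ ≤ ∑ j ∈ Finset.range e, W * (Z * c ^ (N + j) + B - x (N + j)) := by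
          refine Finset.sum_le_sum fun j hj => ?_
          rw [Finset.mem_range] at hj
          have := hx (N + j) (by omega) (by omega)
          exact mul_le_mul_of_nonneg_right (hW j hj.le) (by linarith)
      _ = W * ∑ m ∈ Finset.Ico N (N + e), (Z * c ^ m + B - x m) := by
          rw [Finset.sum_Ico_eq_sum_range, Finset.mul_sum, Nat.add_sub_cancel_left]
      _ ≤ _ := by
          refine mul_le_mul_of_nonneg_left ?_ hW0
          refine Finset.sum_le_sum_of_subset_of_nonneg hsub fun m hm _ => ?_
          rw [Finset.mem_Ico] at hm
          have := hx m hm.1 hm.2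
          linarith
  have hgeom : W * ∑ m ∈ Finset.Ico 1 (N + e), c ^ m ≤
      ∑ j ∈ Finset.range (e + 1), (w j : ℝ) * c ^ (N + j) := by
    have h1 : (c - 1) * ∑ m ∈ Finset.Ico 1 (N + e), c ^ m ≤ c ^ (N + e) := by
      rw [mul_comm, geom_sum_Ico_mul c (by omega : 1 ≤ N + e)]
      simp [hc0.le]
    have h2 : ∑ j ∈ Finset.range (e + 1), (w j : ℝ) * c ^ (N + j) =
        c ^ N * ∑ j ∈ Finset.range (e + 1), (w j : ℝ) * c ^ j := by
      rw [Finset.mul_sum]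
      exact Finset.sum_congr rfl fun j _ => by rw [pow_add]; ring
    have h3 : 0 < c - 1 := by linarith
    refine le_of_mul_le_mul_left ?_ h3
    calc _ = W * ((c - 1) * ∑ m ∈ Finset.Ico 1 (N + e), c ^ m) := by ring
      _ ≤ W * c ^ (N + e) := by gcongr
      _ = c ^ N * (W * c ^ e) := by rw [pow_add]; ring
      _ = _ := by rw [← hroot, h2]; ring
  have hsum : ∑ m ∈ Finset.Ico 1 (N + e), (Z * c ^ m + B - x m) =
      Z * ∑ m ∈ Finset.Ico 1 (N + e), c ^ m + (N + e - 1) * B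
        - ∑ m ∈ Finset.Ico 1 (N + e), x m := by
    rw [Finset.sum_sub_distrib, Finset.sum_add_distrib, ← Finset.mul_sum]
    simp [Nat.cast_sub (show 1 ≤ N + e by omega)]
  have hsum' : ∑ j ∈ Finset.range e, (w j : ℝ) * (Z * c ^ (N + j) + B - x (N + j)) =
      Z * ∑ j ∈ Finset.range e, (w j : ℝ) * c ^ (N + j) + B * ∑ j ∈ Finset.range e, (w j : ℝ)
        - ∑ j ∈ Finset.range e, (w j : ℝ) * x (N + j) := by
    rw [Finset.mul_sum, Finset.mul_sum, ← Finset.sum_add_distrib, ← Finset.sum_sub_distrib]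
    exact Finset.sum_congr rfl fun j _ => by ring
  have hwB : 0 ≤ B * ∑ j ∈ Finset.range e, (w j : ℝ) := by positivity
  have hWB : 0 ≤ W * B := by positivity
  have hgeom' := mul_le_mul_of_nonneg_left hgeom hZ
  rw [Finset.sum_range_succ] at hgeom' ⊢
  rw [hsum, hsum'] at hdef
  nlinarith

/-- `t ^ p * exp (-t)` is antitone on `[p, ∞)`. -/
theorem pow_mul_exp_neg_le {p : ℕ} {s t : ℝ} (hs : 0 < s) (hps : (p : ℝ) ≤ s) (hst : s ≤ t) :
    t ^ p * Real.exp (-t) ≤ s ^ p * Real.exp (-s) := by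
  have ht : 0 < t := hs.trans_le hst
  have h1 : (t / s) ^ p ≤ Real.exp (t - s) := by
    have h2 : t / s ≤ Real.exp (t / s - 1) := by linarith [Real.add_one_le_exp (t / s - 1)]
    calc (t / s) ^ p ≤ Real.exp (t / s - 1) ^ p := by gcongr
      _ = Real.exp (p * (t / s - 1)) := by rw [← Real.exp_nat_mul]
      _ ≤ Real.exp (t - s) := by
        gcongr
        have h3 : 0 ≤ t / s - 1 := by
          rw [sub_nonneg, one_le_div hs]; exact hst
        calc _ ≤ s * (t / s - 1) := by gcongr
          _ = t - s := by field_simp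
  rw [div_pow, div_le_iff₀ (by positivity)] at h1
  calc t ^ p * Real.exp (-t) ≤ Real.exp (t - s) * s ^ p * Real.exp (-t) := by gcongr
    _ = s ^ p * (Real.exp (t - s) * Real.exp (-t)) := by ring
    _ = s ^ p * Real.exp (-s) := by rw [← Real.exp_add]; ring_nf

theorem exists_index_with_small_denominator {c : ℝ} (hc : 1 < c) {e : ℕ} {w : ℕ → ℕ} {W : ℝ}
    (hwe : 1 ≤ w e) (hW : ∀ j ≤ e, (w j : ℝ) ≤ W)
    (hroot : (c - 1) * ∑ j ∈ Finset.range (e + 1), (w j : ℝ) * c ^ j = W * c ^ e)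
    {x : ℕ → ℝ} (hx0 : ∀ n, 0 ≤ x n) (hmono : ∀ m n, 1 ≤ m → m ≤ n → x m ≤ x n)
    (hfreq : ∀ T : ℝ, ∃ᶠ n in atTop, T * c ^ n ≤ x n) {δ : ℝ} (hδ : 0 < δ) (p : ℕ) (Q : ℝ) :
    ∃ N, 1 ≤ N ∧ (p : ℝ) + 1 ≤ x (N + e) ∧
      W * ∑ m ∈ Finset.Ico 1 (N + e), x m + Q
          + p * Real.log (∑ j ∈ Finset.range (e + 1), (w j : ℝ) * x (N + j)) ≤
        ∑ j ∈ Finset.range (e + 1), (w j : ℝ) * x (N + j) ∧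
      ∀ n, N ≤ n → (n : ℝ) ≤ x (n + e) ∨
        W * ∑ m ∈ Finset.Ico 1 (N + e), x m + Q ≤ δ * x (n + e) := by
  have hc0 : 0 < c := by linarith
  have hc1 : 0 < c - 1 := by linarith
  have hwe' : (1 : ℝ) ≤ w e := by exact_mod_cast hwe
  have hW0 : 0 ≤ W := le_trans (by positivity) (hW e le_rfl)
  set K : ℝ := ∑ j ∈ Finset.range (e + 1), (w j : ℝ) with hKdef
  have hK : 0 < K := by
    have : (w e : ℝ) ≤ K := Finset.single_le_sum (f := fun j => (w j : ℝ))
      (fun j _ => by positivity) (Finset.self_mem_range_succ e)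
    linarith
  set T : ℝ := (2 * W / (c - 1) + 1) / δ with hTdef
  have hlarge : ∀ᶠ R : ℕ in atTop, W * (R : ℝ) ^ 2 + Q ≤ c ^ R ∧ (p : ℝ) + 1 ≤ c ^ R := by
    have hev := eventually_record_gain hc W Q 0 1 le_rfl one_pos
    filter_upwards [hev, (tendsto_pow_atTop_atTop_of_one_lt hc).eventually_ge_atTop ((p : ℝ) + 1),
      eventually_gt_atTop 0] with R hR hp hR0
    refine ⟨(by simpa using hR _ le_rfl : _ ≤ c ^ R / (3 * (R : ℝ) ^ 2)).trans ?_, hp⟩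
    have : (1 : ℝ) ≤ R := by exact_mod_cast hR0
    exact div_le_self (by positivity) (by nlinarith)
  obtain ⟨n₀, hn₀⟩ := eventually_atTop.1
    ((eventually_record_gain hc W Q p K (by positivity) hK).and hlarge)
  obtain ⟨R, Z, hR, hZ, hbound, hrec, hafter⟩ := exists_exponential_record hc hmono hfreq (n₀ + e) T
  obtain ⟨N, rfl⟩ : ∃ N, R = N + e := ⟨R - e, by omega⟩
  have hN : 1 ≤ N := by omega
  obtain ⟨hgain, hbig, hpbig⟩ := hn₀ (N + e) (by omega)
  have hRpos : (1 : ℝ) ≤ ((N + e : ℕ) : ℝ) := by exact_mod_cast (by omega : 1 ≤ N + e)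
  have hden := denominator_le_weighted_sum hc hN hW hroot (by linarith) (by positivity) hbound
  rw [← Nat.cast_add] at hden
  generalize hρ : ((N + e : ℕ) : ℝ) = ρ at *
  have hcR : 0 < c ^ (N + e) := by positivity
  have hXc : c ^ (N + e) ≤ x (N + e) := by
    refine le_trans ?_ hrec
    have h1 : 0 ≤ 1 / (2 * ρ ^ 2) := by positivity
    have h2 : 1 ≤ (1 + 1 / (2 * ρ ^ 2)) * Z := by nlinarith
    exact le_mul_of_one_le_left hcR.le h2
  have hLle : ∑ j ∈ Finset.range (e + 1), (w j : ℝ) * x (N + j) ≤ K * x (N + e) := by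
    rw [hKdef, Finset.sum_mul]
    refine Finset.sum_le_sum fun j hj => ?_
    rw [Finset.mem_range] at hj
    have := hmono (N + j) (N + e) (by omega) (by omega)
    gcongr
  have hLge : x (N + e) ≤ ∑ j ∈ Finset.range (e + 1), (w j : ℝ) * x (N + j) := by
    have h1 : (w e : ℝ) * x (N + e) ≤ ∑ j ∈ Finset.range (e + 1), (w j : ℝ) * x (N + j) :=
      Finset.single_le_sum (f := fun j => (w j : ℝ) * x (N + j))
        (fun j _ => mul_nonneg (by positivity) (hx0 _)) (Finset.self_mem_range_succ e)
    have := hx0 (N + e)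
    nlinarith
  refine ⟨N, hN, hpbig.trans hXc, ?_, fun n hn => ?_⟩
  · have h1 := hgain _ hXc
    have h2 : (p : ℝ) * Real.log (∑ j ∈ Finset.range (e + 1), (w j : ℝ) * x (N + j)) ≤
        p * Real.log (K * x (N + e)) := by
      have : 0 < ∑ j ∈ Finset.range (e + 1), (w j : ℝ) * x (N + j) := by linarith
      gcongr
    have h3 : x (N + e) / (3 * ρ ^ 2) ≤ x (N + e) - Z * c ^ (N + e) := by
      have h4 : Z * c ^ (N + e) ≤ x (N + e) / (1 + 1 / (2 * ρ ^ 2)) := by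
        rw [le_div_iff₀ (by positivity)]
        linarith
      have h5 : x (N + e) / (1 + 1 / (2 * ρ ^ 2)) =
          x (N + e) - x (N + e) / (2 * ρ ^ 2 + 1) := by
        field_simp
        ring
      have h6 : x (N + e) / (3 * ρ ^ 2) ≤ x (N + e) / (2 * ρ ^ 2 + 1) := by
        have := hx0 (N + e)
        gcongr
        nlinarith
      linarith
    have h4 : 0 ≤ x (N + e) / (3 * ρ ^ 2) := div_nonneg (hx0 _) (by positivity)
    have h5 : (w e : ℝ) * (Z * c ^ (N + e) - x (N + e)) ≤ Z * c ^ (N + e) - x (N + e) := by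
      nlinarith
    nlinarith
  · rcases hafter (n + e) (by omega) with h | ⟨hZ2, hT⟩
    · left
      push_cast at h
      have : (0 : ℝ) ≤ e := by positivity
      linarith
    · right
      have h1 : ∑ m ∈ Finset.Ico 1 (N + e), x m ≤ 2 * c ^ (N + e) / (c - 1) + ρ ^ 2 := by
        have hg : ∑ m ∈ Finset.Ico 1 (N + e), c ^ m ≤ c ^ (N + e) / (c - 1) := by
          rw [le_div_iff₀ hc1, geom_sum_Ico_mul c (by omega : 1 ≤ N + e)]
          simp [hc0.le]
        calc ∑ m ∈ Finset.Ico 1 (N + e), x m ≤ ∑ m ∈ Finset.Ico 1 (N + e), (2 * c ^ m + ρ) := by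
              refine Finset.sum_le_sum fun m hm => ?_
              rw [Finset.mem_Ico] at hm
              refine (hbound m hm.1 hm.2).trans ?_
              gcongr
          _ = 2 * ∑ m ∈ Finset.Ico 1 (N + e), c ^ m + (ρ - 1) * ρ := by
              rw [Finset.sum_add_distrib, ← Finset.mul_sum, Finset.sum_const, Nat.card_Ico,
                nsmul_eq_mul, Nat.cast_sub (by omega), hρ, Nat.cast_one]
          _ ≤ 2 * (c ^ (N + e) / (c - 1)) + ρ ^ 2 := by
              gcongr
              nlinarith
          _ = _ := by ring
      have h2 : δ * (T * c ^ (N + e)) = W * (2 * c ^ (N + e) / (c - 1)) + c ^ (N + e) := by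
        rw [hTdef]
        field_simp
      have h3 := mul_le_mul_of_nonneg_left hT hδ.le
      have h4 := mul_le_mul_of_nonneg_left h1 hW0
      linarith

/-- Either a linear lower bound on the exponent `l` of the denominator of `B / exp l`, or a lower
bound on `δ * l`, gives a summable majorant with a small constant. -/
theorem term_le_of_growth {η τ s δ M : ℝ} {p : ℕ} (hs : s ≤ 2) (hp : η + 2 ≤ p)
    (hδ1 : δ ≤ 1) (hδ : (1 + τ) * (1 - δ) = η + s) {n : ℕ} (hn : 1 ≤ n)
    {B l l₀ : ℝ} (hB : B ≤ (n : ℝ) ^ η) (hl : (n : ℝ) ^ (1 + τ) ≤ Real.exp l)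
    (hl₀ : 0 < l₀) (hpl : (p : ℝ) ≤ l₀) (hll : l₀ ≤ l) (hM : M + p * Real.log l₀ ≤ l₀)
    (h : (n : ℝ) ≤ l ∨ M ≤ δ * l) :
    B / Real.exp l ≤ Real.exp (-M) * (n : ℝ) ^ (-s) := by
  have hn1 : (1 : ℝ) ≤ n := by exact_mod_cast hn
  have hn0 : (0 : ℝ) < n := by linarith
  rw [div_le_iff₀ (Real.exp_pos l)]
  refine hB.trans ?_
  rcases h with h | h
  · have h1 : l ^ p * Real.exp (-l) ≤ Real.exp (-M) := by
      refine (pow_mul_exp_neg_le hl₀ hpl hll).trans ?_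
      rw [← Real.exp_log hl₀, ← Real.exp_nat_mul, ← Real.exp_add, Real.exp_log hl₀]
      gcongr
      linarith
    have h2 : (n : ℝ) ^ (η + s) ≤ l ^ p := by
      calc (n : ℝ) ^ (η + s) ≤ (n : ℝ) ^ (p : ℝ) := by gcongr; linarith
        _ = (n : ℝ) ^ p := Real.rpow_natCast _ _
        _ ≤ l ^ p := by gcongr
    have h3 : (n : ℝ) ^ η = (n : ℝ) ^ (η + s) * (n : ℝ) ^ (-s) := by
      rw [← Real.rpow_add hn0]; ring_nf
    have h4 : l ^ p ≤ Real.exp (-M) * Real.exp l := by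
      calc l ^ p = l ^ p * Real.exp (-l) * Real.exp l := by
            rw [mul_assoc, ← Real.exp_add]; simp
        _ ≤ _ := by gcongr
    calc (n : ℝ) ^ η = (n : ℝ) ^ (η + s) * (n : ℝ) ^ (-s) := h3
      _ ≤ Real.exp (-M) * Real.exp l * (n : ℝ) ^ (-s) := by gcongr; exact h2.trans h4
      _ = _ := by ring
  · have h1 : (n : ℝ) ^ (η + s) ≤ Real.exp ((1 - δ) * l) := by
      rw [← hδ, Real.rpow_mul hn0.le, mul_comm (1 - δ), Real.exp_mul]
      exact Real.rpow_le_rpow (by positivity) hl (by linarith)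
    calc (n : ℝ) ^ η = (n : ℝ) ^ (η + s) * (n : ℝ) ^ (-s) := by
          rw [← Real.rpow_add hn0]; ring_nf
      _ ≤ Real.exp ((1 - δ) * l) * (n : ℝ) ^ (-s) := by gcongr
      _ ≤ Real.exp (-M + l) * (n : ℝ) ^ (-s) := by gcongr; linarith
      _ = _ := by rw [Real.exp_add]; ring

/-- The power `∏ (a m) ^ W` over `1 ≤ m < N + e` clears the denominators of the partial sum. -/
theorem exists_int_eq_prod_mul_partial_sum {a b w : ℕ → ℕ} {e W N : ℕ} (hN : 1 ≤ N)
    (ha : ∀ n, 1 ≤ n → 0 < a n) (hW : ∀ j ≤ e, w j ≤ W) :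
    ∃ z : ℤ, ((∏ m ∈ Finset.Ico 1 (N + e), a m ^ W : ℕ) : ℝ) * ∑ i ∈ Finset.range (N - 1),
      (b (i + 1) : ℝ) / ∏ j ∈ Finset.range (e + 1), (a (i + 1 + j) : ℝ) ^ w j = z := by
  have hdvd : ∀ i ∈ Finset.range (N - 1), (∏ j ∈ Finset.range (e + 1), a (i + 1 + j) ^ w j) ∣
      ∏ m ∈ Finset.Ico 1 (N + e), a m ^ W := by
    intro i hi
    rw [Finset.mem_range] at hi
    calc ∏ j ∈ Finset.range (e + 1), a (i + 1 + j) ^ w j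
        ∣ ∏ j ∈ Finset.range (e + 1), a (i + 1 + j) ^ W := by
          refine Finset.prod_dvd_prod_of_dvd _ _ fun j hj => pow_dvd_pow _ (hW j ?_)
          rw [Finset.mem_range] at hj
          omega
      _ = ∏ m ∈ Finset.Ico (i + 1) (i + 1 + (e + 1)), a m ^ W := by
          rw [Finset.prod_Ico_eq_prod_range, Nat.add_sub_cancel_left]
      _ ∣ _ := Finset.prod_dvd_prod_of_subset _ _ _
          (Finset.Ico_subset_Ico (by omega) (by omega))
  choose! k hk using hdvd
  refine ⟨∑ i ∈ Finset.range (N - 1), (k i * b (i + 1) : ℤ), ?_⟩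
  rw [Finset.mul_sum]
  push_cast
  refine Finset.sum_congr rfl fun i hi => ?_
  have h1 : (∏ m ∈ Finset.Ico 1 (N + e), (a m : ℝ) ^ W) =
      (∏ j ∈ Finset.range (e + 1), (a (i + 1 + j) : ℝ) ^ w j) * k i := by
    exact_mod_cast hk i hi
  have h2 : (∏ j ∈ Finset.range (e + 1), (a (i + 1 + j) : ℝ) ^ w j) ≠ 0 := by
    refine Finset.prod_ne_zero_iff.2 fun j _ => pow_ne_zero _ ?_
    exact_mod_cast (ha _ (by omega)).ne'
  rw [h1]
  field_simp

theorem frequently_mul_pow_le_log_of_limsup_eq_top {c : ℝ} (hc : 0 < c) {a : ℕ → ℕ}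
    (ha : ∀ n, 1 ≤ n → 0 < a n)
    (h : limsup (fun n : ℕ => (((a n : ℝ) ^ (1 / c ^ n) : ℝ) : EReal)) atTop = ⊤) (T : ℝ) :
    ∃ᶠ n in atTop, T * c ^ n ≤ Real.log (a n) := by
  have hlt : ((Real.exp T : ℝ) : EReal) <
      limsup (fun n : ℕ => (((a n : ℝ) ^ (1 / c ^ n) : ℝ) : EReal)) atTop := by
    rw [h]; exact EReal.coe_lt_top _
  refine ((frequently_lt_of_lt_limsup (by isBoundedDefault) hlt).and_eventually
    (eventually_ge_atTop 1)).mono ?_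
  rintro n ⟨hn, hn1⟩
  have han : (0 : ℝ) < a n := by exact_mod_cast ha n hn1
  have hn' := EReal.coe_lt_coe_iff.1 hn
  have h1 := (Real.lt_log_iff_exp_lt (by positivity)).2 hn'
  rw [Real.log_rpow han, one_div, ← div_eq_inv_mul, lt_div_iff₀ (by positivity)] at h1
  exact h1.le

/-- **Theorem: irrationality of generalized series.**
Fix `d ≥ 1` and a tuple of non-negative integers `w` (encoded as `w : ℕ → ℕ`, only
`w 0, …, w (d-1)` being relevant) with `w (d-1) ≥ 1`. With `W = max {w 0, …, w (d-1)}`,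
let `c` be the unique positive real root of
`P_w(x) = (x-1)·∑_{j<d} w_j x^j − W x^(d-1)`.
If `a`, `b` are sequences of positive integers with `a` non-decreasing, `b_n ≤ n^η`,
`a_n^{w_0}⋯a_{n+d-1}^{w_{d-1}} ≥ n^{1+τ}` for some `0 < η < τ` and all `n ≥ 1`, and
`limsup_n a_n^(1/c^n) = ∞`, then `∑_{n≥1} b_n/(a_n^{w_0}⋯a_{n+d-1}^{w_{d-1}})` is
irrational. -/
theorem stmt_2 (d : ℕ) (hd : 0 < d) (w : ℕ → ℕ) (hw : 1 ≤ w (d - 1))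
    (c : ℝ) (hc : 0 < c)
    (hroot : (c - 1) * ∑ j ∈ Finset.range d, (w j : ℝ) * c ^ j
        - (((Finset.range d).sup w : ℕ) : ℝ) * c ^ (d - 1) = 0)
    (a b : ℕ → ℕ)
    (ha_pos : ∀ n, 1 ≤ n → 0 < a n) (hb_pos : ∀ n, 1 ≤ n → 0 < b n)
    (ha_mono : ∀ n, 1 ≤ n → a n ≤ a (n + 1))
    (η τ : ℝ) (hη : 0 < η) (hητ : η < τ)
    (hb : ∀ n, 1 ≤ n → (b n : ℝ) ≤ (n : ℝ) ^ η)
    (ha : ∀ n : ℕ, 1 ≤ n → (n : ℝ) ^ (1 + τ) ≤ ∏ j ∈ Finset.range d, (a (n + j) : ℝ) ^ w j)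
    (hlimsup : limsup (fun n : ℕ => (((a n : ℝ) ^ (1 / c ^ n) : ℝ) : EReal)) atTop = ⊤) :
    Irrational (∑' n : ℕ,
      (b (n + 1) : ℝ) / ∏ j ∈ Finset.range d, (a (n + 1 + j) : ℝ) ^ w j) := by
  obtain ⟨e, rfl⟩ : ∃ e, d = e + 1 := ⟨d - 1, by omega⟩
  simp only [Nat.add_sub_cancel] at hw hroot
  set W : ℕ := (Finset.range (e + 1)).sup w
  have hwW : ∀ j ≤ e, w j ≤ W := fun j hj => Finset.le_sup (Finset.mem_range.2 (by omega))
  have hc1 : 1 < c := by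
    have hWpos : (0 : ℝ) < W := by exact_mod_cast lt_of_lt_of_le hw (hwW e le_rfl)
    have hsum : 0 ≤ ∑ j ∈ Finset.range (e + 1), (w j : ℝ) * c ^ j := by positivity
    have hpos : 0 < (W : ℝ) * c ^ e := by positivity
    by_contra hcon
    nlinarith [mul_nonneg (sub_nonneg.2 (not_lt.1 hcon)) hsum]
  set x : ℕ → ℝ := fun n => Real.log (a n)
  have hx0 : ∀ n, 0 ≤ x n := fun n => Real.log_natCast_nonneg _
  have haR : ∀ n, 1 ≤ n → (0 : ℝ) < a n := fun n hn => by exact_mod_cast ha_pos n hn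
  have hmono : ∀ m n, 1 ≤ m → m ≤ n → x m ≤ x n := by
    intro m n hm hmn
    have : a m ≤ a n := Nat.le_induction le_rfl
      (fun k hk ih => ih.trans (ha_mono k (hm.trans hk))) n hmn
    exact Real.log_le_log (haR m hm) (by exact_mod_cast this)
  set L : ℕ → ℝ := fun n => ∑ j ∈ Finset.range (e + 1), (w j : ℝ) * x (n + j) with hLdef
  have hexp : ∀ n, 1 ≤ n → ∏ j ∈ Finset.range (e + 1), (a (n + j) : ℝ) ^ w j = Real.exp (L n) := by
    intro n hn
    rw [hLdef, Real.exp_sum]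
    refine Finset.prod_congr rfl fun j _ => ?_
    rw [Real.exp_nat_mul, Real.exp_log (haR _ (by omega))]
  have hLge : ∀ n, x (n + e) ≤ L n := by
    intro n
    have h1 : (w e : ℝ) * x (n + e) ≤ L n :=
      Finset.single_le_sum (f := fun j => (w j : ℝ) * x (n + j))
        (fun j _ => mul_nonneg (by positivity) (hx0 _)) (Finset.self_mem_range_succ e)
    have h2 : (1 : ℝ) ≤ w e := by exact_mod_cast hw
    nlinarith [hx0 (n + e)]
  have hLmono : ∀ m n, 1 ≤ m → m ≤ n → L m ≤ L n := by
    intro m n hm hmn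
    refine Finset.sum_le_sum fun j _ => ?_
    have := hmono (m + j) (n + j) (by omega) (by omega)
    gcongr
  have hτ : 0 < 1 + τ := by linarith
  set s : ℝ := 1 + min 1 ((τ - η) / 2) with hsdef
  have hs1 : 1 < s := by
    have : 0 < min 1 ((τ - η) / 2) := lt_min one_pos (by linarith)
    linarith
  have hs2 : s ≤ 2 := by linarith [min_le_left 1 ((τ - η) / 2)]
  have hsτ : η + s < 1 + τ := by linarith [min_le_right 1 ((τ - η) / 2)]
  set δ : ℝ := 1 - (η + s) / (1 + τ) with hδdef
  have hδ0 : 0 < δ := by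
    rw [hδdef, sub_pos, div_lt_one hτ]; exact hsτ
  have hδ1 : δ ≤ 1 := by
    have : 0 ≤ (η + s) / (1 + τ) := div_nonneg (by linarith) hτ.le
    linarith
  have hδ : (1 + τ) * (1 - δ) = η + s := by
    rw [hδdef]; field_simp; ring
  obtain ⟨p, hp⟩ := exists_nat_ge (η + 2)
  have hmajor : Summable fun i : ℕ => ((i + 1 : ℕ) : ℝ) ^ (-s) :=
    (summable_nat_add_iff 1).2 (Real.summable_nat_rpow.2 (by linarith))
  have hterm_pos : ∀ i : ℕ, 0 < (b (i + 1) : ℝ) /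
      ∏ j ∈ Finset.range (e + 1), (a (i + 1 + j) : ℝ) ^ w j := by
    intro i
    rw [hexp _ (by omega)]
    have : (0 : ℝ) < b (i + 1) := by exact_mod_cast hb_pos _ (by omega)
    positivity
  have hterm_le : ∀ i : ℕ, (b (i + 1) : ℝ) /
      ∏ j ∈ Finset.range (e + 1), (a (i + 1 + j) : ℝ) ^ w j ≤ ((i + 1 : ℕ) : ℝ) ^ (-s) := by
    intro i
    have h0 : (0 : ℝ) < ((i + 1 : ℕ) : ℝ) := by positivity
    have h1 : (1 : ℝ) ≤ ((i + 1 : ℕ) : ℝ) := by exact_mod_cast Nat.succ_pos i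
    calc _ ≤ ((i + 1 : ℕ) : ℝ) ^ η / ((i + 1 : ℕ) : ℝ) ^ (1 + τ) :=
          div_le_div₀ (by positivity) (hb _ (by omega)) (by positivity) (ha _ (by omega))
      _ = ((i + 1 : ℕ) : ℝ) ^ (η - (1 + τ)) := (Real.rpow_sub h0 _ _).symm
      _ ≤ _ := Real.rpow_le_rpow_of_exponent_le h1 (by linarith)
  have hsummable := hmajor.of_nonneg_of_le (fun i => (hterm_pos i).le) hterm_le
  refine irrational_tsum_of_small_tails hterm_pos hsummable fun q hq => ?_
  set C : ℝ := ∑' i : ℕ, ((i + 1 : ℕ) : ℝ) ^ (-s) with hCdef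
  have hC : 0 < C := hmajor.tsum_pos (fun i => by positivity) 0 (by positivity)
  have hqR : (0 : ℝ) < q := by exact_mod_cast hq
  obtain ⟨N, hN, hpx, hgood, hafter⟩ := exists_index_with_small_denominator hc1 hw
    (W := W) (fun j hj => by exact_mod_cast hwW j hj) (by linarith) hx0 hmono
    (frequently_mul_pow_le_log_of_limsup_eq_top hc ha_pos hlimsup) hδ0 p (Real.log (q * C) + 1)
  set E : ℝ := (W : ℝ) * ∑ m ∈ Finset.Ico 1 (N + e), x m with hEdef
  have hD : ((∏ m ∈ Finset.Ico 1 (N + e), a m ^ W : ℕ) : ℝ) = Real.exp E := by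
    push_cast
    rw [hEdef, Finset.mul_sum, Real.exp_sum]
    refine Finset.prod_congr rfl fun m hm => ?_
    rw [Finset.mem_Ico] at hm
    rw [Real.exp_nat_mul, Real.exp_log (haR _ hm.1)]
  refine ⟨N - 1, ∏ m ∈ Finset.Ico 1 (N + e), a m ^ W, ?_,
    exists_int_eq_prod_mul_partial_sum hN ha_pos hwW, ?_⟩
  · exact Finset.prod_pos fun m hm => pow_pos (ha_pos m (Finset.mem_Ico.1 hm).1) _
  · set M : ℝ := E + (Real.log (q * C) + 1) with hMdef
    have htail : ∑' i : ℕ, (b (i + (N - 1) + 1) : ℝ) /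
        ∏ j ∈ Finset.range (e + 1), (a (i + (N - 1) + 1 + j) : ℝ) ^ w j ≤
        Real.exp (-M) * C := by
      rw [hCdef, ← tsum_mul_left]
      refine ((summable_nat_add_iff (N - 1)).2 hsummable).tsum_le_tsum (fun i => ?_)
        (hmajor.mul_left _)
      have hNn : N ≤ i + (N - 1) + 1 := by omega
      have hlN : (p : ℝ) + 1 ≤ L N := hpx.trans (hLge N)
      have hp0 : (0 : ℝ) ≤ p := by positivity
      rw [hexp _ (by omega)]
      refine (term_le_of_growth (M := M) hs2 hp hδ1 hδ (by omega) (hb _ (by omega))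
        ((ha _ (by omega)).trans_eq (hexp _ (by omega))) (by linarith) (by linarith)
        (hLmono N _ hN hNn) hgood ?_).trans ?_
      · have h1 := hLge (i + (N - 1) + 1)
        rcases hafter _ hNn with h | h
        · exact Or.inl (h.trans h1)
        · exact Or.inr (h.trans (by gcongr))
      · refine mul_le_mul_of_nonneg_left ?_ (Real.exp_pos _).le
        refine Real.rpow_le_rpow_of_nonpos (by positivity) ?_ (by linarith)
        exact_mod_cast (by omega : i + 1 ≤ i + (N - 1) + 1)
    rw [hD]
    calc _ ≤ (q : ℝ) * Real.exp E * (Real.exp (-M) * C) := by gcongr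
      _ = q * C * (Real.exp E * Real.exp (-M)) := by ring
      _ = q * C * (Real.exp (-Real.log (q * C)) * Real.exp (-1)) := by
          rw [← Real.exp_add, ← Real.exp_add, hMdef]; ring_nf
      _ = Real.exp (-1) := by
          rw [Real.exp_neg, Real.exp_log (by positivity)]; field_simp
      _ < 1 := by rw [Real.exp_lt_one_iff]; norm_num
end

section
/- Fix a positive integer d and a tuple of non-negative integers w = (w_0, w_1, …, w_{d-1}) with w_{d-1} ≥ 1. Let c̃_w be the largest positive real root of the polynomial P̃_w(x) = (x-1)·∑_{j=0}^{d-1} w_j x^j − x^{d-1}. Then for every real number C ∈ (1,∞) there exists a strictly increasing sequence of positive integers {a_n}_{n=1}^∞ satisfying lim_{n→∞} a_n^{1/c̃_w^n} = C such that ∑_{n=1}^∞ 1/(a_n^{w_0} · a_{n+1}^{w_1} · ⋯ · a_{n+d-1}^{w_{d-1}}) is a rational number. -/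
open Filter Topology

/-- The sequence that follows `a` below `m` and `b` from `m` on. -/
def splice (m : ℕ) (a b : ℕ → ℕ) (k : ℕ) : ℕ := if k < m then a k else b k

/-- The denominator `a_{n+1}^{w_0} ⋯ a_{n+d}^{w_{d-1}}`. -/
noncomputable def blockProd (d : ℕ) (w a : ℕ → ℕ) (n : ℕ) : ℝ :=
  ∏ j ∈ Finset.range d, (a (n + 1 + j) : ℝ) ^ w j

/-- The sum of the reciprocals of the denominators `blockProd d w a n`. -/
noncomputable def blockSum (d : ℕ) (w a : ℕ → ℕ) : ℝ := ∑' n, 1 / blockProd d w a n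

lemma splice_of_lt {m k : ℕ} (a b : ℕ → ℕ) (h : k < m) : splice m a b k = a k := if_pos h

lemma splice_of_le {m k : ℕ} (a b : ℕ → ℕ) (h : m ≤ k) : splice m a b k = b k :=
  if_neg (not_lt.mpr h)

lemma splice_congr {m : ℕ} {a a' : ℕ → ℕ} (b : ℕ → ℕ) (h : ∀ k < m, a k = a' k) :
    splice m a b = splice m a' b := by
  funext k
  unfold splice
  split_ifs with hk
  · exact h k hk
  · rfl

lemma splice_self (m : ℕ) (a : ℕ → ℕ) : splice m a a = a := by
  funext k
  simp [splice]

lemma splice_succ_update (m : ℕ) (p b : ℕ → ℕ) :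
    splice (m + 1) (Function.update p m (b m)) b = splice m p b := by
  funext k
  unfold splice
  rcases lt_trichotomy k m with h | rfl | h
  · rw [if_pos (by omega), if_pos h, Function.update_of_ne h.ne]
  · simp
  · rw [if_neg (by omega), if_neg (by omega)]

lemma le_splice {L a b : ℕ → ℕ} (ha : ∀ k, L k ≤ a k) (hb : ∀ k, L k ≤ b k) (m k : ℕ) :
    L k ≤ splice m a b k := by
  unfold splice
  split_ifs
  exacts [ha k, hb k]

/-- Consecutive overlapping intervals `[l x, u x]` cover everything between `l U` and `u L`. -/
lemma exists_mem_of_overlap {l u : ℕ → ℝ} {L U : ℕ} {S : ℝ} (hLU : L ≤ U) (hl : l U ≤ S)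
    (hu : S ≤ u L) (hstep : ∀ x, L ≤ x → x < U → l x ≤ u (x + 1)) :
    ∃ x, L ≤ x ∧ x ≤ U ∧ l x ≤ S ∧ S ≤ u x := by
  induction U, hLU using Nat.le_induction with
  | base => exact ⟨L, le_rfl, le_rfl, hl, hu⟩
  | succ U hLU ih =>
    by_cases h : S ≤ u (U + 1)
    · exact ⟨U + 1, by omega, le_rfl, hl, h⟩
    · obtain ⟨x, h1, h2, h3⟩ := ih ((hstep U hLU (by omega)).trans (not_le.mp h).le)
        (fun x h1 h2 => hstep x h1 (by omega))
      exact ⟨x, h1, by omega, h3⟩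

/-- Greedy choice of the coordinates `a m`, `m ≥ d`, of a point of the box `[L, U]` at which
`F` takes the prescribed value `S`. -/
lemma exists_eq_of_greedy {L U : ℕ → ℕ} {F : (ℕ → ℕ) → ℝ} {d : ℕ} {S : ℝ}
    (hLU : ∀ k, L k ≤ U k)
    (hstep : ∀ m p x, d ≤ m → (∀ k, L k ≤ p k) → (∀ k, p k ≤ U k) → L m ≤ x → x < U m →
      F (splice (m + 1) (Function.update p m x) U) ≤
        F (splice (m + 1) (Function.update p m (x + 1)) L))
    (hcont : ∀ a b, (∀ k, L k ≤ a k) → (∀ k, L k ≤ b k) →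
      Tendsto (fun m => F (splice m a b)) atTop (𝓝 (F a)))
    (hlo : F (splice d L U) ≤ S) (hhi : S ≤ F L) :
    ∃ a : ℕ → ℕ, (∀ k, L k ≤ a k) ∧ (∀ k, a k ≤ U k) ∧ F a = S := by
  let Inv : ℕ → (ℕ → ℕ) → Prop := fun m p =>
    (∀ k, L k ≤ p k) ∧ (∀ k, p k ≤ U k) ∧ F (splice m p U) ≤ S ∧ S ≤ F (splice m p L)
  have hnext : ∀ i p, ∃ p', Inv (d + i) p →
      Inv (d + (i + 1)) p' ∧ ∀ k < d + i, p' k = p k := by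
    intro i p
    by_cases hp : Inv (d + i) p
    · obtain ⟨h1, h2, h3, h4⟩ := hp
      obtain ⟨x, hx1, hx2, hx3, hx4⟩ := exists_mem_of_overlap
        (l := fun x => F (splice (d + i + 1) (Function.update p (d + i) x) U))
        (u := fun x => F (splice (d + i + 1) (Function.update p (d + i) x) L))
        (S := S) (hLU (d + i)) (by rwa [splice_succ_update]) (by rwa [splice_succ_update])
        (fun x hx hx' => hstep (d + i) p x (by omega) h1 h2 hx hx')
      refine ⟨Function.update p (d + i) x, fun _ => ⟨⟨?_, ?_, hx3, hx4⟩, ?_⟩⟩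
      · intro k
        rcases eq_or_ne k (d + i) with rfl | hk
        · simpa using hx1
        · simpa [hk] using h1 k
      · intro k
        rcases eq_or_ne k (d + i) with rfl | hk
        · simpa using hx2
        · simpa [hk] using h2 k
      · intro k hk
        exact Function.update_of_ne hk.ne _ _
    · exact ⟨p, fun h => absurd h hp⟩
  choose next hnext using hnext
  let s : ℕ → ℕ → ℕ := fun i => Nat.rec L next i
  have hs : ∀ i, Inv (d + i) (s i) := by
    intro i
    induction i with
    | zero => exact ⟨fun _ => le_rfl, hLU, hlo, by
        change S ≤ F (splice d L L)
        rwa [splice_self]⟩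
    | succ i ih => exact (hnext i (s i) ih).1
  have hagree : ∀ i j, i ≤ j → ∀ k < d + i, s j k = s i k := by
    intro i j hij
    induction j, hij using Nat.le_induction with
    | base => intros; rfl
    | succ j hij ih =>
      intro k hk
      rw [← ih k hk]
      exact (hnext j (s j) (hs j)).2 k (by omega)
  have hlim : ∀ i, ∀ k < d + i, s i k = s (k + 1) k := by
    intro i k hk
    rcases le_total i (k + 1) with h | h
    · exact (hagree _ _ h k hk).symm
    · exact hagree _ _ h k (by omega)
  have haL : ∀ k, L k ≤ s (k + 1) k := fun k => (hs (k + 1)).1 k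
  refine ⟨fun k => s (k + 1) k, haL, fun k => (hs (k + 1)).2.1 k, ?_⟩
  have hshift : Tendsto (fun i => d + i) atTop atTop :=
    tendsto_atTop_mono (fun i => Nat.le_add_left i d) tendsto_id
  refine le_antisymm ?_ ?_
  · refine le_of_tendsto ((hcont _ U haL hLU).comp hshift) (Eventually.of_forall fun i => ?_)
    rw [Function.comp_apply, ← splice_congr U (hlim i)]
    exact (hs i).2.2.1
  · refine ge_of_tendsto ((hcont _ L haL fun _ => le_rfl).comp hshift)
      (Eventually.of_forall fun i => ?_)
    rw [Function.comp_apply, ← splice_congr L (hlim i)]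
    exact (hs i).2.2.2

lemma blockProd_pos {d : ℕ} {w a : ℕ → ℕ} (ha : ∀ k, 0 < a k) (n : ℕ) :
    0 < blockProd d w a n :=
  Finset.prod_pos fun _ _ => pow_pos (Nat.cast_pos.mpr (ha _)) _

lemma blockProd_mono {d : ℕ} {w a b : ℕ → ℕ} (h : ∀ k, a k ≤ b k) (n : ℕ) :
    blockProd d w a n ≤ blockProd d w b n :=
  Finset.prod_le_prod (fun _ _ => by positivity) fun _ _ =>
    pow_le_pow_left₀ (Nat.cast_nonneg _) (Nat.cast_le.mpr (h _)) _

lemma blockProd_congr {d : ℕ} {w a b : ℕ → ℕ} {n : ℕ} (h : ∀ k ≤ n + d, a k = b k) :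
    blockProd d w a n = blockProd d w b n :=
  Finset.prod_congr rfl fun j hj => by
    rw [h (n + 1 + j) (by have := Finset.mem_range.mp hj; omega)]

lemma blockProd_succ (e : ℕ) (w a : ℕ → ℕ) (n : ℕ) :
    blockProd (e + 1) w a n = blockProd e w a n * (a (n + (e + 1)) : ℝ) ^ w e := by
  rw [blockProd, Finset.prod_range_succ, show n + 1 + e = n + (e + 1) by ring]
  rfl

lemma one_div_blockProd_anti {d : ℕ} {w a b : ℕ → ℕ} (ha : ∀ k, 0 < a k)
    (h : ∀ k, a k ≤ b k) (n : ℕ) : 1 / blockProd d w b n ≤ 1 / blockProd d w a n :=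
  one_div_le_one_div_of_le (blockProd_pos ha n) (blockProd_mono h n)

lemma summable_of_le {d : ℕ} {w L a : ℕ → ℕ} (hL : ∀ k, 0 < L k)
    (hsum : Summable fun n => 1 / blockProd d w L n) (ha : ∀ k, L k ≤ a k) :
    Summable fun n => 1 / blockProd d w a n :=
  Summable.of_nonneg_of_le
    (fun n => (one_div_pos.mpr (blockProd_pos (fun k => (hL k).trans_le (ha k)) n)).le)
    (fun n => one_div_blockProd_anti hL ha n) hsum

lemma tendsto_blockSum_splice {d : ℕ} {w L a b : ℕ → ℕ} (hL : ∀ k, 0 < L k)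
    (hsum : Summable fun n => 1 / blockProd d w L n) (ha : ∀ k, L k ≤ a k)
    (hb : ∀ k, L k ≤ b k) :
    Tendsto (fun m => blockSum d w (splice m a b)) atTop (𝓝 (blockSum d w a)) := by
  refine tendsto_tsum_of_dominated_convergence hsum (fun n => ?_)
    (Eventually.of_forall fun m n => ?_)
  · refine tendsto_const_nhds.congr' ?_
    filter_upwards [eventually_gt_atTop (n + d)] with m hm
    rw [blockProd_congr fun k hk => (splice_of_lt a b (hk.trans_lt hm)).symm]
  · have hs := le_splice ha hb m
    rw [Real.norm_of_nonneg
      (one_div_pos.mpr (blockProd_pos (fun k => (hL k).trans_le (hs k)) n)).le]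
    exact one_div_blockProd_anti hL hs n

/-- Decrease of `1 / x ^ w` under a unit step, relative to its value. -/
lemma one_div_pow_sub_le (w : ℕ) {x : ℝ} (hx : 0 < x) :
    1 / x ^ w - 1 / (x + 1) ^ w ≤ w / (x * x ^ w) := by
  have hbern : 1 + (w : ℝ) * (-(1 / (x + 1))) ≤ (1 + -(1 / (x + 1))) ^ w := by
    apply one_add_mul_le_pow
    have : 1 / (x + 1) ≤ 1 := by
      rw [div_le_one (by positivity)]
      linarith
    linarith
  have heq : 1 + -(1 / (x + 1)) = x / (x + 1) := by
    field_simp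
    ring
  rw [heq, div_pow] at hbern
  have hle : 1 / (x + 1) ≤ 1 / x := one_div_le_one_div_of_le hx (by linarith)
  have hw : (w : ℝ) * (1 / (x + 1)) ≤ w * (1 / x) :=
    mul_le_mul_of_nonneg_left hle (Nat.cast_nonneg w)
  have hmain : 1 - x ^ w / (x + 1) ^ w ≤ w * (1 / x) := by linarith
  have hxw : 0 < x ^ w := pow_pos hx w
  calc 1 / x ^ w - 1 / (x + 1) ^ w = (1 - x ^ w / (x + 1) ^ w) * (1 / x ^ w) := by
        field_simp
    _ ≤ w * (1 / x) * (1 / x ^ w) := mul_le_mul_of_nonneg_right hmain (by positivity)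
    _ = w / (x * x ^ w) := by
        field_simp

/-- Comparison of two series that agree before `N`, where a loss at `N` is made up for
at `N + 1`. -/
lemma tsum_le_tsum_of_crossing {f g : ℕ → ℝ} {N : ℕ} (hf : Summable f) (hg : Summable g)
    (hearly : ∀ n < N, f n = g n) (hcross : f N + f (N + 1) ≤ g N + g (N + 1))
    (hlate : ∀ n, N + 1 < n → f n ≤ g n) : ∑' n, f n ≤ ∑' n, g n := by
  rw [← hf.sum_add_tsum_nat_add (N + 2), ← hg.sum_add_tsum_nat_add (N + 2)]
  refine add_le_add ?_ (Summable.tsum_le_tsum (fun n => hlate _ (by omega))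
    ((summable_nat_add_iff (N + 2)).mpr hf) ((summable_nat_add_iff (N + 2)).mpr hg))
  rw [Finset.sum_range_succ, Finset.sum_range_succ, Finset.sum_range_succ _ (N + 1),
    Finset.sum_range_succ _ N,
    Finset.sum_congr rfl fun n hn => hearly n (Finset.mem_range.mp hn)]
  linarith

lemma one_div_blockProd_le_half {e K : ℕ} {w y z : ℕ → ℕ} (hw : 1 ≤ w e)
    (hK : K = 2 ^ (∑ j ∈ Finset.range e, w j + 1)) (hypos : ∀ k, 0 < y k)
    (hzpos : ∀ k, 0 < z k) (hzy : ∀ k, z k ≤ 2 * y k) {n : ℕ}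
    (hlast : y (n + (e + 1)) = K * z (n + (e + 1))) :
    1 / blockProd (e + 1) w y n ≤ 1 / blockProd (e + 1) w z n / 2 := by
  have hK1 : 1 ≤ K := hK ▸ Nat.one_le_two_pow
  have hpre : blockProd e w z n ≤ 2 ^ (∑ j ∈ Finset.range e, w j) * blockProd e w y n := by
    unfold blockProd
    rw [← Finset.prod_pow_eq_pow_sum, ← Finset.prod_mul_distrib]
    refine Finset.prod_le_prod (fun _ _ => by positivity) fun j _ => ?_
    rw [← mul_pow]
    exact pow_le_pow_left₀ (Nat.cast_nonneg _) (by exact_mod_cast hzy _) _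
  have hlast' : (K : ℝ) * (z (n + (e + 1)) : ℝ) ^ w e ≤ (y (n + (e + 1)) : ℝ) ^ w e := by
    rw [hlast, Nat.cast_mul, mul_pow]
    exact mul_le_mul_of_nonneg_right
      (le_self_pow₀ (by exact_mod_cast hK1) (by omega)) (by positivity)
  have hy0 : 0 < blockProd e w y n := blockProd_pos hypos n
  rw [div_div]
  refine one_div_le_one_div_of_le (mul_pos (blockProd_pos hzpos n) two_pos) ?_
  rw [blockProd_succ, blockProd_succ]
  calc blockProd e w z n * (z (n + (e + 1)) : ℝ) ^ w e * 2
      ≤ 2 ^ (∑ j ∈ Finset.range e, w j) * blockProd e w y n *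
          (z (n + (e + 1)) : ℝ) ^ w e * 2 := by gcongr
    _ = blockProd e w y n * ((K : ℝ) * (z (n + (e + 1)) : ℝ) ^ w e) := by
        rw [hK]
        push_cast
        ring
    _ ≤ _ := mul_le_mul_of_nonneg_left hlast' hy0.le

lemma one_div_blockProd_sub_le {e : ℕ} {w y z : ℕ → ℕ} {N : ℕ} (hypos : ∀ k, 0 < y k)
    (hzpos : ∀ k, 0 < z k) (hlt : ∀ k ≤ N + e, z k = y k)
    (hm : z (N + (e + 1)) = y (N + (e + 1)) + 1)
    (hratio : 2 * w e * blockProd (e + 1) w z (N + 1) ≤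
      y (N + (e + 1)) * blockProd (e + 1) w y N) :
    1 / blockProd (e + 1) w y N - 1 / blockProd (e + 1) w z N ≤
      1 / blockProd (e + 1) w z (N + 1) / 2 := by
  have hz1 := blockProd_pos (d := e + 1) (w := w) hzpos (N + 1)
  generalize blockProd (e + 1) w z (N + 1) = Z at *
  have hx0 : (0 : ℝ) < y (N + (e + 1)) := Nat.cast_pos.mpr (hypos _)
  have hB0 : 0 < blockProd e w y N := blockProd_pos hypos N
  rw [blockProd_succ] at hratio
  rw [blockProd_succ, blockProd_succ, blockProd_congr hlt, hm, Nat.cast_add, Nat.cast_one]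
  generalize (y (N + (e + 1)) : ℝ) = x at *
  generalize blockProd e w y N = B at *
  calc 1 / (B * x ^ w e) - 1 / (B * (x + 1) ^ w e)
      = 1 / B * (1 / x ^ w e - 1 / (x + 1) ^ w e) := by
        rw [mul_sub, one_div_mul_one_div, one_div_mul_one_div]
    _ ≤ 1 / B * (w e / (x * x ^ w e)) :=
        mul_le_mul_of_nonneg_left (one_div_pow_sub_le _ hx0) (by positivity)
    _ = w e / (x * (B * x ^ w e)) := by
        rw [div_mul_div_comm, one_mul, mul_left_comm]
    _ ≤ 1 / Z / 2 := by
        rw [div_div, div_le_div_iff₀ (by positivity) (by positivity)]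
        linarith

/-- The overlap condition for the greedy choice: raising the coordinate `m` by one is
compensated by moving all later coordinates from the top of the box to its bottom. -/
lemma blockSum_overlap {e K : ℕ} {w L U : ℕ → ℕ} (hL : ∀ k, 0 < L k)
    (hsum : Summable fun n => 1 / blockProd (e + 1) w L n) (hw : 1 ≤ w e)
    (hU : ∀ k, U k = K * L k) (hK : K = 2 ^ (∑ j ∈ Finset.range e, w j + 1))
    (hratio : ∀ N y z, (∀ k, L k ≤ y k) → (∀ k, z k ≤ U k) →
      2 * w e * blockProd (e + 1) w z (N + 1) ≤
        y (N + (e + 1)) * blockProd (e + 1) w y N)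
    (m : ℕ) (p : ℕ → ℕ) (x : ℕ) (hm : e + 1 ≤ m) (hpL : ∀ k, L k ≤ p k)
    (hpU : ∀ k, p k ≤ U k) (hxL : L m ≤ x) (hxU : x < U m) :
    blockSum (e + 1) w (splice (m + 1) (Function.update p m x) U) ≤
      blockSum (e + 1) w (splice (m + 1) (Function.update p m (x + 1)) L) := by
  have hK1 : 1 ≤ K := hK ▸ Nat.one_le_two_pow
  have hLU : ∀ k, L k ≤ U k := fun k => by
    rw [hU]
    exact Nat.le_mul_of_pos_left _ hK1
  obtain ⟨N, rfl⟩ : ∃ N, m = N + (e + 1) := ⟨m - (e + 1), by omega⟩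
  set m := N + (e + 1) with hm_def
  set y := splice (m + 1) (Function.update p m x) U with hy
  set z := splice (m + 1) (Function.update p m (x + 1)) L with hz
  have hylt : ∀ k < m, y k = p k := fun k hk => by
    rw [hy, splice_of_lt _ _ (by omega), Function.update_of_ne hk.ne]
  have hzlt : ∀ k < m, z k = p k := fun k hk => by
    rw [hz, splice_of_lt _ _ (by omega), Function.update_of_ne hk.ne]
  have hym : y m = x := by rw [hy, splice_of_lt _ _ (by omega), Function.update_self]
  have hzm : z m = x + 1 := by rw [hz, splice_of_lt _ _ (by omega), Function.update_self]
  have hygt : ∀ k, m < k → y k = U k := fun k hk => by rw [hy, splice_of_le _ _ hk]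
  have hzgt : ∀ k, m < k → z k = L k := fun k hk => by rw [hz, splice_of_le _ _ hk]
  have hyL : ∀ k, L k ≤ y k := fun k => by
    rcases lt_trichotomy k m with h | rfl | h
    · rw [hylt k h]; exact hpL k
    · rw [hym]; exact hxL
    · rw [hygt k h]; exact hLU k
  have hzL : ∀ k, L k ≤ z k := fun k => by
    rcases lt_trichotomy k m with h | rfl | h
    · rw [hzlt k h]; exact hpL k
    · rw [hzm]; omega
    · rw [hzgt k h]
  have hzU : ∀ k, z k ≤ U k := fun k => by
    rcases lt_trichotomy k m with h | rfl | h
    · rw [hzlt k h]; exact hpU k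
    · rw [hzm]; omega
    · rw [hzgt k h]; exact hLU k
  have hypos : ∀ k, 0 < y k := fun k => (hL k).trans_le (hyL k)
  have hzpos : ∀ k, 0 < z k := fun k => (hL k).trans_le (hzL k)
  have hzy : ∀ k, z k ≤ 2 * y k := fun k => by
    rcases lt_trichotomy k m with h | rfl | h
    · rw [hzlt k h, hylt k h]; omega
    · rw [hzm, hym]; have := hL m; omega
    · rw [hzgt k h, hygt k h]; have := hLU k; omega
  have hlate : ∀ n, N < n →
      1 / blockProd (e + 1) w y n ≤ 1 / blockProd (e + 1) w z n / 2 := fun n hn =>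
    one_div_blockProd_le_half hw hK hypos hzpos hzy
      (by rw [hygt _ (by omega), hzgt _ (by omega), hU])
  have hcross := one_div_blockProd_sub_le (w := w) (N := N) hypos hzpos
    (fun k hk => by rw [hzlt k (by omega), hylt k (by omega)]) (by rw [← hm_def, hzm, hym])
    (hratio N y z hyL hzU)
  refine tsum_le_tsum_of_crossing (N := N) (summable_of_le hL hsum hyL)
    (summable_of_le hL hsum hzL) (fun n hn => ?_) ?_ fun n hn => ?_
  · rw [blockProd_congr fun k hk => ?_]
    rw [hylt k (by omega), hzlt k (by omega)]
  · have := hlate (N + 1) (by omega)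
    linarith
  · have h1 := hlate n (by omega)
    have h2 := one_div_pos.mpr (blockProd_pos (d := e + 1) (w := w) hzpos n)
    linarith

/-- The scale `g h^k C^(c^k)` of the `k`-th coordinate. -/
noncomputable def scale (g h C c : ℝ) (k : ℕ) : ℝ := g * h ^ k * C ^ (c ^ k)

lemma rpow_le_scale {g h C c : ℝ} (hg : 1 ≤ g) (hh : 1 ≤ h) (hC : 1 < C) (k : ℕ) :
    g * C ^ (c ^ k) ≤ scale g h C c k := by
  have h0 : 0 < C ^ (c ^ k) := Real.rpow_pos_of_pos (by linarith) _
  unfold scale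
  gcongr
  exact le_mul_of_one_le_right (by linarith) (one_le_pow₀ hh)

lemma pow_le_scale {g h C c : ℝ} (hg : 1 ≤ g) (hh : 1 ≤ h) (hC : 1 < C) (hc : 1 < c) (k : ℕ) :
    h ^ k ≤ scale g h C c k := by
  have h0 : 1 ≤ C ^ (c ^ k) := Real.one_le_rpow hC.le (by positivity)
  have h1 : 0 < h ^ k := by positivity
  calc h ^ k ≤ g * h ^ k := le_mul_of_one_le_left h1.le hg
    _ ≤ scale g h C c k := le_mul_of_one_le_right (by positivity) h0

lemma scale_succ {g h C c : ℝ} (hC : 1 < C) (k : ℕ) :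
    scale g h C c (k + 1) = h * C ^ ((c - 1) * c ^ k) * scale g h C c k := by
  unfold scale
  rw [show c ^ (k + 1) = (c - 1) * c ^ k + c ^ k by ring, Real.rpow_add (by linarith)]
  ring

lemma mul_scale_le_scale_succ {g h C c : ℝ} (hg : 1 ≤ g) (hh : 1 ≤ h) (hC : 1 < C)
    (hc : 1 < c) (k : ℕ) : h * scale g h C c k ≤ scale g h C c (k + 1) := by
  have h0 : 0 < scale g h C c k := lt_of_lt_of_le (by positivity) (pow_le_scale hg hh hC hc k)
  have h1 : 1 ≤ C ^ ((c - 1) * c ^ k) :=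
    Real.one_le_rpow hC.le (mul_nonneg (by linarith) (by positivity))
  rw [scale_succ hC]
  gcongr
  exact le_mul_of_one_le_right (by linarith) h1

/-- The root condition on `c` makes the shifted product of scales exceed the original one by
a bounded multiple of the newest scale. -/
lemma prod_scale_succ {g h C c : ℝ} (hC : 1 < C) {e : ℕ} {w : ℕ → ℕ}
    (hroot : (c - 1) * ∑ j ∈ Finset.range (e + 1), (w j : ℝ) * c ^ j = c ^ e) (N : ℕ) :
    ∏ j ∈ Finset.range (e + 1), scale g h C c (N + 1 + 1 + j) ^ w j =
      h ^ (∑ j ∈ Finset.range (e + 1), w j) * C ^ (c ^ (N + (e + 1))) *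
        ∏ j ∈ Finset.range (e + 1), scale g h C c (N + 1 + j) ^ w j := by
  have hC0 : 0 < C := by linarith
  have hexp : c ^ (N + (e + 1)) =
      ∑ j ∈ Finset.range (e + 1), (c - 1) * c ^ (N + 1 + j) * (w j : ℝ) := by
    rw [show N + (e + 1) = (N + 1) + e by ring, pow_add, ← hroot, Finset.mul_sum,
      Finset.mul_sum]
    refine Finset.sum_congr rfl fun j _ => ?_
    rw [pow_add c (N + 1) j]
    ring
  rw [hexp, Real.rpow_sum_of_pos hC0, ← Finset.prod_pow_eq_pow_sum,
    ← Finset.prod_mul_distrib, ← Finset.prod_mul_distrib]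
  refine Finset.prod_congr rfl fun j _ => ?_
  rw [show N + 1 + 1 + j = N + 1 + j + 1 by ring, scale_succ hC, mul_pow, mul_pow,
    ← Real.rpow_mul_natCast hC0.le]

lemma blockProd_ratio {g h C c K : ℝ} {e : ℕ} {w y z : ℕ → ℕ} (hg : 1 ≤ g) (hh : 1 ≤ h)
    (hC : 1 < C) (hc : 1 < c)
    (hroot : (c - 1) * ∑ j ∈ Finset.range (e + 1), (w j : ℝ) * c ^ j = c ^ e)
    (hg_eq : g = 2 * w e * (K * h) ^ (∑ j ∈ Finset.range (e + 1), w j))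
    (hy : ∀ k, scale g h C c k ≤ y k) (hz : ∀ k, (z k : ℝ) ≤ K * scale g h C c k) (N : ℕ) :
    2 * w e * blockProd (e + 1) w z (N + 1) ≤
      y (N + (e + 1)) * blockProd (e + 1) w y N := by
  have hpos : ∀ k, 0 < scale g h C c k := fun k =>
    lt_of_lt_of_le (by positivity) (pow_le_scale hg hh hC hc k)
  have hC0 : 0 < C ^ (c ^ (N + (e + 1))) := Real.rpow_pos_of_pos (by linarith) _
  have hzb : blockProd (e + 1) w z (N + 1) ≤ K ^ (∑ j ∈ Finset.range (e + 1), w j) *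
      ∏ j ∈ Finset.range (e + 1), scale g h C c (N + 1 + 1 + j) ^ w j := by
    unfold blockProd
    rw [← Finset.prod_pow_eq_pow_sum, ← Finset.prod_mul_distrib]
    refine Finset.prod_le_prod (fun _ _ => by positivity) fun j _ => ?_
    rw [← mul_pow]
    exact pow_le_pow_left₀ (Nat.cast_nonneg _) (hz _) _
  have hyb : ∏ j ∈ Finset.range (e + 1), scale g h C c (N + 1 + j) ^ w j ≤
      blockProd (e + 1) w y N :=
    Finset.prod_le_prod (fun _ _ => (pow_pos (hpos _) _).le) fun j _ =>
      pow_le_pow_left₀ (hpos _).le (hy _) _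
  rw [prod_scale_succ hC hroot] at hzb
  have hP : 0 ≤ ∏ j ∈ Finset.range (e + 1), scale g h C c (N + 1 + j) ^ w j :=
    Finset.prod_nonneg fun _ _ => (pow_pos (hpos _) _).le
  have hlast := (rpow_le_scale (c := c) hg hh hC (N + (e + 1))).trans (hy _)
  calc 2 * w e * blockProd (e + 1) w z (N + 1)
      ≤ 2 * w e * _ := mul_le_mul_of_nonneg_left hzb (by positivity)
    _ = g * C ^ (c ^ (N + (e + 1))) *
          ∏ j ∈ Finset.range (e + 1), scale g h C c (N + 1 + j) ^ w j := by
        rw [hg_eq, mul_pow]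
        ring
    _ ≤ _ := mul_le_mul hlast hyb hP (Nat.cast_nonneg _)

lemma tendsto_rpow_of_scale_le {g h C c K : ℝ} {a : ℕ → ℕ} (hg : 1 ≤ g) (hh : 1 ≤ h)
    (hC : 1 < C) (hc : 1 < c) (hK : 0 < K) (hl : ∀ k, scale g h C c k ≤ a k)
    (hu : ∀ k, (a k : ℝ) ≤ K * scale g h C c k) :
    Tendsto (fun n : ℕ => (a n : ℝ) ^ (1 / c ^ n)) atTop (𝓝 C) := by
  have hC0 : 0 < C := by linarith
  have hpos : ∀ k, 0 < scale g h C c k := fun k =>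
    lt_of_lt_of_le (by positivity) (pow_le_scale hg hh hC hc k)
  have ha0 : ∀ k, (0 : ℝ) < a k := fun k => (hpos k).trans_le (hl k)
  have hlog : ∀ k, Real.log (scale g h C c k) =
      Real.log g + k * Real.log h + c ^ k * Real.log C := fun k => by
    have h0 : 0 < C ^ (c ^ k) := Real.rpow_pos_of_pos hC0 _
    unfold scale
    rw [Real.log_mul (by positivity) h0.ne', Real.log_mul (by positivity) (by positivity),
      Real.log_pow, Real.log_rpow hC0]
  have hinv : Tendsto (fun n : ℕ => 1 / c ^ n) atTop (𝓝 0) := by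
    simpa using tendsto_pow_const_div_const_pow_of_one_lt 0 hc
  have hlin : Tendsto (fun n : ℕ => (n : ℝ) / c ^ n) atTop (𝓝 0) := by
    simpa using tendsto_pow_const_div_const_pow_of_one_lt 1 hc
  have hupper : Tendsto (fun n : ℕ => (Real.log K + Real.log g) * (1 / c ^ n) +
      Real.log h * ((n : ℝ) / c ^ n) + Real.log C) atTop (𝓝 (Real.log C)) := by
    simpa using ((hinv.const_mul (Real.log K + Real.log g)).add
      (hlin.const_mul (Real.log h))).add_const (Real.log C)
  have hmid : Tendsto (fun n : ℕ => Real.log (a n) * (1 / c ^ n)) atTop (𝓝 (Real.log C)) := by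
    refine tendsto_of_tendsto_of_tendsto_of_le_of_le tendsto_const_nhds hupper
      (fun n => ?_) (fun n => ?_)
    · have hcn : 0 < c ^ n := by positivity
      have h1 := Real.log_le_log (hpos n) (hl n)
      rw [hlog] at h1
      have h2 : 0 ≤ (n : ℝ) * Real.log h := mul_nonneg (Nat.cast_nonneg _) (Real.log_nonneg hh)
      have h3 := Real.log_nonneg hg
      simp only [mul_one_div]
      rw [le_div_iff₀ hcn]
      linarith
    · have hcn : 0 < c ^ n := by positivity
      have h1 := Real.log_le_log (ha0 n) (hu n)
      rw [Real.log_mul hK.ne' (hpos n).ne', hlog] at h1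
      have h2 := mul_le_mul_of_nonneg_right h1 (one_div_pos.mpr hcn).le
      refine h2.trans_eq ?_
      field_simp
      ring
  have hexp := (Real.continuous_exp.tendsto _).comp hmid
  rw [Real.exp_log hC0] at hexp
  refine hexp.congr fun n => ?_
  rw [Function.comp_apply, Real.rpow_def_of_pos (ha0 n)]

lemma one_lt_of_root {e : ℕ} {w : ℕ → ℕ} {c : ℝ} (hc : 0 < c)
    (hroot : (c - 1) * ∑ j ∈ Finset.range (e + 1), (w j : ℝ) * c ^ j = c ^ e) : 1 < c := by
  have h1 : 0 ≤ ∑ j ∈ Finset.range (e + 1), (w j : ℝ) * c ^ j := by positivity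
  have h2 : 0 < (c - 1) * ∑ j ∈ Finset.range (e + 1), (w j : ℝ) * c ^ j := by
    rw [hroot]
    positivity
  linarith [pos_of_mul_pos_left h2 h1]

lemma summable_one_div_blockProd {e : ℕ} {w L : ℕ → ℕ} {h : ℝ} (hw : 1 ≤ w e) (hh : 1 < h)
    (hL : ∀ k, h ^ k ≤ L k) : Summable fun n => 1 / blockProd (e + 1) w L n := by
  have hL1 : ∀ k, (1 : ℝ) ≤ L k := fun k => (one_le_pow₀ hh.le).trans (hL k)
  have hL0 : ∀ k, 0 < L k := fun k => by exact_mod_cast zero_lt_one.trans_le (hL1 k)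
  refine Summable.of_nonneg_of_le (fun n => (one_div_pos.mpr (blockProd_pos hL0 n)).le)
    (fun n => ?_) (summable_geometric_of_lt_one (inv_pos.mpr (by linarith)).le
      (inv_lt_one_of_one_lt₀ hh))
  rw [inv_pow, ← one_div]
  refine one_div_le_one_div_of_le (by positivity) ?_
  rw [blockProd_succ]
  have h1 : 1 ≤ blockProd e w L n := by
    unfold blockProd
    exact Finset.one_le_prod fun _ _ => one_le_pow₀ (hL1 _)
  calc h ^ n ≤ h ^ (n + (e + 1)) := pow_le_pow_right₀ hh.le (by omega)
    _ ≤ L (n + (e + 1)) := hL _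
    _ ≤ (L (n + (e + 1)) : ℝ) ^ w e := le_self_pow₀ (hL1 _) (by omega)
    _ ≤ _ := le_mul_of_one_le_left (by positivity) h1

lemma blockSum_splice_lt {e : ℕ} {w L U : ℕ → ℕ} (hw : 1 ≤ w e) (hL : ∀ k, 0 < L k)
    (hLU : ∀ k, L k < U k) (hsum : Summable fun n => 1 / blockProd (e + 1) w L n) :
    blockSum (e + 1) w (splice (e + 1) L U) < blockSum (e + 1) w L := by
  have hs : ∀ k, L k ≤ splice (e + 1) L U k :=
    le_splice (fun _ => le_rfl) (fun k => (hLU k).le) _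
  refine Summable.tsum_lt_tsum (i := 0) (fun n => one_div_blockProd_anti hL hs n) ?_
    (summable_of_le hL hsum hs) hsum
  refine one_div_lt_one_div_of_lt (blockProd_pos hL 0) ?_
  rw [blockProd_succ, blockProd_succ, splice_of_le _ _ (by omega)]
  refine mul_lt_mul' (blockProd_mono hs 0) ?_ (by positivity)
    (blockProd_pos (fun k => (hL k).trans_le (hs k)) 0)
  exact pow_lt_pow_left₀ (by exact_mod_cast hLU _) (by positivity) (by omega)

/-- **negative result.** Fix `d ≥ 1` and non-negative integers
`w 0, …, w (d-1)` with `w (d-1) ≥ 1`. Let `c` be the largest positive real root of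
`P̃_w(x) = (x-1)·∑_{j<d} w_j x^j − x^(d-1)`. Then for every real `C > 1` there is a
strictly increasing sequence of positive integers `a` with `lim_n a_n^(1/c^n) = C` and
`∑_{n≥1} 1/(a_n^{w_0}⋯a_{n+d-1}^{w_{d-1}})` rational. -/
theorem stmt_3 (d : ℕ) (hd : 0 < d) (w : ℕ → ℕ) (hw : 1 ≤ w (d - 1))
    (c : ℝ) (hc : 0 < c)
    (hroot : (c - 1) * ∑ j ∈ Finset.range d, (w j : ℝ) * c ^ j - c ^ (d - 1) = 0)
    (hmax : ∀ x : ℝ, 0 < x →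
      (x - 1) * ∑ j ∈ Finset.range d, (w j : ℝ) * x ^ j - x ^ (d - 1) = 0 → x ≤ c)
    (C : ℝ) (hC : 1 < C) :
    ∃ a : ℕ → ℕ, (∀ n, 1 ≤ n → 0 < a n) ∧ (∀ n, 1 ≤ n → a n < a (n + 1)) ∧
      Tendsto (fun n : ℕ => (a n : ℝ) ^ (1 / c ^ n)) atTop (𝓝 C) ∧
      ∃ q : ℚ, (∑' n : ℕ, 1 / ∏ j ∈ Finset.range d, (a (n + 1 + j) : ℝ) ^ w j) = q := by
  obtain ⟨e, rfl⟩ : ∃ e, d = e + 1 := ⟨d - 1, by omega⟩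
  rw [Nat.add_sub_cancel] at hw hroot
  rw [sub_eq_zero] at hroot
  have hc1 := one_lt_of_root hc hroot
  obtain ⟨K, hK⟩ : ∃ K : ℕ, K = 2 ^ (∑ j ∈ Finset.range e, w j + 1) := ⟨_, rfl⟩
  have hK2 : 2 ≤ K := hK ▸ le_self_pow₀ one_le_two (by omega)
  have hK2' : (2 : ℝ) ≤ K := by exact_mod_cast hK2
  obtain ⟨h, hh⟩ : ∃ h : ℝ, h = 4 * K := ⟨_, rfl⟩
  have hh1 : 1 < h := by linarith
  obtain ⟨g, hg⟩ : ∃ g : ℝ, g =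
    2 * w e * (2 * K * h) ^ (∑ j ∈ Finset.range (e + 1), w j) := ⟨_, rfl⟩
  have hg1 : 1 ≤ g := by
    have h1 : (1 : ℝ) ≤ w e := by exact_mod_cast hw
    have h2 : (1 : ℝ) ≤ (2 * K * h) ^ (∑ j ∈ Finset.range (e + 1), w j) :=
      one_le_pow₀ (by nlinarith)
    rw [hg]
    nlinarith
  have hscale : ∀ k, 1 ≤ scale g h C c k := fun k =>
    (one_le_pow₀ hh1.le).trans (pow_le_scale hg1 hh1.le hC hc1 k)
  obtain ⟨L, hL⟩ : ∃ L : ℕ → ℕ, ∀ k, L k = ⌈scale g h C c k⌉₊ := ⟨_, fun _ => rfl⟩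
  have hLl : ∀ k, scale g h C c k ≤ L k := fun k => by
    rw [hL]
    exact Nat.le_ceil _
  have hLu : ∀ k, (L k : ℝ) ≤ 2 * scale g h C c k := fun k => by
    rw [hL]
    linarith [Nat.ceil_lt_add_one (zero_le_one.trans (hscale k)), hscale k]
  have hL0 : ∀ k, 0 < L k := fun k => by
    exact_mod_cast zero_lt_one.trans_le ((hscale k).trans (hLl k))
  have hUu : ∀ k a, a ≤ K * L k → (a : ℝ) ≤ 2 * K * scale g h C c k := fun k a ha => by
    have h1 : (a : ℝ) ≤ K * L k := by exact_mod_cast ha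
    nlinarith [hLu k]
  have hLU : ∀ k, L k < K * L k := fun k => by nlinarith [hL0 k]
  have hsum : Summable fun n => 1 / blockProd (e + 1) w L n :=
    summable_one_div_blockProd hw hh1 fun k =>
      (pow_le_scale hg1 hh1.le hC hc1 k).trans (hLl k)
  obtain ⟨q, hq1, hq2⟩ := exists_rat_btwn
    (blockSum_splice_lt (U := fun k => K * L k) hw hL0 hLU hsum)
  obtain ⟨a, haL, haU, haq⟩ := exists_eq_of_greedy (F := blockSum (e + 1) w)
    (U := fun k => K * L k) (fun k => (hLU k).le)
    (blockSum_overlap hL0 hsum hw (fun _ => rfl) hK fun N y z hy hz =>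
      blockProd_ratio hg1 hh1.le hC hc1 hroot hg
        (fun k => (hLl k).trans (by exact_mod_cast hy k)) (fun k => hUu k _ (hz k)) N)
    (fun a b ha hb => tendsto_blockSum_splice hL0 hsum ha hb) hq1.le hq2.le
  refine ⟨a, fun n _ => (hL0 n).trans_le (haL n), fun n _ => ?_, ?_, q, haq⟩
  · have h1 := hUu n _ (haU n)
    have h2 := mul_scale_le_scale_succ hg1 hh1.le hC hc1 n
    have h3 := hLl (n + 1)
    have h4 : (L (n + 1) : ℝ) ≤ a (n + 1) := by exact_mod_cast haL (n + 1)
    have h5 : (a n : ℝ) < a (n + 1) := by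
      rw [hh] at h1 h2 h3
      rw [hh] at hscale
      nlinarith [hscale n]
    exact_mod_cast h5
  · exact tendsto_rpow_of_scale_le hg1 hh1.le hC hc1 (by positivity : (0 : ℝ) < 2 * K)
      (fun k => (hLl k).trans (by exact_mod_cast haL k)) fun k => hUu k _ (haU k)
end

section
/- If a_1 < a_2 < ⋯ is a strictly increasing sequence of positive integers with liminf_{n→∞} a_n^{1/2^n} > 1, then the sum ∑_{n=1}^∞ 1/(a_n a_{n+1}) is irrational. -/
open Filter Topology

/-- Multiplying by the product of all the factors clears the denominators of a partial sum. -/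
lemma exists_int_prod_mul_sum_one_div_mul_succ (b : ℕ → ℕ) (hb : ∀ n, 0 < b n) (n : ℕ) :
    ∃ z : ℤ, (∏ j ∈ Finset.range (n + 1), (b j : ℝ)) *
      ∑ k ∈ Finset.range n, 1 / ((b k : ℝ) * b (k + 1)) = z := by
  induction n with
  | zero => exact ⟨0, by simp⟩
  | succ n ih =>
    obtain ⟨z, hz⟩ := ih
    refine ⟨b (n + 1) * z + ∏ j ∈ Finset.range n, (b j : ℤ), ?_⟩
    have h0 : (b n : ℝ) ≠ 0 := by exact_mod_cast (hb n).ne'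
    have h1 : (b (n + 1) : ℝ) ≠ 0 := by exact_mod_cast (hb (n + 1)).ne'
    rw [Finset.prod_range_succ, Finset.sum_range_succ, mul_add]
    push_cast
    rw [← hz, Finset.prod_range_succ]
    field_simp

/-- A product of terms bounded by `exp (T * (7 / 4) ^ j)` is controlled by a geometric sum. -/
lemma prod_range_le_exp_of_log_le (b : ℕ → ℕ) (hb : ∀ n, 0 < b n) {T : ℝ} (hT : 0 ≤ T) (n : ℕ)
    (h : ∀ j < n, Real.log (b j) ≤ T * (7 / 4) ^ j) :
    ∏ j ∈ Finset.range n, (b j : ℝ) ≤ Real.exp (4 / 3 * T * (7 / 4) ^ n) := by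
  calc ∏ j ∈ Finset.range n, (b j : ℝ)
      ≤ ∏ j ∈ Finset.range n, Real.exp (T * (7 / 4) ^ j) := by
        refine Finset.prod_le_prod (fun _ _ => Nat.cast_nonneg _) fun j hj => ?_
        rw [← Real.log_le_iff_le_exp (by exact_mod_cast hb j)]
        exact h j (Finset.mem_range.1 hj)
    _ = Real.exp (T * ∑ j ∈ Finset.range n, (7 / 4 : ℝ) ^ j) := by
        rw [← Real.exp_sum, Finset.mul_sum]
    _ ≤ Real.exp (4 / 3 * T * (7 / 4) ^ n) := by
        rw [geom_sum_eq (by norm_num)]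
        refine Real.exp_le_exp.2 ?_
        ring_nf
        linarith

lemma summable_one_div_sqrt_of_two_pow_le_log (b : ℕ → ℕ) (hb : ∀ n, 0 < b n) {δ : ℝ}
    (hδ : 0 < δ) (h : ∀ᶠ n in atTop, δ * 2 ^ n ≤ Real.log (b n)) :
    Summable fun n => 1 / √(b n : ℝ) := by
  refine Summable.of_norm_bounded_eventually_nat (g := fun n => 2 / δ * (1 / 2 : ℝ) ^ n)
    (summable_geometric_two.mul_left _) ?_
  filter_upwards [h] with n hn
  have hbn : (0 : ℝ) < b n := by exact_mod_cast hb n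
  have hs : 0 < √(b n : ℝ) := Real.sqrt_pos.2 hbn
  have h1 : Real.log √(b n : ℝ) = Real.log (b n) / 2 := Real.log_sqrt hbn.le
  have h2 := Real.log_le_sub_one_of_pos hs
  have h3 : δ * 2 ^ n / 2 ≤ √(b n : ℝ) := by linarith
  rw [Real.norm_of_nonneg (by positivity)]
  calc 1 / √(b n : ℝ) ≤ 1 / (δ * 2 ^ n / 2) := one_div_le_one_div_of_le (by positivity) h3
    _ = 2 / δ * (1 / 2 : ℝ) ^ n := by
      rw [one_div_pow]
      field_simp

/-- Consecutive products in the tail from `m` on cost at most `b m ^ (-3 / 2)`. -/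
lemma one_div_mul_succ_le (b : ℕ → ℕ) (hb : ∀ n, 0 < b n) (hmono : Monotone b) (m k : ℕ) :
    1 / ((b (k + m) : ℝ) * b (k + m + 1)) ≤
      Real.exp (-(3 / 2) * Real.log (b m)) * (1 / √(b (k + m + 1) : ℝ)) := by
  have hm : (0 : ℝ) < b m := by exact_mod_cast hb m
  have hk : (0 : ℝ) < b (k + m + 1) := by exact_mod_cast hb _
  have h1 : (b m : ℝ) ≤ b (k + m) := by exact_mod_cast hmono (Nat.le_add_left m k)
  have h2 : (b m : ℝ) ≤ b (k + m + 1) := by exact_mod_cast hmono (by omega)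
  have hexp : Real.exp (-(3 / 2) * Real.log (b m)) = 1 / (b m * √(b m : ℝ)) := by
    have : (b m : ℝ) * √(b m : ℝ) = Real.exp (3 / 2 * Real.log (b m)) := by
      rw [Real.sqrt_eq_rpow, Real.rpow_def_of_pos hm]
      nth_rewrite 1 [← Real.exp_log hm]
      rw [← Real.exp_add]
      ring_nf
    rw [this, one_div, ← Real.exp_neg, neg_mul]
  rw [hexp, one_div_mul_one_div]
  have hsm : 0 < √(b m : ℝ) := Real.sqrt_pos.2 hm
  have hsk : 0 < √(b (k + m + 1) : ℝ) := Real.sqrt_pos.2 hk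
  refine one_div_le_one_div_of_le (by positivity) ?_
  rw [mul_assoc]
  refine mul_le_mul h1 ?_ (by positivity) (by positivity)
  calc √(b m : ℝ) * √(b (k + m + 1) : ℝ)
      ≤ √(b (k + m + 1) : ℝ) * √(b (k + m + 1) : ℝ) := by gcongr
    _ = b (k + m + 1) := Real.mul_self_sqrt hk.le

theorem irrational_tsum_one_div_mul_succ (b : ℕ → ℕ) (hb : ∀ n, 0 < b n) (hmono : Monotone b)
    {δ : ℝ} (hδ : 0 < δ) (h : ∀ᶠ n in atTop, δ * 2 ^ n ≤ Real.log (b n)) :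
    Irrational (∑' n, 1 / ((b n : ℝ) * b (n + 1))) := by
  have hpos : ∀ n, (0 : ℝ) < b n := fun n => by exact_mod_cast hb n
  have hsq := summable_one_div_sqrt_of_two_pow_le_log b hb hδ h
  set C : ℝ := ∑' n, 1 / √(b n : ℝ) with hC
  set f : ℕ → ℝ := fun n => 1 / ((b n : ℝ) * b (n + 1)) with hf
  have hfpos : ∀ n, 0 < f n := fun n => one_div_pos.2 (mul_pos (hpos _) (hpos _))
  have hfs : Summable f := by
    refine Summable.of_nonneg_of_le (fun n => (hfpos n).le)
      (fun n => one_div_mul_succ_le b hb hmono 0 n) ?_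
    exact ((summable_nat_add_iff 1).2 hsq).mul_left _
  have htail : ∀ m, ∑' k, f (k + m) ≤ Real.exp (-(3 / 2) * Real.log (b m)) * C := by
    intro m
    have hsm : Summable fun k => 1 / √(b (k + m + 1) : ℝ) := (summable_nat_add_iff (m + 1)).2 hsq
    calc ∑' k, f (k + m)
        ≤ ∑' k, Real.exp (-(3 / 2) * Real.log (b m)) * (1 / √(b (k + m + 1) : ℝ)) :=
          ((summable_nat_add_iff m).2 hfs).tsum_le_tsum
            (fun k => one_div_mul_succ_le b hb hmono m k) (hsm.mul_left _)
      _ = Real.exp (-(3 / 2) * Real.log (b m)) * ∑' k, 1 / √(b (k + m + 1) : ℝ) := tsum_mul_left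
      _ ≤ _ := by
          refine mul_le_mul_of_nonneg_left ?_ (Real.exp_pos _).le
          rw [hC, ← hsq.sum_add_tsum_nat_add (m + 1)]
          exact le_add_of_nonneg_left (Finset.sum_nonneg fun _ _ => by positivity)
  rintro ⟨r, hr⟩
  have hq : (0 : ℝ) < r.den := by exact_mod_cast r.den_pos
  -- Clearing denominators in the tail leaves a positive integer.
  have hlower : ∀ n, 1 ≤ r.den * ((∏ j ∈ Finset.range (n + 1), (b j : ℝ)) * ∑' k, f (k + n)) := by
    intro n
    obtain ⟨z, hz⟩ := exists_int_prod_mul_sum_one_div_mul_succ b hb n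
    have hsplit := hfs.sum_add_tsum_nat_add n
    have hrq : (r.den : ℝ) * r = r.num := by exact_mod_cast Rat.den_mul_eq_num r
    have heq : r.den * ((∏ j ∈ Finset.range (n + 1), (b j : ℝ)) * ∑' k, f (k + n)) =
        (((∏ j ∈ Finset.range (n + 1), (b j : ℤ)) * r.num - r.den * z : ℤ) : ℝ) := by
      push_cast
      rw [← hz, ← hrq, hr, ← hsplit]
      ring
    have hgt : 0 < r.den * ((∏ j ∈ Finset.range (n + 1), (b j : ℝ)) * ∑' k, f (k + n)) :=
      mul_pos hq (mul_pos (Finset.prod_pos fun j _ => hpos j)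
        (((summable_nat_add_iff n).2 hfs).tsum_pos (fun k => (hfpos _).le) 0 (hfpos _)))
    rw [heq] at hgt ⊢
    exact_mod_cast hgt
  have hlog : Tendsto (fun n => Real.log (b n)) atTop atTop :=
    tendsto_atTop_mono' _ h
      ((tendsto_pow_atTop_atTop_of_one_lt one_lt_two).const_mul_atTop hδ)
  have hu : Tendsto (fun n => Real.log (b n) / (7 / 4) ^ n) atTop atTop := by
    refine tendsto_atTop_mono' _ ?_
      ((tendsto_pow_atTop_atTop_of_one_lt (r := (8 / 7 : ℝ)) (by norm_num)).const_mul_atTop hδ)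
    filter_upwards [h] with n hn
    rw [le_div_iff₀ (by positivity), mul_assoc, ← mul_pow]
    norm_num
    exact hn
  have hsmall : Tendsto (fun n => r.den * (Real.exp (-(5 / 21) * Real.log (b n)) +
      Real.exp (-(1 / 6) * Real.log (b n)) * C)) atTop (𝓝 0) := by
    have hexp : ∀ s : ℝ, s < 0 → Tendsto (fun n => Real.exp (s * Real.log (b n))) atTop (𝓝 0) :=
      fun s hs => Real.tendsto_exp_atBot.comp (hlog.const_mul_atTop_of_neg hs)
    simpa using ((hexp (-(5 / 21)) (by norm_num)).add
      ((hexp (-(1 / 6)) (by norm_num)).mul_const C)).const_mul (r.den : ℝ)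
  obtain ⟨m, hrec, hm1, hm2⟩ := ((frequently_high_scores hu).and_eventually
    ((hsmall.eventually_lt_const one_pos).and (eventually_ge_atTop 1))).exists
  obtain ⟨n, rfl⟩ : ∃ n, m = n + 1 := ⟨m - 1, by omega⟩
  set L := Real.log (b (n + 1)) with hL
  have hL0 : 0 ≤ L := Real.log_nonneg (by exact_mod_cast hb (n + 1))
  have hbound : ∀ j < n + 1, Real.log (b j) ≤ L / (7 / 4) ^ (n + 1) * (7 / 4) ^ j := by
    intro j hj
    rw [← div_le_iff₀ (by positivity)]
    exact (hrec j hj).le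
  have hT : 0 ≤ L / (7 / 4 : ℝ) ^ (n + 1) := by positivity
  have hP1 : ∏ j ∈ Finset.range (n + 1), (b j : ℝ) ≤ Real.exp (4 / 3 * L) := by
    refine (prod_range_le_exp_of_log_le b hb hT (n + 1) hbound).trans_eq ?_
    congr 1
    field_simp
  have hP2 : ∏ j ∈ Finset.range n, (b j : ℝ) ≤ Real.exp (16 / 21 * L) := by
    refine (prod_range_le_exp_of_log_le b hb hT n fun j hj => hbound j (by omega)).trans_eq ?_
    congr 1
    rw [pow_succ]
    field_simp
    ring
  have hfirst : (∏ j ∈ Finset.range (n + 1), (b j : ℝ)) * f n ≤ Real.exp (-(5 / 21) * L) := by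
    have : (∏ j ∈ Finset.range (n + 1), (b j : ℝ)) * f n =
        (∏ j ∈ Finset.range n, (b j : ℝ)) * Real.exp (-L) := by
      have := hpos n
      have := hpos (n + 1)
      rw [Finset.prod_range_succ, hL, Real.exp_neg, Real.exp_log (hpos _), hf]
      field_simp
    rw [this]
    refine (mul_le_mul_of_nonneg_right hP2 (Real.exp_pos _).le).trans_eq ?_
    rw [← Real.exp_add]
    ring_nf
  have hrest : (∏ j ∈ Finset.range (n + 1), (b j : ℝ)) * ∑' k, f (k + (n + 1)) ≤
      Real.exp (-(1 / 6) * L) * C := by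
    refine (mul_le_mul hP1 (htail (n + 1)) (tsum_nonneg fun k => (hfpos _).le)
      (Real.exp_pos _).le).trans_eq ?_
    rw [← mul_assoc, ← Real.exp_add, ← hL]
    ring_nf
  have hsplit : ∑' k, f (k + n) = f n + ∑' k, f (k + (n + 1)) := by
    rw [((summable_nat_add_iff n).2 hfs).tsum_eq_zero_add]
    simp only [zero_add, add_assoc, add_comm 1 n]
  have hge := hlower n
  rw [hsplit, mul_add] at hge
  exact absurd (hge.trans (mul_le_mul_of_nonneg_left (add_le_add hfirst hrest) hq.le)) hm1.not_ge

/-- **answer to the Erdős–Graham question.** If `a₁ < a₂ < ⋯` is a strictly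
increasing sequence of positive integers with `liminf_n a_n^(1/2^n) > 1`, then
`∑_{n≥1} 1/(a_n a_{n+1})` is irrational. (The `liminf` is taken in `EReal` so that the
hypothesis also covers sequences for which the quantity is unbounded.) -/
theorem stmt_4 (a : ℕ → ℕ) (ha_pos : ∀ n, 1 ≤ n → 0 < a n)
    (ha : ∀ n, 1 ≤ n → a n < a (n + 1))
    (hliminf : 1 < liminf (fun n : ℕ => (((a n : ℝ) ^ (1 / (2 : ℝ) ^ n) : ℝ) : EReal)) atTop) :
    Irrational (∑' n : ℕ, 1 / ((a (n + 1) : ℝ) * (a (n + 2) : ℝ))) := by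
  obtain ⟨c, hc1, hc⟩ := EReal.lt_iff_exists_real_btwn.1 hliminf
  have hc1 : 1 < c := by exact_mod_cast hc1
  have hδ := Real.log_pos hc1
  refine irrational_tsum_one_div_mul_succ (fun n => a (n + 1)) (fun n => ha_pos _ (by omega))
    (monotone_nat_of_le_succ fun n => (ha _ (by omega)).le) hδ ?_
  filter_upwards [(tendsto_add_atTop_nat 1).eventually (eventually_lt_of_lt_liminf hc)] with n hn
  have hn : c < (a (n + 1) : ℝ) ^ (1 / (2 : ℝ) ^ (n + 1)) := by exact_mod_cast hn
  have hpos : (0 : ℝ) < a (n + 1) := by exact_mod_cast ha_pos (n + 1) (by omega)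
  have hlog := Real.log_lt_log (by linarith) hn
  rw [Real.log_rpow hpos, one_div_mul_eq_div, lt_div_iff₀ (by positivity), pow_succ] at hlog
  have : 0 < Real.log c * 2 ^ n := by positivity
  linarith
end

section
/- Let d ≥ 2 be an integer and let ψ > 0 satisfy ψ^d = ψ^{d-1} + 1. If {a_n}_{n=1}^∞ is a strictly increasing sequence of positive integers satisfying limsup_{n→∞} a_n^{1/ψ^n} = ∞, then the sum ∑_{n=1}^∞ 1/(a_n · a_{n+1} · ⋯ · a_{n+d-1}) is irrational. -/
open Filter Topology

/-- There is a constant `K` with `(k + 1) ^ 2 ≤ K * ψ ^ k` for all `k`, if `1 < ψ`. -/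
lemma exists_succ_sq_le_mul_pow {ψ : ℝ} (hψ : 1 < ψ) :
    ∃ K : ℝ, 0 ≤ K ∧ ∀ k : ℕ, ((k : ℝ) + 1) ^ 2 ≤ K * ψ ^ k := by
  obtain ⟨K, hK⟩ := (tendsto_pow_const_div_const_pow_of_one_lt 2 hψ).bddAbove_range
  have hK' : ∀ k : ℕ, (k : ℝ) ^ 2 ≤ K * ψ ^ k := fun k => by
    have h := hK ⟨k, rfl⟩
    exact (div_le_iff₀ (by positivity)).1 h
  have hK0 : 0 ≤ K := by simpa using hK' 0
  refine ⟨K * ψ, by positivity, fun k => ?_⟩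
  have h := hK' (k + 1)
  push_cast at h
  rw [pow_succ ψ] at h
  linarith

/-- A monotone nonnegative sequence whose terms are controlled by its partial sums, in the weak
form `hcrude` and, whenever a later term is twice as large, in the sharper form `hsharp`, grows at
most like `ψ ^ n`, where `ψ ^ (e + 1) = ψ ^ e + 1`. -/
lemma exists_le_mul_pow_of_le_sum {x : ℕ → ℝ} (hmono : Monotone x) (hnonneg : ∀ n, 0 ≤ x n)
    {ψ : ℝ} (hψ : 1 < ψ) {e : ℕ} (he : 1 ≤ e) (hψe : ψ ^ (e + 1) = ψ ^ e + 1)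
    {C : ℝ} (hC : 0 ≤ C)
    (hcrude : ∀ N, x (N + e) ≤ C + ∑ i ∈ Finset.range (N + 1), x i)
    (hsharp : ∀ N J, N ≤ J → 2 * x (N + e) ≤ x J →
      x (N + e) ≤ C + ∑ i ∈ Finset.range N, x i + Real.log (J + 1)) :
    ∃ K : ℝ, ∀ n, x n ≤ K * ψ ^ n := by
  set S : ℕ → ℝ := fun n => ∑ i ∈ Finset.range n, x i with hS
  have hSsucc : ∀ n, S (n + 1) = S n + x n := fun n => Finset.sum_range_succ _ _
  have hSmono : Monotone S := monotone_nat_of_le_succ fun n => by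
    linarith [hSsucc n, hnonneg n]
  have hS0 : ∀ n, 0 ≤ S n := fun n => Finset.sum_nonneg fun i _ => hnonneg i
  have hcrude' : ∀ m, e ≤ m → x m ≤ C + S m := fun m hm => by
    obtain ⟨N, rfl⟩ := Nat.exists_eq_add_of_le' hm
    exact (hcrude N).trans (by linarith [hSmono (show N + 1 ≤ N + e by omega)])
  -- a priori bound on the partial sums
  set D : ℝ := S e + C with hD
  have hD0 : 0 ≤ D := add_nonneg (hS0 e) hC
  have hSD : ∀ m, S m + C ≤ D * 2 ^ m := by
    intro m
    induction m with
    | zero => simpa using by linarith [hSmono (Nat.zero_le e)]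
    | succ m ih =>
      by_cases hm : e ≤ m
      · rw [hSsucc, pow_succ]
        linarith [hcrude' m hm]
      · have h1 : S (m + 1) ≤ S e := hSmono (by omega)
        have h2 : (1 : ℝ) ≤ 2 ^ (m + 1) := one_le_pow₀ (by norm_num)
        nlinarith
  have hxD : ∀ m, x m ≤ 2 * D * 2 ^ m := fun m => by
    have h := hSD (m + 1)
    rw [hSsucc, pow_succ] at h
    linarith [hS0 m]
  set C' : ℝ := C + Real.log (4 * D + 3) with hC'
  have hC'0 : 0 ≤ C' := add_nonneg hC (Real.log_nonneg (by linarith))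
  -- the sharp recursion on a stretch where `j < x j`
  have hrec : ∀ k n m, e ≤ m → k < m → (∀ j, k < j → j ≤ n → (j : ℝ) < x j) → m ≤ n →
      2 * x m ≤ x n → x m ≤ C' + m + S (m - e) := by
    intro k n m hem hkm hgood hmn h2
    classical
    have hex : ∃ J, m ≤ J ∧ 2 * x m ≤ x J := ⟨n, hmn, h2⟩
    obtain ⟨hJm, hJx⟩ := Nat.find_spec hex
    have hJn : Nat.find hex ≤ n := Nat.find_min' hex ⟨hmn, h2⟩
    have hmin := fun {j} (hj : j < Nat.find hex) => Nat.find_min hex hj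
    set J := Nat.find hex
    have hJ : (J : ℝ) ≤ m + 1 + 2 * x m := by
      rcases hJm.eq_or_lt with h | h
      · rw [← h]; linarith [hnonneg m]
      · obtain ⟨i, hi⟩ := Nat.exists_eq_add_of_lt h
        have h3 := hmin (show m + i < J by omega)
        have h4 : x (m + i) < 2 * x m := by
          by_contra hcon
          exact h3 ⟨by omega, not_lt.1 hcon⟩
        have h5 := hgood (m + i) (by omega) (by omega)
        rw [hi]
        push_cast at h5 ⊢
        linarith [(Nat.cast_nonneg m : (0 : ℝ) ≤ m)]
    have hm2 : (m : ℝ) + 1 ≤ 2 ^ m := by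
      exact_mod_cast Nat.succ_le_of_lt (Nat.lt_two_pow_self (n := m))
    have hJ2 : (J : ℝ) + 1 ≤ (4 * D + 3) * 2 ^ m := by
      have : (1 : ℝ) ≤ 2 ^ m := one_le_pow₀ (by norm_num)
      linarith [hxD m]
    have hlog : Real.log (J + 1) ≤ Real.log (4 * D + 3) + m := by
      calc Real.log (J + 1) ≤ Real.log ((4 * D + 3) * 2 ^ m) :=
            Real.log_le_log (by positivity) hJ2
        _ = Real.log (4 * D + 3) + m * Real.log 2 := by
            rw [Real.log_mul (by positivity) (by positivity), Real.log_pow]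
        _ ≤ _ := by
            have := Real.log_two_lt_d9
            have : (m : ℝ) * Real.log 2 ≤ m * 1 := by gcongr; linarith
            linarith
    have h := hsharp (m - e) J (by omega)
    rw [Nat.sub_add_cancel hem] at h
    linarith [h hJx]
  -- every index lies on such a stretch starting from a small partial sum
  have hstart : ∀ n, e ≤ n → ∃ k, e ≤ k ∧ k ≤ n ∧
      (∀ j, k < j → j ≤ n → (j : ℝ) < x j) ∧ S (k + 1) ≤ S (e + 1) + (k + 1) * k := by
    intro n hn
    induction n, hn using Nat.le_induction with
    | base => exact ⟨e, le_rfl, le_rfl, fun j h1 h2 => by omega, by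
        have : (0 : ℝ) ≤ (e + 1) * e := by positivity
        linarith⟩
    | succ n hn ih =>
      by_cases hb : ((n + 1 : ℕ) : ℝ) < x (n + 1)
      · obtain ⟨k, h1, h2, h3, h4⟩ := ih
        refine ⟨k, h1, by omega, fun j hj hj' => ?_, h4⟩
        rcases Nat.le_succ_iff.1 hj' with h | h
        · exact h3 j hj h
        · rw [h]; exact hb
      · refine ⟨n + 1, by omega, le_rfl, fun j h1 h2 => by omega, ?_⟩
        have h : S (n + 1 + 1) ≤ (n + 1 + 1 : ℕ) • ((n + 1 : ℕ) : ℝ) := by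
          have := Finset.sum_le_card_nsmul (Finset.range (n + 1 + 1)) x ((n + 1 : ℕ) : ℝ)
            fun i hi => (hmono (Nat.lt_succ_iff.1 (Finset.mem_range.1 hi))).trans (not_lt.1 hb)
          simpa using this
        rw [nsmul_eq_mul] at h
        push_cast at h ⊢
        linarith [hS0 (e + 1)]
  set B : ℝ := C' + 1 + e with hB
  have hB0 : 0 ≤ B := by positivity
  obtain ⟨K₀, hK₀, hsq⟩ := exists_succ_sq_le_mul_pow hψ
  set K₁ : ℝ := S (e + 1) + B + K₀ with hK₁
  have hψ0 : 0 < ψ := by linarith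
  have hK₁0 : 0 ≤ K₁ := by linarith [hS0 (e + 1)]
  set K : ℝ := K₁ * ψ ^ e with hK
  have hK0 : 0 ≤ K := by positivity
  have hpow1 : ∀ n : ℕ, 1 ≤ ψ ^ n := fun n => one_le_pow₀ hψ.le
  have hmain : ∀ n, e ≤ n → x n ≤ 2 * (K + C) * ψ ^ n := by
    intro n hn
    obtain ⟨k, hek, hkn, hgood, hSk⟩ := hstart n hn
    have hUk : S (k + 1) + (k + 1) + B ≤ K₁ * ψ ^ k := by
      have h1 := hsq k
      have h2 : (S (e + 1) + B) * 1 ≤ (S (e + 1) + B) * ψ ^ k :=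
        mul_le_mul_of_nonneg_left (hpow1 k) (add_nonneg (hS0 _) hB0)
      rw [hK₁]
      nlinarith
    have hU : ∀ i, k ≤ i + e → i ≤ n + 1 → (∀ j, k < j → j < i → 2 * x j ≤ x n) →
        S i + i + B ≤ K * ψ ^ i := by
      intro i
      induction i using Nat.strong_induction_on with
      | _ i ih =>
        intro hki hin hsmall
        by_cases hik : i ≤ k + 1
        · have h1 : S i ≤ S (k + 1) := hSmono hik
          have h2 : (i : ℝ) ≤ k + 1 := by exact_mod_cast hik
          have h3 : K₁ * ψ ^ k ≤ K₁ * ψ ^ (i + e) := by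
            gcongr
            exact hψ.le
          rw [pow_add] at h3
          rw [hK]
          linarith
        · obtain ⟨m, rfl⟩ : ∃ m, i = m + 1 := ⟨i - 1, by omega⟩
          obtain ⟨N, rfl⟩ : ∃ N, m = N + e := ⟨m - e, by omega⟩
          have h1 := ih (N + e) (by omega) (by omega) (by omega)
            fun j h h' => hsmall j h (by omega)
          have h2 := ih N (by omega) (by omega) (by omega)
            fun j h h' => hsmall j h (by omega)
          have h3 := hrec k n (N + e) (by omega) (by omega) hgood (by omega)
            (hsmall _ (by omega) (by omega))
          rw [Nat.add_sub_cancel] at h3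
          have h4 : K * ψ ^ (N + e + 1) = K * ψ ^ (N + e) + K * ψ ^ N := by
            rw [add_assoc, pow_add, hψe, pow_add]; ring
          rw [hSsucc, h4]
          push_cast at h1 h3 ⊢
          linarith
    classical
    rcases hkn.eq_or_lt with rfl | hlt
    · have h := hU k (by omega) (by omega) fun j h h' => by omega
      have h1 := hcrude' k hek
      have h2 : C * 1 ≤ C * ψ ^ k := mul_le_mul_of_nonneg_left (hpow1 k) hC
      have h3 : 0 ≤ K * ψ ^ k := by positivity
      have h4 : (0 : ℝ) ≤ k := Nat.cast_nonneg k
      linarith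
    · have hex : ∃ m, k < m ∧ x n ≤ 2 * x m := ⟨n, hlt, by linarith [hnonneg n]⟩
      obtain ⟨hkm, hxm⟩ := Nat.find_spec hex
      have hmn : Nat.find hex ≤ n := Nat.find_min' hex ⟨hlt, by linarith [hnonneg n]⟩
      have hmin := fun {j} (hj : j < Nat.find hex) => Nat.find_min hex hj
      set m := Nat.find hex
      have h := hU m (by omega) (by omega) fun j h h' => by
        by_contra hcon
        exact hmin h' ⟨h, (not_le.1 hcon).le⟩
      have h1 := hcrude' m (by omega)
      have h2 : C * 1 ≤ C * ψ ^ m := mul_le_mul_of_nonneg_left (hpow1 m) hC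
      have h4 : (0 : ℝ) ≤ m := Nat.cast_nonneg m
      have h5 : (K + C) * ψ ^ m ≤ (K + C) * ψ ^ n := by
        gcongr
        exact hψ.le
      linarith
  refine ⟨2 * (K + C) + x e, fun n => ?_⟩
  have hx : x e * 1 ≤ x e * ψ ^ n := mul_le_mul_of_nonneg_left (hpow1 n) (hnonneg e)
  have h0 : 0 ≤ 2 * (K + C) * ψ ^ n := by positivity
  rcases le_total e n with h | h
  · linarith [hmain n h, hnonneg e]
  · linarith [hmono h]

/-- The reciprocals of products of `e + 1` consecutive terms of a strictly increasing sequence of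
positive integers are bounded by a telescoping difference. -/
lemma one_div_prod_succ_le_sub {c : ℕ → ℕ} (hpos : ∀ n, 0 < c n) (hc : StrictMono c) {e : ℕ}
    (he : 1 ≤ e) (n : ℕ) :
    1 / ∏ i ∈ Finset.range (e + 1), (c (n + i) : ℝ) ≤
      1 / ∏ i ∈ Finset.range e, (c (n + i) : ℝ) -
        1 / ∏ i ∈ Finset.range e, (c (n + 1 + i) : ℝ) := by
  have hpos' : ∀ n, (0 : ℝ) < c n := fun n => by exact_mod_cast hpos n
  set Q : ℕ → ℝ := fun n => ∏ i ∈ Finset.range e, (c (n + i) : ℝ) with hQ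
  have hQpos : ∀ n, 0 < Q n := fun n => Finset.prod_pos fun i _ => hpos' _
  have h1 : ∏ i ∈ Finset.range (e + 1), (c (n + i) : ℝ) = Q n * c (n + e) :=
    Finset.prod_range_succ _ _
  have h2 : ∏ i ∈ Finset.range (e + 1), (c (n + i) : ℝ) = Q (n + 1) * c n := by
    rw [Finset.prod_range_succ']
    simp only [hQ, add_zero, add_assoc, add_comm 1]
  have h3 : (c n : ℝ) + 1 ≤ c (n + e) := by
    exact_mod_cast Nat.succ_le_of_lt (hc (show n < n + e by omega))
  change _ ≤ 1 / Q n - 1 / Q (n + 1)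
  have h4 : 1 / Q n = c (n + e) / (Q n * c (n + e)) := by
    have := (hpos' (n + e)).ne'
    have := (hQpos n).ne'
    field_simp
  have h5 : 1 / Q (n + 1) = c n / (Q n * c (n + e)) := by
    rw [← h1, h2]
    have := (hpos' n).ne'
    have := (hQpos (n + 1)).ne'
    field_simp
  rw [h1, h4, h5, ← sub_div]
  have := hQpos n
  have := hpos' (n + e)
  gcongr
  linarith

/-- Partial sums of the series are bounded by the reciprocal of the first `e` factors. -/
lemma sum_one_div_prod_le {c : ℕ → ℕ} (hpos : ∀ n, 0 < c n) (hc : StrictMono c) {e : ℕ}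
    (he : 1 ≤ e) (N M : ℕ) :
    ∑ n ∈ Finset.range M, 1 / ∏ i ∈ Finset.range (e + 1), (c (N + n + i) : ℝ) ≤
      1 / ∏ i ∈ Finset.range e, (c (N + i) : ℝ) := by
  have h : ∑ n ∈ Finset.range M, 1 / ∏ i ∈ Finset.range (e + 1), (c (N + n + i) : ℝ) ≤
      1 / ∏ i ∈ Finset.range e, (c (N + i) : ℝ) -
        1 / ∏ i ∈ Finset.range e, (c (N + M + i) : ℝ) := by
    induction M with
    | zero => simp
    | succ M ih =>
      rw [Finset.sum_range_succ]
      have := one_div_prod_succ_le_sub hpos hc he (N + M)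
      rw [← add_assoc N M 1]
      linarith
  exact h.trans (sub_le_self _ (by positivity))

lemma summable_one_div_prod {c : ℕ → ℕ} (hpos : ∀ n, 0 < c n) (hc : StrictMono c) {e : ℕ}
    (he : 1 ≤ e) (N : ℕ) :
    Summable fun n => 1 / ∏ i ∈ Finset.range (e + 1), (c (N + n + i) : ℝ) :=
  summable_of_sum_range_le (fun _ => by positivity) (sum_one_div_prod_le hpos hc he N)

lemma tsum_one_div_prod_le {c : ℕ → ℕ} (hpos : ∀ n, 0 < c n) (hc : StrictMono c) {e : ℕ}
    (he : 1 ≤ e) (N : ℕ) :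
    ∑' n, 1 / ∏ i ∈ Finset.range (e + 1), (c (N + n + i) : ℝ) ≤
      1 / ∏ i ∈ Finset.range e, (c (N + i) : ℝ) :=
  Real.tsum_le_of_sum_range_le (fun _ => by positivity) (sum_one_div_prod_le hpos hc he N)

/-- If the sum of the series is rational with denominator `q`, its tails are bounded below in
terms of the product of the terms involved so far. -/
lemma one_le_mul_tsum_of_rat {c : ℕ → ℕ} (hpos : ∀ n, 0 < c n) (hc : StrictMono c) {e : ℕ}
    (he : 1 ≤ e) {r : ℚ}
    (hr : ∑' n, 1 / ∏ i ∈ Finset.range (e + 1), (c (n + i) : ℝ) = r) (N : ℕ) :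
    1 ≤ r.den * (∏ i ∈ Finset.range (N + e), (c i : ℝ)) *
      ∑' n, 1 / ∏ i ∈ Finset.range (e + 1), (c (N + n + i) : ℝ) := by
  have hpos' : ∀ n, (0 : ℝ) < c n := fun n => by exact_mod_cast hpos n
  have hint : ∃ z : ℤ, (r.den : ℝ) * (∏ i ∈ Finset.range (N + e), (c i : ℝ)) *
      ∑' n, 1 / ∏ i ∈ Finset.range (e + 1), (c (N + n + i) : ℝ) = z := by
    induction N with
    | zero =>
      refine ⟨r.num * ∏ i ∈ Finset.range e, (c i : ℤ), ?_⟩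
      have h : (r.den : ℝ) * r = r.num := by exact_mod_cast Rat.den_mul_eq_num r
      simp only [zero_add, hr]
      push_cast
      rw [← h]
      ring
    | succ N ih =>
      obtain ⟨z, hz⟩ := ih
      refine ⟨c (N + e) * z - r.den * ∏ i ∈ Finset.range N, (c i : ℤ), ?_⟩
      rw [(summable_one_div_prod hpos hc he N).tsum_eq_zero_add] at hz
      have h1 : ∏ i ∈ Finset.range (N + e + 1), (c i : ℝ) =
          (∏ i ∈ Finset.range N, (c i : ℝ)) * ∏ i ∈ Finset.range (e + 1), (c (N + i) : ℝ) := by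
        rw [add_assoc, Finset.prod_range_add]
      have h2 := h1
      rw [Finset.prod_range_succ] at h2
      have h3 : ∏ i ∈ Finset.range (e + 1), (c (N + i) : ℝ) ≠ 0 :=
        (Finset.prod_pos fun i _ => hpos' _).ne'
      have h4 : ∑' n, 1 / ∏ i ∈ Finset.range (e + 1), (c (N + (n + 1) + i) : ℝ) =
          ∑' n, 1 / ∏ i ∈ Finset.range (e + 1), (c (N + 1 + n + i) : ℝ) :=
        tsum_congr fun n => by rw [show N + (n + 1) = N + 1 + n by omega]
      rw [h4, add_zero] at hz
      rw [show N + 1 + e = N + e + 1 by omega, Finset.prod_range_succ]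
      push_cast
      rw [← hz]
      set P := ∏ i ∈ Finset.range (e + 1), (c (N + i) : ℝ)
      have h5 : (∏ i ∈ Finset.range (N + e), (c i : ℝ)) * c (N + e) * (1 / P) =
          ∏ i ∈ Finset.range N, (c i : ℝ) := by
        rw [h2]; field_simp
      linear_combination (-(r.den : ℝ)) * h5
  obtain ⟨z, hz⟩ := hint
  have hTpos : 0 < ∑' n, 1 / ∏ i ∈ Finset.range (e + 1), (c (N + n + i) : ℝ) :=
    (summable_one_div_prod hpos hc he N).tsum_pos (fun _ => by positivity) 0
      (one_div_pos.2 (Finset.prod_pos fun i _ => hpos' _))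
  have hzpos : (0 : ℝ) < z := by
    rw [← hz]
    have : (0 : ℝ) < r.den := by exact_mod_cast r.den_pos
    have : 0 < ∏ i ∈ Finset.range (N + e), (c i : ℝ) := Finset.prod_pos fun i _ => hpos' _
    positivity
  rw [hz]
  exact_mod_cast (show 0 < z by exact_mod_cast hzpos)

/-- Rationality forces `c (N + e)` to be bounded by the product of the terms up to `c N`. -/
lemma le_mul_prod_succ_of_rat {c : ℕ → ℕ} (hpos : ∀ n, 0 < c n) (hc : StrictMono c) {e : ℕ}
    (he : 1 ≤ e) {r : ℚ}
    (hr : ∑' n, 1 / ∏ i ∈ Finset.range (e + 1), (c (n + i) : ℝ) = r) (N : ℕ) :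
    (c (N + e) : ℝ) ≤ 2 * r.den * ∏ i ∈ Finset.range (N + 1), (c i : ℝ) := by
  have hpos' : ∀ n, (0 : ℝ) < c n := fun n => by exact_mod_cast hpos n
  have hone : ∀ n, (1 : ℝ) ≤ c n := fun n => by exact_mod_cast hpos n
  have h := one_le_mul_tsum_of_rat hpos hc he hr N
  rw [(summable_one_div_prod hpos hc he N).tsum_eq_zero_add] at h
  have h4 : ∑' n, 1 / ∏ i ∈ Finset.range (e + 1), (c (N + (n + 1) + i) : ℝ) =
      ∑' n, 1 / ∏ i ∈ Finset.range (e + 1), (c (N + 1 + n + i) : ℝ) :=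
    tsum_congr fun n => by rw [show N + (n + 1) = N + 1 + n by omega]
  rw [h4, add_zero] at h
  have hT := tsum_one_div_prod_le hpos hc he (N + 1)
  set T := ∑' n, 1 / ∏ i ∈ Finset.range (e + 1), (c (N + 1 + n + i) : ℝ)
  have h1 : ∏ i ∈ Finset.range (e + 1), (c (N + i) : ℝ) =
      (∏ i ∈ Finset.range e, (c (N + i) : ℝ)) * c (N + e) := Finset.prod_range_succ _ _
  have h2 : ∏ i ∈ Finset.range (e + 1), (c (N + i) : ℝ) =
      (∏ i ∈ Finset.range e, (c (N + 1 + i) : ℝ)) * c N := by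
    rw [Finset.prod_range_succ']
    simp only [add_zero, add_assoc, add_comm 1]
  have hQ : 0 < ∏ i ∈ Finset.range e, (c (N + i) : ℝ) := Finset.prod_pos fun i _ => hpos' _
  have hQ' : 0 < ∏ i ∈ Finset.range e, (c (N + 1 + i) : ℝ) :=
    Finset.prod_pos fun i _ => hpos' _
  have hA : 0 < ∏ i ∈ Finset.range N, (c i : ℝ) := Finset.prod_pos fun i _ => hpos' _
  rw [Finset.prod_range_add, h1] at h
  rw [h1] at h2
  rw [Finset.prod_range_succ]
  set Q := ∏ i ∈ Finset.range e, (c (N + i) : ℝ)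
  set Q' := ∏ i ∈ Finset.range e, (c (N + 1 + i) : ℝ)
  set A := ∏ i ∈ Finset.range N, (c i : ℝ)
  have hq : (0 : ℝ) < r.den := by exact_mod_cast r.den_pos
  have h5 : 1 / Q' = c N / (Q * c (N + e)) := by
    rw [h2]
    have := (hpos' N).ne'
    field_simp
  have h6 : 1 ≤ r.den * (A * Q) * (1 / (Q * c (N + e)) + c N / (Q * c (N + e))) :=
    h.trans (by rw [← h5]; gcongr)
  have h7 : r.den * (A * Q) * (1 / (Q * c (N + e)) + c N / (Q * c (N + e))) =
      r.den * A * (1 + c N) / c (N + e) := by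
    have := (hpos' (N + e)).ne'
    field_simp
  rw [h7, le_div_iff₀ (hpos' _), one_mul] at h6
  refine h6.trans ?_
  have h8 : r.den * A * (1 + c N) ≤ r.den * A * (2 * c N) := by
    gcongr
    linarith [hone N]
  linarith

/-- If `c J` exceeds the square of `c (N + e)`, rationality forces `c (N + e)` to be bounded, up
to a factor `J + 1`, by the product of the terms before `c N`. -/
lemma le_mul_prod_mul_of_rat {c : ℕ → ℕ} (hpos : ∀ n, 0 < c n) (hc : StrictMono c) {e : ℕ}
    (he : 1 ≤ e) {r : ℚ}
    (hr : ∑' n, 1 / ∏ i ∈ Finset.range (e + 1), (c (n + i) : ℝ) = r) {N J : ℕ} (hNJ : N ≤ J)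
    (hJ : (c (N + e) : ℝ) ^ 2 ≤ c J) :
    (c (N + e) : ℝ) ≤ r.den * (∏ i ∈ Finset.range N, (c i : ℝ)) * (J + 1) := by
  have hpos' : ∀ n, (0 : ℝ) < c n := fun n => by exact_mod_cast hpos n
  have hone : ∀ n, (1 : ℝ) ≤ c n := fun n => by exact_mod_cast hpos n
  have hmono : ∀ {i j}, i ≤ j → (c i : ℝ) ≤ c j := fun h => by exact_mod_cast hc.monotone h
  have h := one_le_mul_tsum_of_rat hpos hc he hr N
  obtain ⟨L, rfl⟩ := Nat.exists_eq_add_of_le hNJ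
  rw [← (summable_one_div_prod hpos hc he N).sum_add_tsum_nat_add L] at h
  have h4 : ∀ n i, N + (n + L) + i = N + L + n + i := by intros; omega
  simp only [h4] at h
  have hT := tsum_one_div_prod_le hpos hc he (N + L)
  set T := ∑' n, 1 / ∏ i ∈ Finset.range (e + 1), (c (N + L + n + i) : ℝ)
  have hQ : 0 < ∏ i ∈ Finset.range e, (c (N + i) : ℝ) := Finset.prod_pos fun i _ => hpos' _
  have hA : 0 < ∏ i ∈ Finset.range N, (c i : ℝ) := Finset.prod_pos fun i _ => hpos' _
  have hP : ∏ i ∈ Finset.range (e + 1), (c (N + i) : ℝ) =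
      (∏ i ∈ Finset.range e, (c (N + i) : ℝ)) * c (N + e) := Finset.prod_range_succ _ _
  have hsum : ∑ n ∈ Finset.range L, 1 / ∏ i ∈ Finset.range (e + 1), (c (N + n + i) : ℝ) ≤
      L * (1 / ((∏ i ∈ Finset.range e, (c (N + i) : ℝ)) * c (N + e))) := by
    rw [← hP]
    have := Finset.sum_le_card_nsmul (Finset.range L)
      (fun n => 1 / ∏ i ∈ Finset.range (e + 1), (c (N + n + i) : ℝ))
      (1 / ∏ i ∈ Finset.range (e + 1), (c (N + i) : ℝ)) fun n _ => by
        refine one_div_le_one_div_of_le (Finset.prod_pos fun i _ => hpos' _) ?_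
        exact Finset.prod_le_prod (fun i _ => (hpos' _).le) fun i _ => hmono (by omega)
    simpa using this
  have hQL : (∏ i ∈ Finset.range e, (c (N + i) : ℝ)) * c (N + e) ≤
      ∏ i ∈ Finset.range e, (c (N + L + i) : ℝ) := by
    calc (∏ i ∈ Finset.range e, (c (N + i) : ℝ)) * c (N + e)
        ≤ (∏ i ∈ Finset.range e, (c (N + i) : ℝ)) * (c (N + e) : ℝ) ^ e := by
          gcongr
          exact le_self_pow₀ (hone _) (by omega)
      _ = ∏ i ∈ Finset.range e, ((c (N + i) : ℝ) * c (N + e)) := by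
          rw [Finset.prod_mul_distrib, Finset.prod_const, Finset.card_range]
      _ ≤ _ := by
          refine Finset.prod_le_prod (fun i _ => by positivity) fun i hi => ?_
          have h1 : (c (N + i) : ℝ) ≤ c (N + e) := hmono (by have := Finset.mem_range.1 hi; omega)
          have h2 : (c (N + L) : ℝ) ≤ c (N + L + i) := hmono (by omega)
          nlinarith [hpos' (N + e)]
  have hcN := hpos' (N + e)
  rw [Finset.prod_range_add] at h
  set Q := ∏ i ∈ Finset.range e, (c (N + i) : ℝ)
  set A := ∏ i ∈ Finset.range N, (c i : ℝ)
  have hT' : T ≤ 1 / (Q * c (N + e)) :=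
    hT.trans (one_div_le_one_div_of_le (by positivity) hQL)
  have hq : (0 : ℝ) < r.den := by exact_mod_cast r.den_pos
  have h6 : 1 ≤ r.den * (A * Q) * (L * (1 / (Q * c (N + e))) + 1 / (Q * c (N + e))) :=
    h.trans (by gcongr)
  have h7 : r.den * (A * Q) * (L * (1 / (Q * c (N + e))) + 1 / (Q * c (N + e))) =
      r.den * A * (L + 1) / c (N + e) := by
    field_simp
  rw [h7, le_div_iff₀ hcN, one_mul] at h6
  refine h6.trans ?_
  gcongr
  omega

/-- If the sum of the series is rational, then `log (c n)` grows at most like `ψ ^ n`. -/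
lemma exists_log_le_mul_pow_of_rat {c : ℕ → ℕ} (hpos : ∀ n, 0 < c n) (hc : StrictMono c) {e : ℕ}
    (he : 1 ≤ e) {ψ : ℝ} (hψ : 1 < ψ) (hψe : ψ ^ (e + 1) = ψ ^ e + 1) {r : ℚ}
    (hr : ∑' n, 1 / ∏ i ∈ Finset.range (e + 1), (c (n + i) : ℝ) = r) :
    ∃ K : ℝ, ∀ n, Real.log (c n) ≤ K * ψ ^ n := by
  have hpos' : ∀ n, (0 : ℝ) < c n := fun n => by exact_mod_cast hpos n
  have hone : ∀ n, (1 : ℝ) ≤ c n := fun n => by exact_mod_cast hpos n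
  have hq : (1 : ℝ) ≤ r.den := by exact_mod_cast r.den_pos
  have hq0 : (0 : ℝ) < r.den := by linarith
  have hlogA : ∀ N, Real.log (∏ i ∈ Finset.range N, (c i : ℝ)) =
      ∑ i ∈ Finset.range N, Real.log (c i) := fun N => Real.log_prod fun i _ => (hpos' i).ne'
  have hA : ∀ N, 0 < ∏ i ∈ Finset.range N, (c i : ℝ) := fun N => Finset.prod_pos fun i _ => hpos' i
  refine exists_le_mul_pow_of_le_sum (x := fun n => Real.log (c n)) (C := Real.log (2 * r.den))
    (fun i j hij => Real.log_le_log (hpos' i) (by exact_mod_cast hc.monotone hij))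
    (fun n => Real.log_nonneg (hone n)) hψ he hψe (Real.log_nonneg (by linarith))
    (fun N => ?_) fun N J hNJ hJ => ?_
  · rw [← hlogA, ← Real.log_mul (by positivity) (hA _).ne']
    exact Real.log_le_log (hpos' _) (le_mul_prod_succ_of_rat hpos hc he hr N)
  · have hJ' : (c (N + e) : ℝ) ^ 2 ≤ c J := by
      rw [← Real.log_le_log_iff (pow_pos (hpos' _) 2) (hpos' _), Real.log_pow]
      exact_mod_cast hJ
    rw [← hlogA, ← Real.log_mul (by positivity) (hA _).ne',
      ← Real.log_mul (mul_pos (by positivity) (hA _)).ne' (by positivity)]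
    refine Real.log_le_log (hpos' _) ((le_mul_prod_mul_of_rat hpos hc he hr hNJ hJ').trans ?_)
    have := hA N
    gcongr
    linarith

/-- Let `d ≥ 2` and let `ψ > 0` satisfy `ψ^d = ψ^(d-1) + 1`. If `a` is a
strictly increasing sequence of positive integers with `limsup_n a_n^(1/ψ^n) = ∞` (limsup
taken in `EReal`), then `∑_{n≥1} 1/(a_n a_{n+1} ⋯ a_{n+d-1})` is irrational. -/
theorem stmt_5 (d : ℕ) (hd : 2 ≤ d) (ψ : ℝ) (hψ : 0 < ψ)
    (hψeq : ψ ^ d = ψ ^ (d - 1) + 1)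
    (a : ℕ → ℕ) (ha_pos : ∀ n, 1 ≤ n → 0 < a n)
    (ha : ∀ n, 1 ≤ n → a n < a (n + 1))
    (hlimsup : limsup (fun n : ℕ => (((a n : ℝ) ^ (1 / ψ ^ n) : ℝ) : EReal)) atTop = ⊤) :
    Irrational (∑' n : ℕ, 1 / ∏ i ∈ Finset.range d, (a (n + 1 + i) : ℝ)) := by
  obtain ⟨e, rfl⟩ : ∃ e, d = e + 1 := ⟨d - 1, by omega⟩
  rw [Nat.add_sub_cancel] at hψeq
  have hψ1 : 1 < ψ := by
    by_contra hcon
    have h : ψ ^ e * ψ ≤ ψ ^ e * 1 := by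
      gcongr
      exact not_lt.1 hcon
    rw [pow_succ] at hψeq
    linarith
  rintro ⟨r, hr⟩
  obtain ⟨K, hK⟩ := exists_log_le_mul_pow_of_rat (c := fun n => a (n + 1))
    (fun n => ha_pos _ (by omega)) (strictMono_nat_of_lt_succ fun n => ha _ (by omega))
    (show 1 ≤ e by omega) hψ1 hψeq (r := r) (by
      rw [hr]
      simp only [add_right_comm])
  have hbound : limsup (fun n : ℕ => (((a n : ℝ) ^ (1 / ψ ^ n) : ℝ) : EReal)) atTop ≤
      ((Real.exp K : ℝ) : EReal) := by
    refine limsup_le_of_le (by isBoundedDefault) ?_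
    filter_upwards [eventually_ge_atTop 1] with n hn
    obtain ⟨m, rfl⟩ := Nat.exists_eq_add_of_le' hn
    have hpos : (0 : ℝ) < a (m + 1) := by exact_mod_cast ha_pos _ hn
    have hlog : 0 ≤ Real.log (a (m + 1)) := Real.log_natCast_nonneg _
    rw [EReal.coe_le_coe_iff, Real.rpow_def_of_pos hpos, Real.exp_le_exp, mul_one_div,
      div_le_iff₀ (by positivity)]
    have h := hK m
    have hK0 : 0 ≤ K := nonneg_of_mul_nonneg_left (hlog.trans h) (by positivity)
    refine h.trans ?_
    gcongr
    · exact hψ1.le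
    · omega
  rw [hlimsup, top_le_iff] at hbound
  exact EReal.coe_ne_top _ hbound
end

section
/- Let {a_n}_{n=1}^∞ be a monotonically increasing (i.e., non-decreasing) sequence of positive integers such that a_n ≥ n^{1+τ} for some real τ > 0 and every n ∈ ℕ, and such that limsup_{n→∞} a_n^{1/2^n} = ∞. Then the sum ∑_{n=1}^∞ 1/a_n is irrational. -/
open Filter Topology

/-- The product of the first `n` terms `a 1, …, a n`. -/
def prodFirst (a : ℕ → ℕ) (n : ℕ) : ℕ := ∏ i ∈ Finset.range n, a (i + 1)

lemma prodFirst_succ (a : ℕ → ℕ) (n : ℕ) :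
    prodFirst a (n + 1) = prodFirst a n * a (n + 1) :=
  Finset.prod_range_succ _ _

lemma prodFirst_pos {a : ℕ → ℕ} (ha_pos : ∀ n, 1 ≤ n → 0 < a n) (n : ℕ) :
    0 < prodFirst a n :=
  Finset.prod_pos fun i _ => ha_pos (i + 1) (Nat.le_add_left 1 i)

/-- If the series of reciprocals has the rational sum `p / q`, then `q` times the product of the
first `n` terms times the `n`-th tail is a positive integer. -/
lemma one_le_mul_tail {a : ℕ → ℕ} (ha_pos : ∀ n, 1 ≤ n → 0 < a n)
    (hs : Summable fun n : ℕ => 1 / (a (n + 1) : ℝ)) {p : ℤ} {q : ℕ} (hq : 0 < q)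
    (hpq : ∑' n : ℕ, 1 / (a (n + 1) : ℝ) = p / q) (n : ℕ) :
    1 ≤ (q : ℝ) * prodFirst a n * ∑' i : ℕ, 1 / (a (i + n + 1) : ℝ) := by
  have hsn : Summable fun i : ℕ => 1 / (a (i + n + 1) : ℝ) :=
    (summable_nat_add_iff (f := fun n : ℕ => 1 / (a (n + 1) : ℝ)) n).2 hs
  have hterm : ∀ i : ℕ, 0 < 1 / (a (i + n + 1) : ℝ) := fun i => by
    have := ha_pos (i + n + 1) (by omega)
    positivity
  have htail : 0 < ∑' i : ℕ, 1 / (a (i + n + 1) : ℝ) :=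
    hsn.tsum_pos (fun i => (hterm i).le) 0 (hterm 0)
  have hP : (0 : ℝ) < prodFirst a n := by exact_mod_cast prodFirst_pos ha_pos n
  have hq' : (0 : ℝ) < q := by exact_mod_cast hq
  have hpartial : ∃ z : ℤ,
      (prodFirst a n : ℝ) * ∑ i ∈ Finset.range n, 1 / (a (i + 1) : ℝ) = z := by
    refine ⟨∑ i ∈ Finset.range n, ((prodFirst a n / a (i + 1) : ℕ) : ℤ), ?_⟩
    rw [Finset.mul_sum]
    rw [Int.cast_sum]
    refine Finset.sum_congr rfl fun i hi => ?_
    have hdvd : a (i + 1) ∣ prodFirst a n := Finset.dvd_prod_of_mem (fun i => a (i + 1)) hi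
    have hne : (a (i + 1) : ℝ) ≠ 0 := by
      exact_mod_cast (ha_pos (i + 1) (by omega)).ne'
    rw [Int.cast_natCast, Nat.cast_div hdvd hne]
    ring
  obtain ⟨z, hz⟩ := hpartial
  have hsplit := hs.sum_add_tsum_nat_add n
  rw [hpq] at hsplit
  have hinteger : (q : ℝ) * prodFirst a n * ∑' i : ℕ, 1 / (a (i + n + 1) : ℝ)
      = ((prodFirst a n * p - q * z : ℤ) : ℝ) := by
    rw [← eq_sub_iff_add_eq'] at hsplit
    rw [hsplit, mul_sub, mul_assoc, mul_assoc, hz]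
    push_cast
    field_simp
  have hpos : 0 < (q : ℝ) * prodFirst a n * ∑' i : ℕ, 1 / (a (i + n + 1) : ℝ) := by positivity
  rw [hinteger] at hpos ⊢
  exact_mod_cast Int.add_one_le_iff.2 (Int.cast_pos.1 hpos)

/-- As long as each term is at most `K * 4 ^ j` times the product of the previous ones, the
products grow at most like iterated squares. -/
lemma prodFirst_le_pow {a : ℕ → ℕ} {K s n : ℕ} (hsn : s ≤ n)
    (h : ∀ j, s ≤ j → j < n → a (j + 1) ≤ K * 4 ^ (j + 1) * prodFirst a j) :
    K * 4 ^ (n + 2) * prodFirst a n ≤ (K * 4 ^ (s + 2) * prodFirst a s) ^ 2 ^ (n - s) := by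
  induction n, hsn using Nat.le_induction with
  | base => simp
  | succ n hsn ih =>
    have ih := ih fun j hj hjn => h j hj (by omega)
    have hn := h n hsn (by omega)
    calc K * 4 ^ (n + 1 + 2) * prodFirst a (n + 1)
        = K * 4 ^ (n + 3) * prodFirst a n * a (n + 1) := by rw [prodFirst_succ]; ring
      _ ≤ K * 4 ^ (n + 3) * prodFirst a n * (K * 4 ^ (n + 1) * prodFirst a n) := by gcongr
      _ = (K * 4 ^ (n + 2) * prodFirst a n) ^ 2 := by ring
      _ ≤ ((K * 4 ^ (s + 2) * prodFirst a s) ^ 2 ^ (n - s)) ^ 2 := by gcongr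
      _ = _ := by rw [← pow_mul, ← pow_succ, Nat.succ_sub hsn]

/-- If the terms past `s` are at least geometric up to a small error `e`, and some later term
`a m` outgrows the iterated squaring of the product at `s`, then some tail is small compared
with the corresponding product. -/
lemma exists_mul_tail_lt_one {a : ℕ → ℕ} (ha_pos : ∀ n, 1 ≤ n → 0 < a n)
    (ha_mono : ∀ n, 1 ≤ n → a n ≤ a (n + 1))
    (hs : Summable fun n : ℕ => 1 / (a (n + 1) : ℝ)) {q K B s m : ℕ} (hq : 0 < q) (hK : 0 < K)
    (hB : K * 4 ^ (s + 2) * prodFirst a s ≤ 2 ^ B) (hqB : 8 * q * (B + q) ≤ K * 2 ^ s)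
    (hsm : s < m) (ham : 2 ^ (B * 2 ^ (m - s)) < a m) {e : ℕ → ℝ} (he : ∀ j, 0 ≤ e j)
    (hes : Summable e) (hsum : ∑' j, e j ≤ 1 / (4 * q * 2 ^ (B * 2 ^ (m - s))))
    (hae : ∀ j, s < j → 1 / (a j : ℝ) ≤ (1 / 2) ^ j + e j) :
    ∃ n, (q : ℝ) * prodFirst a n * ∑' i : ℕ, 1 / (a (i + n + 1) : ℝ) < 1 := by
  classical
  have hex : ∃ n, s ≤ n ∧ n < m ∧ K * 4 ^ (n + 1) * prodFirst a n < a (n + 1) := by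
    by_contra! hcon
    have h1 := prodFirst_le_pow hsm.le hcon
    obtain ⟨m, rfl⟩ : ∃ m', m = m' + 1 := ⟨m - 1, by omega⟩
    have h2 : a (m + 1) ≤ K * 4 ^ (m + 1 + 2) * prodFirst a (m + 1) := by
      rw [prodFirst_succ, ← mul_assoc]
      exact Nat.le_mul_of_pos_left _ (Nat.mul_pos (by positivity) (prodFirst_pos ha_pos m))
    have h3 : (K * 4 ^ (s + 2) * prodFirst a s) ^ 2 ^ (m + 1 - s) ≤ 2 ^ (B * 2 ^ (m + 1 - s)) := by
      rw [pow_mul]; gcongr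
    omega
  obtain ⟨hsn, hnm, hn⟩ := Nat.find_spec hex
  have hmin := fun j (hj : j < Nat.find hex) => Nat.find_min hex hj
  generalize Nat.find hex = n at hsn hnm hn hmin
  refine ⟨n, ?_⟩
  have hP := prodFirst_pos ha_pos n
  have hgrow : 16 * prodFirst a n ≤ 2 ^ (B * 2 ^ (n - s)) := by
    have h1 : K * 4 ^ (n + 2) * prodFirst a n ≤ _ := prodFirst_le_pow hsn fun j hj hjn => by
      by_contra! hlt
      exact hmin j hjn ⟨hj, by omega, hlt⟩
    calc 16 * prodFirst a n ≤ K * 4 ^ (n + 2) * prodFirst a n := by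
          gcongr
          calc 16 = 1 * 4 ^ 2 := by norm_num
            _ ≤ K * 4 ^ (n + 2) := by gcongr <;> omega
      _ ≤ _ := h1
      _ ≤ (2 ^ B) ^ 2 ^ (n - s) := by gcongr
      _ = _ := by rw [pow_mul]
  obtain ⟨T, hT⟩ : ∃ T, T = B * 2 ^ (n - s) + q := ⟨_, rfl⟩
  have hT1 : 16 * q * prodFirst a n ≤ 2 ^ T := by
    have := (Nat.lt_two_pow_self (n := q)).le
    calc 16 * q * prodFirst a n = (16 * prodFirst a n) * q := by ring
      _ ≤ 2 ^ (B * 2 ^ (n - s)) * 2 ^ q := by gcongr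
      _ = 2 ^ T := by rw [hT, pow_add]
  have hT2 : 8 * q * T ≤ K * 4 ^ (n + 1) := by
    have h1 : 1 ≤ 2 ^ (n - s) := Nat.one_le_two_pow
    calc 8 * q * T ≤ 8 * q * ((B + q) * 2 ^ (n - s)) := by
          gcongr; rw [hT]; nlinarith
      _ = 8 * q * (B + q) * 2 ^ (n - s) := by ring
      _ ≤ K * 2 ^ s * 2 ^ (n - s) := by gcongr
      _ = K * 2 ^ n := by rw [mul_assoc, ← pow_add, Nat.add_sub_cancel' hsn]
      _ ≤ K * 4 ^ (n + 1) := by gcongr <;> omega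
  have hT3 : 8 * q * T * prodFirst a n ≤ a (n + 1) :=
    (Nat.mul_le_mul_right _ hT2).trans hn.le
  have hgm : 16 * prodFirst a n ≤ 2 ^ (B * 2 ^ (m - s)) :=
    hgrow.trans (by gcongr <;> norm_num)
  have hmono : ∀ i, a (n + 1) ≤ a (i + n + 1) := fun i => by
    induction i with
    | zero => simp
    | succ i ih =>
      have := ha_mono (i + n + 1) (by omega)
      rw [show i + 1 + n + 1 = i + n + 1 + 1 by ring]
      exact ih.trans this
  have hsn' : Summable fun i : ℕ => 1 / (a (i + n + 1) : ℝ) :=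
    (summable_nat_add_iff (f := fun n : ℕ => 1 / (a (n + 1) : ℝ)) n).2 hs
  have hPr : (0 : ℝ) < prodFirst a n := by exact_mod_cast hP
  have hqr : (0 : ℝ) < q := by exact_mod_cast hq
  have har : (0 : ℝ) < a (n + 1) := by exact_mod_cast ha_pos (n + 1) (by omega)
  have hhead : ∑ i ∈ Finset.range T, 1 / (a (i + n + 1) : ℝ) ≤ T / a (n + 1) := by
    calc _ ≤ ∑ i ∈ Finset.range T, 1 / (a (n + 1) : ℝ) := by
          refine Finset.sum_le_sum fun i _ => ?_
          have := hmono i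
          gcongr
      _ = _ := by simp [div_eq_mul_inv]
  have hgeom : HasSum (fun i : ℕ => (1 / 2 : ℝ) ^ T * (1 / 2) ^ i) ((1 / 2) ^ T * 2) :=
    hasSum_geometric_two.mul_left _
  have hes' : Summable fun i => e (i + (T + n + 1)) := (summable_nat_add_iff _).2 hes
  have hetail : ∑' i, e (i + (T + n + 1)) ≤ ∑' j, e j := by
    rw [← hes.sum_add_tsum_nat_add (T + n + 1)]
    exact le_add_of_nonneg_left (Finset.sum_nonneg fun i _ => he i)
  have htail : ∑' i, 1 / (a (i + T + n + 1) : ℝ) ≤ (1 / 2) ^ T * 2 + ∑' j, e j := by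
    refine le_trans ?_ (add_le_add_right hetail _)
    rw [← hgeom.tsum_eq, ← hgeom.summable.tsum_add hes']
    refine Summable.tsum_le_tsum (fun i => ?_) ((summable_nat_add_iff T).2 hsn')
      (hgeom.summable.add hes')
    refine (hae (i + T + n + 1) (by omega)).trans ?_
    rw [show i + (T + n + 1) = i + T + n + 1 by ring, ← pow_add]
    gcongr ?_ + _
    exact pow_le_pow_of_le_one (by norm_num) (by norm_num) (by omega)
  have hsplit := hsn'.sum_add_tsum_nat_add T
  have hT1r : 16 * (q : ℝ) * prodFirst a n ≤ 2 ^ T := by exact_mod_cast hT1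
  have hT3r : 8 * (q : ℝ) * T * prodFirst a n ≤ a (n + 1) := by exact_mod_cast hT3
  have hgmr : 16 * (prodFirst a n : ℝ) ≤ 2 ^ (B * 2 ^ (m - s)) := by exact_mod_cast hgm
  have b1 : (q : ℝ) * prodFirst a n * (T / a (n + 1)) ≤ 1 / 8 := by
    rw [← mul_div_assoc, div_le_iff₀ har]; linarith
  have b2 : (q : ℝ) * prodFirst a n * ((1 / 2) ^ T * 2) ≤ 1 / 8 := by
    rw [one_div_pow, show (q : ℝ) * prodFirst a n * (1 / 2 ^ T * 2)
      = (2 * q * prodFirst a n) / 2 ^ T by ring, div_le_iff₀ (by positivity)]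
    linarith
  have b3 : (q : ℝ) * prodFirst a n * ∑' j, e j ≤ 1 / 8 := by
    refine (mul_le_mul_of_nonneg_left hsum (by positivity)).trans ?_
    rw [mul_one_div, div_le_iff₀ (by positivity)]
    nlinarith
  calc (q : ℝ) * prodFirst a n * ∑' i : ℕ, 1 / (a (i + n + 1) : ℝ)
      ≤ q * prodFirst a n * (T / a (n + 1) + ((1 / 2) ^ T * 2 + ∑' j, e j)) := by
        rw [← hsplit]; gcongr
    _ < 1 := by rw [mul_add, mul_add]; linarith

/-- A sequence with `limsup a n ^ (1 / 2 ^ n) = ∞` exceeds `2 ^ (c * 2 ^ n)` infinitely often. -/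
lemma frequently_two_pow_lt {a : ℕ → ℕ}
    (hlimsup : limsup (fun n : ℕ => (((a n : ℝ) ^ (1 / (2 : ℝ) ^ n) : ℝ) : EReal)) atTop = ⊤)
    (c : ℕ) : ∃ᶠ n in atTop, 2 ^ (c * 2 ^ n) < a n := by
  have h : (((2 : ℝ) ^ c : ℝ) : EReal) <
      limsup (fun n : ℕ => (((a n : ℝ) ^ (1 / (2 : ℝ) ^ n) : ℝ) : EReal)) atTop := by
    rw [hlimsup]; exact EReal.coe_lt_top _
  refine (frequently_lt_of_lt_limsup (by isBoundedDefault) h).mono fun n hn => ?_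
  rw [EReal.coe_lt_coe_iff] at hn
  have h2 := pow_lt_pow_left₀ hn (by positivity) (n := 2 ^ n) (by positivity)
  rw [← Real.rpow_natCast ((a n : ℝ) ^ _), ← Real.rpow_mul (by positivity)] at h2
  push_cast at h2
  rw [one_div, inv_mul_cancel₀ (by positivity), Real.rpow_one, ← pow_mul] at h2
  exact_mod_cast h2

lemma eventually_mul_quadratic_le_two_pow (c : ℝ) :
    ∀ᶠ s : ℕ in atTop, c * ((s ^ 2 + 2 * s + 4 : ℕ) : ℝ) ≤ 2 ^ s := by
  have h := tendsto_pow_const_div_const_pow_of_one_lt 2 (one_lt_two (α := ℝ))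
  have h2 := h.eventually (gt_mem_nhds (show (0 : ℝ) < 1 / (7 * (|c| + 1)) by positivity))
  filter_upwards [h2, eventually_ge_atTop 1] with s hs hs1
  have hs1' : (1 : ℝ) ≤ s := by exact_mod_cast hs1
  rw [div_lt_div_iff₀ (by positivity) (by positivity)] at hs
  have h7 : ((s ^ 2 + 2 * s + 4 : ℕ) : ℝ) ≤ 7 * s ^ 2 := by push_cast; nlinarith
  calc c * ((s ^ 2 + 2 * s + 4 : ℕ) : ℝ) ≤ (|c| + 1) * (7 * s ^ 2) := by
        have := le_abs_self c
        gcongr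
        linarith
    _ ≤ 2 ^ s := by linarith

lemma monotone_from_one {a : ℕ → ℕ} (ha_mono : ∀ n, 1 ≤ n → a n ≤ a (n + 1)) {i j : ℕ}
    (hi : 1 ≤ i) (hij : i ≤ j) : a i ≤ a j := by
  induction j, hij using Nat.le_induction with
  | base => exact le_rfl
  | succ j hij ih => exact ih.trans (ha_mono j (hi.trans hij))

/-- A term past `m` of a sequence with `a j ≥ j ^ (1 + τ)` has a reciprocal bounded by a power of
`a m` times the term of a convergent `p`-series. -/
lemma one_div_le_rpow_mul {x y j τ : ℝ} (hτ : 0 < τ) (hx : 0 < x) (hxy : x ≤ y) (hj : 0 < j)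
    (hjy : j ^ (1 + τ) ≤ y) :
    1 / y ≤ x ^ (-(τ / 2 / (1 + τ))) * (1 / j ^ (1 + τ / 2)) := by
  have hy : 0 < y := hx.trans_le hxy
  have h1 : x ^ (τ / 2 / (1 + τ)) ≤ y ^ (τ / 2 / (1 + τ)) :=
    Real.rpow_le_rpow hx.le hxy (by positivity)
  have h2 : j ^ (1 + τ / 2) ≤ y ^ ((1 + τ / 2) / (1 + τ)) := by
    calc j ^ (1 + τ / 2) = (j ^ (1 + τ)) ^ ((1 + τ / 2) / (1 + τ)) := by
          rw [← Real.rpow_mul hj.le]; congr 1; field_simp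
      _ ≤ _ := Real.rpow_le_rpow (by positivity) hjy (by positivity)
  have h3 : y ^ (τ / 2 / (1 + τ)) * y ^ ((1 + τ / 2) / (1 + τ)) = y := by
    rw [← Real.rpow_add hy]
    convert Real.rpow_one y using 2
    field_simp
    ring
  rw [Real.rpow_neg hx.le, inv_mul_eq_div, div_div, mul_comm (j ^ _)]
  apply one_div_le_one_div_of_le (by positivity)
  calc x ^ (τ / 2 / (1 + τ)) * j ^ (1 + τ / 2)
      ≤ y ^ (τ / 2 / (1 + τ)) * y ^ ((1 + τ / 2) / (1 + τ)) := by gcongr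
    _ = y := h3

/-- Sequences that are eventually at least `2 ^ n` have a small tail. -/
lemma exists_mul_tail_lt_one_of_eventually {a : ℕ → ℕ} (ha_pos : ∀ n, 1 ≤ n → 0 < a n)
    (ha_mono : ∀ n, 1 ≤ n → a n ≤ a (n + 1))
    (hs : Summable fun n : ℕ => 1 / (a (n + 1) : ℝ))
    (hfreq : ∀ c : ℕ, ∃ᶠ n in atTop, 2 ^ (c * 2 ^ n) < a n) {q : ℕ} (hq : 0 < q)
    (hev : ∀ᶠ n in atTop, 2 ^ n ≤ a n) :
    ∃ n, (q : ℝ) * prodFirst a n * ∑' i : ℕ, 1 / (a (i + n + 1) : ℝ) < 1 := by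
  obtain ⟨s, hge⟩ := eventually_atTop.1 hev
  obtain ⟨C, hC⟩ : ∃ C, C = 2 * s + 4 + prodFirst a s + q := ⟨_, rfl⟩
  obtain ⟨κ, hκ⟩ := (eventually_mul_quadratic_le_two_pow (8 * q * (C + 1) : ℕ)).exists
  have hκ' : 8 * q * (C + 1) * (κ ^ 2 + 2 * κ + 4) ≤ 2 ^ κ := by exact_mod_cast hκ
  obtain ⟨m, ham, hsm⟩ := ((hfreq (κ + 2 * s + 4 + prodFirst a s)).and_eventually
    (eventually_gt_atTop s)).exists
  refine exists_mul_tail_lt_one (K := 2 ^ κ) (B := κ + 2 * s + 4 + prodFirst a s) (s := s) (m := m)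
    (e := fun _ => 0) ha_pos ha_mono hs hq (by positivity) ?_ ?_ hsm ?_
    (fun _ => le_rfl) summable_zero (by rw [tsum_zero]; positivity) ?_
  · have := (Nat.lt_two_pow_self (n := prodFirst a s)).le
    calc 2 ^ κ * 4 ^ (s + 2) * prodFirst a s ≤ 2 ^ κ * 4 ^ (s + 2) * 2 ^ prodFirst a s := by gcongr
      _ = _ := by
        rw [show (4 : ℕ) = 2 ^ 2 by norm_num, ← pow_mul, ← pow_add, ← pow_add]
        ring
  · calc 8 * q * (κ + 2 * s + 4 + prodFirst a s + q) = 8 * q * (κ + C) := by rw [hC]; ring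
      _ ≤ 8 * q * ((C + 1) * (κ ^ 2 + 2 * κ + 4)) := by gcongr; nlinarith [Nat.zero_le (C * κ)]
      _ = 8 * q * (C + 1) * (κ ^ 2 + 2 * κ + 4) := by ring
      _ ≤ 2 ^ κ := hκ'
      _ ≤ 2 ^ κ * 2 ^ s := Nat.le_mul_of_pos_right _ (by positivity)
  · refine lt_of_le_of_lt ?_ ham
    gcongr
    · norm_num
    · norm_num
    · omega
  · intro j hj
    have h1 : (2 : ℝ) ^ j ≤ a j := by exact_mod_cast hge j hj.le
    rw [add_zero, one_div_pow]
    gcongr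

/-- Sequences that drop below `2 ^ n` infinitely often have a small tail. -/
lemma exists_mul_tail_lt_one_of_frequently {a : ℕ → ℕ} (ha_pos : ∀ n, 1 ≤ n → 0 < a n)
    (ha_mono : ∀ n, 1 ≤ n → a n ≤ a (n + 1)) {τ : ℝ} (hτ : 0 < τ)
    (ha : ∀ n : ℕ, 1 ≤ n → (n : ℝ) ^ (1 + τ) ≤ (a n : ℝ))
    (hs : Summable fun n : ℕ => 1 / (a (n + 1) : ℝ))
    (hfreq : ∀ c : ℕ, ∃ᶠ n in atTop, 2 ^ (c * 2 ^ n) < a n) {q : ℕ} (hq : 0 < q)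
    (hlow : ∃ᶠ n in atTop, a n < 2 ^ n) :
    ∃ n, (q : ℝ) * prodFirst a n * ∑' i : ℕ, 1 / (a (i + n + 1) : ℝ) < 1 := by
  obtain ⟨η, hη⟩ : ∃ η, η = τ / 2 / (1 + τ) := ⟨_, rfl⟩
  have hη0 : 0 < η := by rw [hη]; positivity
  have hps : Summable fun j : ℕ => 1 / (j : ℝ) ^ (1 + τ / 2) :=
    Real.summable_one_div_nat_rpow.2 (by linarith)
  obtain ⟨S, hS⟩ : ∃ S, S = ∑' j : ℕ, 1 / (j : ℝ) ^ (1 + τ / 2) := ⟨_, rfl⟩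
  have hS0 : 0 ≤ S := by rw [hS]; exact tsum_nonneg fun j => by positivity
  obtain ⟨s₀, hs₀⟩ := eventually_atTop.1 (((eventually_mul_quadratic_le_two_pow
    (8 * q * (1 + q) : ℕ)).and (eventually_mul_quadratic_le_two_pow (2 / η))).and
    ((eventually_mul_quadratic_le_two_pow (4 * q * S)).and (eventually_ge_atTop 1)))
  obtain ⟨s₁, hs₁low, hs₁⟩ := (hlow.and_eventually (eventually_ge_atTop s₀)).exists
  obtain ⟨m, ham, hsm₁⟩ := ((hfreq 1).and_eventually (eventually_gt_atTop s₁)).exists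
  rw [one_mul] at ham
  obtain ⟨s, hss₁, hsm, hslow, hbetween⟩ : ∃ s, s₁ ≤ s ∧ s < m ∧ a s < 2 ^ s ∧
      ∀ j, s < j → j < m → 2 ^ j ≤ a j := by
    classical
    refine ⟨Nat.findGreatest (fun j => a j < 2 ^ j) (m - 1),
      Nat.le_findGreatest (by omega) hs₁low,
      (Nat.findGreatest_le _).trans_lt (by omega),
      Nat.findGreatest_spec (P := fun j => a j < 2 ^ j) (m := s₁) (by omega) hs₁low,
      fun j hj hjm => not_lt.1 (Nat.findGreatest_is_greatest
        (P := fun j => a j < 2 ^ j) hj (by omega))⟩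
  obtain ⟨⟨hq1, hη1⟩, hS1, hs1⟩ := hs₀ s (hs₁.trans hss₁)
  obtain ⟨B, hBdef⟩ : ∃ B, B = s ^ 2 + 2 * s + 4 := ⟨_, rfl⟩
  rw [← hBdef] at hq1 hη1 hS1
  have hqB : 8 * q * (1 + q) * B ≤ 2 ^ s := by exact_mod_cast hq1
  have hB1 : s + 1 ≤ B := by rw [hBdef]; nlinarith
  have hB2 : B ≤ 2 ^ s := by
    refine le_trans (Nat.le_mul_of_pos_left _ ?_) hqB
    positivity
  have hm2 : 2 ^ s * 2 ^ (m - s) = 2 ^ m := by rw [← pow_add, Nat.add_sub_cancel' hsm.le]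
  have hm2r : (2 : ℝ) ^ s * 2 ^ (m - s) = 2 ^ m := by exact_mod_cast hm2
  have hamr : (2 : ℝ) ^ 2 ^ m < a m := by exact_mod_cast ham
  have ham0 : (0 : ℝ) < a m := lt_trans (by positivity) hamr
  have hηB : (2 : ℝ) * B ≤ η * 2 ^ s := by
    rw [div_mul_eq_mul_div, div_le_iff₀ hη0] at hη1
    linarith
  refine exists_mul_tail_lt_one (K := 1) (B := B) (s := s) (m := m)
    (e := fun j => (a m : ℝ) ^ (-η) * (1 / (j : ℝ) ^ (1 + τ / 2))) ha_pos ha_mono hs hq one_pos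
    ?_ ?_ hsm ?_ (fun j => by positivity) (hps.mul_left _) ?_ ?_
  · have hprod : prodFirst a s ≤ (2 ^ s) ^ s := by
      have := Finset.prod_le_pow_card (Finset.range s) (fun i => a (i + 1)) (2 ^ s) fun i hi =>
        (monotone_from_one ha_mono (Nat.le_add_left 1 i)
          (Nat.succ_le_of_lt (Finset.mem_range.1 hi))).trans hslow.le
      rwa [Finset.card_range] at this
    calc 1 * 4 ^ (s + 2) * prodFirst a s ≤ 1 * 4 ^ (s + 2) * (2 ^ s) ^ s := by gcongr
      _ = 2 ^ B := by
        rw [show (4 : ℕ) = 2 ^ 2 by norm_num, ← pow_mul, ← pow_mul, one_mul, ← pow_add, hBdef]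
        congr 1; ring
  · rw [one_mul]
    refine le_trans ?_ hqB
    rw [mul_assoc (8 * q)]
    gcongr
    nlinarith [Nat.mul_le_mul_left q (show 1 ≤ B by omega)]
  · refine lt_of_le_of_lt ?_ ham
    rw [← hm2]
    gcongr
    norm_num
  · rw [tsum_mul_left, ← hS, Real.rpow_neg ham0.le, inv_mul_eq_div,
      div_le_div_iff₀ (by positivity) (by positivity), one_mul]
    obtain ⟨D, hD⟩ : ∃ D, D = B * 2 ^ (m - s) := ⟨_, rfl⟩
    rw [← hD]
    have hDs : s ≤ D := by
      have : 1 ≤ 2 ^ (m - s) := Nat.one_le_two_pow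
      rw [hD]; nlinarith
    have hSq : 4 * q * S ≤ 2 ^ D := by
      have hB1r : (1 : ℝ) ≤ B := by exact_mod_cast (show 1 ≤ B by omega)
      calc 4 * q * S ≤ 4 * q * S * B := le_mul_of_one_le_right (by positivity) hB1r
        _ ≤ 2 ^ s := hS1
        _ ≤ 2 ^ D := pow_le_pow_right₀ (by norm_num) hDs
    have hDm : (2 : ℝ) * D ≤ 2 ^ m * η := by
      rw [hD, ← hm2r]
      push_cast
      have : (0 : ℝ) < 2 ^ (m - s) := by positivity
      nlinarith
    calc S * (4 * q * 2 ^ D) = 4 * q * S * 2 ^ D := by ring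
      _ ≤ 2 ^ D * 2 ^ D := by gcongr
      _ = (2 : ℝ) ^ ((2 : ℝ) * D) := by
        rw [← pow_add, ← Real.rpow_natCast]; congr 1; push_cast; ring
      _ ≤ (2 : ℝ) ^ ((2 : ℝ) ^ m * η) := Real.rpow_le_rpow_of_exponent_le (by norm_num) hDm
      _ = ((2 : ℝ) ^ 2 ^ m) ^ η := by
        rw [Real.rpow_mul (by norm_num), ← Real.rpow_natCast 2 (2 ^ m)]
        push_cast
        rfl
      _ ≤ (a m : ℝ) ^ η := Real.rpow_le_rpow (by positivity) hamr.le hη0.le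
  · intro j hj
    have he : 0 ≤ (a m : ℝ) ^ (-η) * (1 / (j : ℝ) ^ (1 + τ / 2)) := by positivity
    by_cases hjm : j < m
    · have h1 : (2 : ℝ) ^ j ≤ a j := by exact_mod_cast hbetween j hj hjm
      refine le_add_of_le_of_nonneg ?_ he
      rw [one_div_pow]
      gcongr
    · refine le_add_of_nonneg_of_le (by positivity) ?_
      rw [hη]
      exact one_div_le_rpow_mul hτ ham0
        (by exact_mod_cast monotone_from_one ha_mono (by omega) (not_lt.1 hjm))
        (by exact_mod_cast (show 0 < j by omega)) (ha j (by omega))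

/-- **Erdős, 1975.** If `a` is a non-decreasing sequence of positive integers
with `a_n ≥ n^(1+τ)` for some `τ > 0` and all `n ≥ 1`, and `limsup_n a_n^(1/2^n) = ∞`
(limsup taken in `EReal`), then `∑_{n≥1} 1/a_n` is irrational. -/
theorem stmt_6 (a : ℕ → ℕ) (ha_pos : ∀ n, 1 ≤ n → 0 < a n)
    (ha_mono : ∀ n, 1 ≤ n → a n ≤ a (n + 1))
    (τ : ℝ) (hτ : 0 < τ)
    (ha : ∀ n : ℕ, 1 ≤ n → (n : ℝ) ^ (1 + τ) ≤ (a n : ℝ))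
    (hlimsup : limsup (fun n : ℕ => (((a n : ℝ) ^ (1 / (2 : ℝ) ^ n) : ℝ) : EReal)) atTop = ⊤) :
    Irrational (∑' n : ℕ, 1 / (a (n + 1) : ℝ)) := by
  have hs : Summable fun n : ℕ => 1 / (a (n + 1) : ℝ) := by
    have hps : Summable fun n : ℕ => 1 / ((n + 1 : ℕ) : ℝ) ^ (1 + τ) :=
      (summable_nat_add_iff (f := fun n : ℕ => 1 / (n : ℝ) ^ (1 + τ)) 1).2
        (Real.summable_one_div_nat_rpow.2 (by linarith))
    refine Summable.of_nonneg_of_le (fun n => by positivity) (fun n => ?_) hps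
    exact one_div_le_one_div_of_le (by positivity) (ha (n + 1) (by omega))
  rintro ⟨r, hr⟩
  have hrq : ∑' n : ℕ, 1 / (a (n + 1) : ℝ) = (r.num : ℝ) / (r.den : ℝ) := by
    rw [← hr]; exact Rat.cast_def r
  obtain ⟨n, hn⟩ :
      ∃ n, (r.den : ℝ) * prodFirst a n * ∑' i : ℕ, 1 / (a (i + n + 1) : ℝ) < 1 := by
    have hfreq := frequently_two_pow_lt hlimsup
    by_cases hev : ∀ᶠ n in atTop, 2 ^ n ≤ a n
    · exact exists_mul_tail_lt_one_of_eventually ha_pos ha_mono hs hfreq r.den_pos hev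
    · refine exists_mul_tail_lt_one_of_frequently ha_pos ha_mono hτ ha hs hfreq r.den_pos ?_
      simpa only [not_eventually, not_le] using hev
  exact hn.not_ge (one_le_mul_tail ha_pos hs r.den_pos hrq n)
end

section
/- If {δ_n}_{n=1}^∞ and {μ_n}_{n=1}^∞ are sequences of positive real numbers with ∑_{n=1}^∞ δ_n < ∞ and limsup_{n→∞} μ_n = ∞, then the set P := { m ∈ ℕ : μ_{m+1} > (1 + δ_m) · max_{n ≤ m} μ_n } is infinite. -/
open Filter Topology

open Real in
/-- If each new term of `μ` is eventually at most `1 + δ m` times some earlier term, with `δ`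
summable and nonnegative, then `μ` is bounded above. -/
theorem exists_forall_le_of_le_one_add_mul {δ μ : ℕ → ℝ} (hδ : ∀ n, 1 ≤ n → 0 ≤ δ n)
    (hμ : ∀ n, 1 ≤ n → 0 ≤ μ n) (hδ_sum : Summable fun n : ℕ => δ (n + 1)) (N : ℕ)
    (h : ∀ m, N < m → ∃ n ∈ Finset.Icc 1 m, μ (m + 1) ≤ (1 + δ m) * μ n) :
    ∃ B, ∀ n, 1 ≤ n → μ n ≤ B := by
  set C := ∑ n ∈ Finset.Icc 1 (N + 1), μ n
  have hC0 : 0 ≤ C := Finset.sum_nonneg fun n hn => hμ n (Finset.mem_Icc.1 hn).1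
  have hδ' : ∀ i : ℕ, 0 ≤ δ (i + 1) := fun i => hδ _ (by omega)
  have key : ∀ k, N ≤ k → ∀ n ∈ Finset.Icc 1 (k + 1),
      μ n ≤ C * exp (∑ i ∈ Finset.range k, δ (i + 1)) := by
    intro k hk
    induction k, hk using Nat.le_induction with
    | base =>
      intro n hn
      have h1 : μ n ≤ C := Finset.single_le_sum
        (fun j hj => hμ j (Finset.mem_Icc.1 hj).1) hn
      exact h1.trans (le_mul_of_one_le_right hC0
        (one_le_exp (Finset.sum_nonneg fun i _ => hδ' i)))
    | succ k hk ih =>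
      intro n hn
      rw [Finset.mem_Icc] at hn
      rw [Finset.sum_range_succ, exp_add]
      obtain hn' | rfl : n ≤ k + 1 ∨ n = k + 1 + 1 := by omega
      · rw [← mul_assoc]
        exact (ih n (Finset.mem_Icc.2 ⟨hn.1, hn'⟩)).trans
          (le_mul_of_one_le_right (by positivity) (one_le_exp (hδ' k)))
      · obtain ⟨j, hj, hle⟩ := h (k + 1) (by omega)
        calc μ (k + 1 + 1) ≤ (1 + δ (k + 1)) * μ j := hle
          _ ≤ exp (δ (k + 1)) * (C * exp (∑ i ∈ Finset.range k, δ (i + 1))) :=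
            mul_le_mul (by linarith [add_one_le_exp (δ (k + 1))]) (ih j hj)
              (hμ j (Finset.mem_Icc.1 hj).1) (exp_pos _).le
          _ = _ := by ring
  refine ⟨C * exp (∑' i, δ (i + 1)), fun n hn => ?_⟩
  refine (key (N + n) (by omega) n (Finset.mem_Icc.2 ⟨hn, by omega⟩)).trans ?_
  gcongr
  exact hδ_sum.sum_le_tsum _ fun i _ => hδ' i

/-- **Borel's trick.** If `δ` and `μ` are sequences of positive reals with
`∑_{n≥1} δ_n < ∞` and `limsup_n μ_n = ∞` (limsup taken in `EReal`), then the set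
`P = { m ≥ 1 : μ_{m+1} > (1+δ_m) · max_{1 ≤ n ≤ m} μ_n }` is infinite. The condition
`μ_{m+1} > (1+δ_m) · max_{1 ≤ n ≤ m} μ_n` is expressed equivalently (since `1+δ_m > 0`)
as `∀ n ∈ [1, m], (1+δ_m) μ_n < μ_{m+1}`. -/
theorem stmt_8 (δ μ : ℕ → ℝ) (hδ : ∀ n, 1 ≤ n → 0 < δ n) (hμ : ∀ n, 1 ≤ n → 0 < μ n)
    (hδ_sum : Summable fun n : ℕ => δ (n + 1))
    (hμ_limsup : limsup (fun n : ℕ => ((μ n : ℝ) : EReal)) atTop = ⊤) :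
    {m : ℕ | 1 ≤ m ∧ ∀ n ∈ Finset.Icc 1 m, (1 + δ m) * μ n < μ (m + 1)}.Infinite := by
  intro hfin
  obtain ⟨N, hN⟩ := hfin.bddAbove
  obtain ⟨B, hB⟩ := exists_forall_le_of_le_one_add_mul (fun n hn => (hδ n hn).le)
    (fun n hn => (hμ n hn).le) hδ_sum N fun m hm => by
      by_contra! hcon
      exact hm.not_ge (hN ⟨by omega, hcon⟩)
  have hle : limsup (fun n : ℕ => ((μ n : ℝ) : EReal)) atTop ≤ (B : EReal) :=
    limsup_le_of_le (h := (eventually_ge_atTop 1).mono fun n hn => EReal.coe_le_coe (hB n hn))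
  rw [hμ_limsup] at hle
  exact EReal.coe_ne_top B (top_le_iff.1 hle)
end
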